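/- Let n ≥ 2 and b > −1 be a constant. Let ψ be a real-valued function on the closed half-space ℝⁿ₊ ∪ {x_n = 0} that is C¹ there with globally Lipschitz gradient, C² in the open half-space ℝⁿ₊, and satisfies det M_b[ψ](x) = 1 for all x ∈ ℝⁿ₊. Assume ∂ψ/∂x_n(x',0) = 0 for all x' ∈ ℝ^{n-1}, and that the equation is uniformly elliptic for ψ, i.e. there is Ĉ > 0 with Ĉ⁻¹ I ≤ M_b[ψ](x) ≤ Ĉ I for all x ∈ ℝⁿ₊. Then ψ is C^{2,α} up to the boundary for some α ∈ (0,1): the second derivatives D²ψ extend continuously to the closed half-space, and there is a constant C such that ‖D²ψ(x) − D²ψ(x̃)‖ ≤ C|x − x̃|^α for all x, x̃ ∈ ℝ^{n-1} × [0,1]. -/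

import Mathlib

open MeasureTheory
open scoped ENNReal

noncomputable section

/-- Euclidean n-space. -/
abbrev Eu (n : ℕ) := EuclideanSpace ℝ (Fin n)

/-- Partial derivative ∂ψ/∂xᵢ. -/
def pd {n : ℕ} (ψ : Eu n → ℝ) (i : Fin n) (x : Eu n) : ℝ :=
  fderiv ℝ ψ x (EuclideanSpace.single i 1)

/-- Second partial derivative ∂²ψ/∂xᵢ∂xⱼ. -/
def pd2 {n : ℕ} (ψ : Eu n → ℝ) (i j : Fin n) (x : Eu n) : ℝ :=
  pd (pd ψ j) i x


/-- The matrix `M_b[ψ](x)`: Hessian of `ψ`, with the `(n,n)` entry replaced by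
`ψ_{x_n x_n} + b ψ_{x_n}/x_n`.  Here `ln` denotes the last index. -/
def Mb {n : ℕ} (b : ℝ) (ψ : Eu n → ℝ) (ln : Fin n) (x : Eu n) :
    Matrix (Fin n) (Fin n) ℝ :=
  Matrix.of fun i j =>
    if i = ln ∧ j = ln then pd2 ψ ln ln x + b * pd ψ ln x / x ln
    else pd2 ψ i j x

/-- `A ≤ B` for symmetric matrices: `B - A` is positive semidefinite. -/
def matLE {n : ℕ} (A B : Matrix (Fin n) (Fin n) ℝ) : Prop := (B - A).PosSemidef

section RegularityProof

/-- Real square matrices. -/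
abbrev Mt (n : ℕ) := Matrix (Fin n) (Fin n) ℝ

open scoped MatrixOrder in
lemma psd_factor {n : ℕ} {A : Mt n} (hA : A.PosSemidef) :
    ∃ C : Mt n, A = C.transpose * C := by
  obtain ⟨C, hC⟩ := CStarAlgebra.nonneg_iff_eq_star_mul_self.mp hA.nonneg
  exact ⟨C, by rw [hC, Matrix.star_eq_conjTranspose, Matrix.conjTranspose_eq_transpose_of_trivial]⟩

lemma psd_conj {n : ℕ} {A : Mt n} (hA : A.PosSemidef) (C : Mt n) :
    (C * A * C.transpose).PosSemidef := by
  simpa [Matrix.conjTranspose_eq_transpose_of_trivial] using hA.mul_mul_conjTranspose_same C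

lemma trace_mul_nonneg {n : ℕ} {A B : Mt n} (hA : A.PosSemidef) (hB : B.PosSemidef) :
    0 ≤ (A * B).trace := by
  obtain ⟨C, rfl⟩ := psd_factor hA
  rw [Matrix.mul_assoc, Matrix.trace_mul_comm]
  exact (psd_conj hB C).trace_nonneg

lemma det_rpow_le_trace {n : ℕ} (hn : 0 < n) {S : Mt n} (hS : S.PosSemidef) :
    S.det ^ ((n : ℝ)⁻¹) ≤ S.trace / n := by
  have hn' : (n : ℝ) ≠ 0 := by positivity
  have h := Real.geom_mean_le_arith_mean_weighted (Finset.univ : Finset (Fin n))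
    (fun _ => (n : ℝ)⁻¹) hS.1.eigenvalues (fun _ _ => by positivity)
    (by simp [hn']) (fun i _ => hS.eigenvalues_nonneg i)
  rw [Real.finsetProd_rpow _ _ (fun i _ => hS.eigenvalues_nonneg i), ← Finset.mul_sum] at h
  have h1 := hS.1.det_eq_prod_eigenvalues
  have h2 := hS.1.trace_eq_sum_eigenvalues
  simp only [RCLike.ofReal_real_eq_id, id_eq] at h1 h2
  rw [h1, h2, div_eq_inv_mul]
  exact h

lemma det_le_trace_pow {n : ℕ} (hn : 0 < n) {S : Mt n} (hS : S.PosSemidef) :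
    S.det ≤ (S.trace / n) ^ n := by
  have h := det_rpow_le_trace hn hS
  have h0 : 0 ≤ S.det ^ ((n : ℝ)⁻¹) := Real.rpow_nonneg hS.det_nonneg _
  calc S.det = (S.det ^ ((n : ℝ)⁻¹)) ^ n :=
        (Real.rpow_inv_natCast_pow hS.det_nonneg hn.ne').symm
    _ ≤ _ := pow_le_pow_left₀ h0 h n

lemma trace_mul_ge {n : ℕ} (hn : 0 < n) {A B : Mt n} (hA : A.PosSemidef) (hB : B.PosSemidef)
    (h : 1 ≤ A.det * B.det) : (n : ℝ) ≤ (A * B).trace := by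
  obtain ⟨C, rfl⟩ := psd_factor hA
  rw [Matrix.mul_assoc, Matrix.trace_mul_comm]
  have hS := psd_conj hB C
  have h1 := det_rpow_le_trace hn hS
  have h2 : (C * B * C.transpose).det = (C.transpose * C).det * B.det := by
    simp only [Matrix.det_mul, Matrix.det_transpose]; ring
  have hn' : (0 : ℝ) < n := by positivity
  have h3 : 1 ≤ (C * B * C.transpose).det ^ ((n : ℝ)⁻¹) :=
    Real.one_le_rpow (by rw [h2]; exact h) (by positivity)
  have := (le_div_iff₀ hn').1 (h3.trans h1)
  linarith

lemma trace_mul_gt {n : ℕ} (hn : 0 < n) {A B : Mt n} (hA : A.PosSemidef) (hB : B.PosSemidef)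
    (h : 1 < A.det * B.det) : (n : ℝ) < (A * B).trace := by
  obtain ⟨C, rfl⟩ := psd_factor hA
  rw [Matrix.mul_assoc, Matrix.trace_mul_comm]
  have hS := psd_conj hB C
  have h1 := det_rpow_le_trace hn hS
  have h2 : (C * B * C.transpose).det = (C.transpose * C).det * B.det := by
    simp only [Matrix.det_mul, Matrix.det_transpose]; ring
  have hn' : (0 : ℝ) < n := by positivity
  have h3 : 1 < (C * B * C.transpose).det ^ ((n : ℝ)⁻¹) :=
    Real.one_lt_rpow (by rw [h2]; exact h) (by positivity)
  have := (lt_div_iff₀ hn').1 (h3.trans_le h1)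
  linarith

/-- Coefficient matrices with ellipticity constants `l ≤ u`. -/
def Ell {n : ℕ} (l u : ℝ) (a : Mt n) : Prop :=
  (a - l • (1 : Mt n)).PosSemidef ∧ (u • (1 : Mt n) - a).PosSemidef

lemma Ell.trace_ge {n : ℕ} {l u : ℝ} {a X : Mt n} (ha : Ell l u a) (hX : X.PosSemidef) :
    l * X.trace ≤ (a * X).trace := by
  have := trace_mul_nonneg ha.1 hX
  rw [Matrix.sub_mul, Matrix.trace_sub, Matrix.smul_mul, Matrix.one_mul, Matrix.trace_smul,
    smul_eq_mul] at this
  linarith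

lemma Ell.psd {n : ℕ} {l u : ℝ} {a : Mt n} (ha : Ell l u a) (hl : 0 ≤ l) : a.PosSemidef := by
  have := ha.1.add ((Matrix.PosSemidef.one (n := Fin n) (R := ℝ)).smul hl)
  simpa using this

lemma Ell.posDef {n : ℕ} {l u : ℝ} {a : Mt n} (ha : Ell l u a) (hl : 0 < l) : a.PosDef := by
  have := ((Matrix.PosDef.one (n := Fin n) (R := ℝ)).smul hl).posSemidef_add ha.1
  simpa using this

lemma Ell.diag_ge {n : ℕ} {l u : ℝ} {a : Mt n} (ha : Ell l u a) (i : Fin n) : l ≤ a i i := by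
  have := ha.1.diag_nonneg (i := i)
  simp at this; linarith

lemma Ell.diag_le {n : ℕ} {l u : ℝ} {a : Mt n} (ha : Ell l u a) (i : Fin n) : a i i ≤ u := by
  have := ha.2.diag_nonneg (i := i)
  simp at this; linarith

lemma Ell.inv {n : ℕ} {l u : ℝ} {a : Mt n} (ha : Ell l u a) (hl : 0 < l) (hu : 0 < u) :
    Ell u⁻¹ l⁻¹ a⁻¹ := by
  have hp := ha.posDef hl
  have hd : IsUnit a.det := hp.det_pos.ne'.isUnit
  have h1 : a * a⁻¹ = 1 := Matrix.mul_nonsing_inv a hd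
  have h2 : a⁻¹ * a = 1 := Matrix.nonsing_inv_mul a hd
  have hps : a⁻¹.transpose = a⁻¹ := by
    have := hp.inv.1
    rwa [Matrix.IsHermitian, Matrix.conjTranspose_eq_transpose_of_trivial] at this
  have hst : ∀ s : ℝ, (a⁻¹ - s • (1 : Mt n)).transpose = a⁻¹ - s • (1 : Mt n) := fun s => by
    simp [hps]
  constructor
  · have e : a⁻¹ - u⁻¹ • (1 : Mt n) = (a⁻¹ - u⁻¹ • (1 : Mt n)) * a *
        (a⁻¹ - u⁻¹ • (1 : Mt n)).transpose + (u⁻¹ * u⁻¹) • (u • (1 : Mt n) - a) := by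
      rw [hst]
      simp only [Matrix.sub_mul, Matrix.mul_sub, h1, h2, Matrix.smul_mul, Matrix.mul_smul,
        Matrix.one_mul, Matrix.mul_one, smul_sub, smul_smul]
      rw [mul_assoc, inv_mul_cancel₀ hu.ne', mul_one]
      abel
    rw [e]
    exact (psd_conj hp.posSemidef _).add (ha.2.smul (by positivity))
  · have e : l⁻¹ • (1 : Mt n) - a⁻¹ = a⁻¹ * (a - l • (1 : Mt n)) * a⁻¹.transpose +
        l • ((a⁻¹ - l⁻¹ • (1 : Mt n)) * 1 * (a⁻¹ - l⁻¹ • (1 : Mt n)).transpose) := by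
      rw [hst, hps]
      simp only [Matrix.sub_mul, Matrix.mul_sub, h2, Matrix.smul_mul, Matrix.mul_smul,
        Matrix.one_mul, Matrix.mul_one, smul_sub, smul_smul]
      rw [← mul_assoc, mul_inv_cancel₀ hl.ne', one_mul, one_smul]
      abel
    rw [e]
    exact (psd_conj ha.1 _).add ((psd_conj Matrix.PosSemidef.one _).smul hl.le)

open Filter Topology

/-- `f` is differentiable near `t`, with first and second derivative `d₁`, `d₂` at `t`. -/
def Jet2 {E : Type*} [NormedAddCommGroup E] [NormedSpace ℝ E] (f : ℝ → E) (t : ℝ) (d₁ d₂ : E) :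
    Prop :=
  ∃ f' : ℝ → E, (∀ᶠ s in 𝓝 t, HasDerivAt f (f' s) s) ∧ f' t = d₁ ∧ HasDerivAt f' d₂ t

section Jets

variable {E : Type*} [NormedAddCommGroup E] [NormedSpace ℝ E]

lemma Jet2.hasDerivAt {f : ℝ → E} {t : ℝ} {d₁ d₂ : E} (h : Jet2 f t d₁ d₂) :
    HasDerivAt f d₁ t := by
  obtain ⟨f', h1, rfl, -⟩ := h
  exact h1.self_of_nhds

lemma Jet2.add {f g : ℝ → E} {t : ℝ} {d₁ d₂ e₁ e₂ : E} (hf : Jet2 f t d₁ d₂)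
    (hg : Jet2 g t e₁ e₂) : Jet2 (fun s => f s + g s) t (d₁ + e₁) (d₂ + e₂) := by
  obtain ⟨f', h1, rfl, h2⟩ := hf
  obtain ⟨g', k1, rfl, k2⟩ := hg
  exact ⟨fun s => f' s + g' s, by filter_upwards [h1, k1] with s a b using a.add b, rfl, h2.add k2⟩

lemma Jet2.sub {f g : ℝ → E} {t : ℝ} {d₁ d₂ e₁ e₂ : E} (hf : Jet2 f t d₁ d₂)
    (hg : Jet2 g t e₁ e₂) : Jet2 (fun s => f s - g s) t (d₁ - e₁) (d₂ - e₂) := by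
  obtain ⟨f', h1, rfl, h2⟩ := hf
  obtain ⟨g', k1, rfl, k2⟩ := hg
  exact ⟨fun s => f' s - g' s, by filter_upwards [h1, k1] with s a b using a.sub b, rfl, h2.sub k2⟩

lemma Jet2.const_smul {f : ℝ → E} {t : ℝ} {d₁ d₂ : E} (c : ℝ) (hf : Jet2 f t d₁ d₂) :
    Jet2 (fun s => c • f s) t (c • d₁) (c • d₂) := by
  obtain ⟨f', h1, rfl, h2⟩ := hf
  exact ⟨fun s => c • f' s, by filter_upwards [h1] with s a using a.const_smul c, rfl,
    h2.const_smul c⟩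

lemma Jet2.const_mul {f : ℝ → ℝ} {t : ℝ} {d₁ d₂ : ℝ} (c : ℝ) (hf : Jet2 f t d₁ d₂) :
    Jet2 (fun s => c * f s) t (c * d₁) (c * d₂) := hf.const_smul c

lemma jet2_const (c : E) (t : ℝ) : Jet2 (fun _ => c) t 0 0 :=
  ⟨fun _ => 0, .of_forall fun s => hasDerivAt_const s c, rfl, hasDerivAt_const t _⟩

lemma jet2_line (x ξ : E) (t : ℝ) : Jet2 (fun s : ℝ => x + s • ξ) t ξ 0 :=
  ⟨fun _ => ξ, .of_forall fun s => by
    simpa using ((hasDerivAt_id s).smul_const ξ).const_add x, rfl, hasDerivAt_const t _⟩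

lemma Jet2.congr {f g : ℝ → E} {t : ℝ} {d₁ d₂ : E} (hf : Jet2 f t d₁ d₂) (h : g =ᶠ[𝓝 t] f) :
    Jet2 g t d₁ d₂ := by
  obtain ⟨f', h1, h3, h2⟩ := hf
  refine ⟨f', ?_, h3, h2⟩
  filter_upwards [h1, h.eventuallyEq_nhds] with s a b using a.congr_of_eventuallyEq b

lemma Jet2.comp {F h : ℝ → ℝ} {t d₁ d₂ e₁ e₂ : ℝ} (hF : Jet2 F (h t) e₁ e₂)
    (hh : Jet2 h t d₁ d₂) :
    Jet2 (fun s => F (h s)) t (e₁ * d₁) (e₂ * d₁ ^ 2 + e₁ * d₂) := by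
  have hh0 := hh.hasDerivAt
  obtain ⟨F', h1, rfl, h2⟩ := hF
  obtain ⟨h', k1, rfl, k2⟩ := hh
  refine ⟨fun s => F' (h s) * h' s, ?_, rfl, ?_⟩
  · filter_upwards [hh0.continuousAt.eventually h1, k1] with s a b using a.comp s b
  · exact ((h2.comp t hh0).mul k2).congr_deriv (by simp only [Function.comp_apply]; ring)

lemma Jet2.comp_clm {F : Type*} [NormedAddCommGroup F] [NormedSpace ℝ F] {f : ℝ → E} {t : ℝ}
    {d₁ d₂ : E} (hf : Jet2 f t d₁ d₂) (A : E →L[ℝ] F) :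
    Jet2 (fun s => A (f s)) t (A d₁) (A d₂) := by
  obtain ⟨f', h1, rfl, h2⟩ := hf
  exact ⟨fun s => A (f' s), by
    filter_upwards [h1] with s a using A.hasFDerivAt.comp_hasDerivAt s a, rfl,
    A.hasFDerivAt.comp_hasDerivAt t h2⟩

/-- Second-order chain rule for a `C²` function along a curve. -/
lemma ContDiffAt.jet2_comp {v : E → ℝ} {c : ℝ → E} {t : ℝ} {d₁ d₂ : E}
    (hv : ContDiffAt ℝ 2 v (c t)) (hc : Jet2 c t d₁ d₂) :
    Jet2 (fun s => v (c s)) t (fderiv ℝ v (c t) d₁)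
      (fderiv ℝ (fderiv ℝ v) (c t) d₁ d₁ + fderiv ℝ v (c t) d₂) := by
  have hc0 := hc.hasDerivAt
  obtain ⟨c', h1, rfl, h2⟩ := hc
  have hd : ∀ᶠ y in 𝓝 (c t), DifferentiableAt ℝ v y := by
    filter_upwards [hv.eventually (by simp)] with y hy using hy.differentiableAt (by simp)
  have hd2 : DifferentiableAt ℝ (fderiv ℝ v) (c t) :=
    (hv.fderiv_right (m := 1) (by norm_num)).differentiableAt (by simp)
  refine ⟨fun s => fderiv ℝ v (c s) (c' s), ?_, rfl, ?_⟩
  · filter_upwards [hc0.continuousAt.eventually hd, h1] with s a b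
      using a.hasFDerivAt.comp_hasDerivAt s b
  · exact (hd2.hasFDerivAt.comp_hasDerivAt t hc0).clm_apply h2

end Jets

lemma Jet2.isLocalMin {f : ℝ → ℝ} {t d₁ d₂ : ℝ} (hf : Jet2 f t d₁ d₂) (hm : IsLocalMin f t) :
    d₁ = 0 ∧ 0 ≤ d₂ := by
  have h0 : d₁ = 0 := hm.hasDerivAt_eq_zero hf.hasDerivAt
  refine ⟨h0, ?_⟩
  by_contra hneg
  push Not at hneg
  obtain ⟨f', h1, h3, h2⟩ := hf
  have hlo := (hasDerivAt_iff_isLittleO.1 h2).bound (c := -d₂ / 2) (by linarith)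
  have hev : ∀ᶠ s in 𝓝 t, t < s → f' s < 0 := by
    filter_upwards [hlo] with s hs hts
    rw [h3, h0, sub_zero, smul_eq_mul, Real.norm_eq_abs, Real.norm_eq_abs,
      abs_of_pos (sub_pos.2 hts)] at hs
    nlinarith [(abs_le.1 hs).2, sub_pos.2 hts]
  obtain ⟨e, he, H⟩ := Metric.eventually_nhds_iff.1 (h1.and (hev.and hm))
  have hanti : StrictAntiOn f (Set.Icc t (t + e / 2)) := by
    apply strictAntiOn_of_deriv_neg (convex_Icc _ _)
    · intro s hs
      refine (H ?_).1.continuousAt.continuousWithinAt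
      rw [Real.dist_eq, abs_lt]; constructor <;> linarith [hs.1, hs.2]
    · intro s hs
      rw [interior_Icc] at hs
      have := H (y := s) (by rw [Real.dist_eq, abs_lt]; constructor <;> linarith [hs.1, hs.2])
      rw [this.1.deriv]
      exact this.2.1 hs.1
  have h5 := hanti (Set.left_mem_Icc.2 (by linarith)) (Set.right_mem_Icc.2 (by linarith))
    (by linarith : t < t + e / 2)
  have h6 := (H (y := t + e / 2) (by
    rw [Real.dist_eq, abs_lt]; constructor <;> linarith)).2.2
  linarith

open Matrix

/-- The quadratic form of a matrix. -/
def qf {n : ℕ} (X : Mt n) (ξ : Eu n) : ℝ := ξ.ofLp ⬝ᵥ X *ᵥ ξ.ofLp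

/-- The Hessian matrix. -/
def hs {n : ℕ} (v : Eu n → ℝ) (x : Eu n) : Mt n := Matrix.of fun i j => pd2 v i j x

/-- The matrix unit at the position `(i, i)`. -/
def En {n : ℕ} (i : Fin n) : Mt n := Matrix.single i i 1

section QuadForm

variable {n : ℕ}

lemma qf_eq_sum (X : Mt n) (ξ : Eu n) : qf X ξ = ∑ i, ∑ j, ξ i * (X i j * ξ j) := by
  simp [qf, dotProduct, mulVec, Finset.mul_sum]

lemma qf_add (X Y : Mt n) (ξ : Eu n) : qf (X + Y) ξ = qf X ξ + qf Y ξ := by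
  simp [qf, Matrix.add_mulVec]

lemma qf_sub (X Y : Mt n) (ξ : Eu n) : qf (X - Y) ξ = qf X ξ - qf Y ξ := by
  simp [qf, Matrix.sub_mulVec]

lemma qf_smul (c : ℝ) (X : Mt n) (ξ : Eu n) : qf (c • X) ξ = c * qf X ξ := by
  simp [qf, Matrix.smul_mulVec]

lemma qf_vec_smul (c : ℝ) (X : Mt n) (ξ : Eu n) : qf X (c • ξ) = c ^ 2 * qf X ξ := by
  simp [qf, Matrix.mulVec_smul]; ring

lemma qf_one (ξ : Eu n) : qf (1 : Mt n) ξ = ‖ξ‖ ^ 2 := by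
  rw [EuclideanSpace.norm_sq_eq]
  simp [qf, dotProduct, sq]

lemma qf_En (i : Fin n) (ξ : Eu n) : qf (En i) ξ = ξ i ^ 2 := by
  simp [qf_eq_sum, En, Matrix.single_apply, sq, ite_and]

lemma qf_vecMulVec (w : Fin n → ℝ) (ξ : Eu n) : qf (vecMulVec w w) ξ = (w ⬝ᵥ ξ.ofLp) ^ 2 := by
  simp [qf, Matrix.vecMulVec_mulVec, sq, dotProduct_comm]

lemma psd_iff_qf {X : Mt n} : X.PosSemidef ↔ X.transpose = X ∧ ∀ ξ : Eu n, 0 ≤ qf X ξ := by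
  constructor
  · intro h
    refine ⟨by
      have := h.1
      rwa [Matrix.IsHermitian, conjTranspose_eq_transpose_of_trivial] at this, fun ξ => ?_⟩
    simpa [qf] using h.dotProduct_mulVec_nonneg ξ.ofLp
  · rintro ⟨h1, h2⟩
    refine Matrix.PosSemidef.of_dotProduct_mulVec_nonneg (by
      rwa [Matrix.IsHermitian, conjTranspose_eq_transpose_of_trivial]) fun w => ?_
    simpa [qf] using h2 (WithLp.toLp 2 w)

lemma psd_En (i : Fin n) : (En i).PosSemidef :=
  psd_iff_qf.2 ⟨by simp [En], fun ξ => by rw [qf_En]; positivity⟩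

lemma trace_mul_En (a : Mt n) (i : Fin n) : (a * En i).trace = a i i := by
  simp [En, Matrix.trace_mul_single]

lemma trace_mul_vecMulVec (a : Mt n) (w : Fin n → ℝ) :
    (a * vecMulVec w w).trace = w ⬝ᵥ a *ᵥ w := by
  rw [Matrix.mul_vecMulVec, Matrix.trace_vecMulVec, dotProduct_comm]

end QuadForm

section Hessian

variable {n : ℕ} {v : Eu n → ℝ} {x : Eu n}

lemma pd2_eq (hv : ContDiffAt ℝ 2 v x) (i j : Fin n) :
    pd2 v i j x =
      fderiv ℝ (fderiv ℝ v) x (EuclideanSpace.single i 1) (EuclideanSpace.single j 1) := by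
  have hd : DifferentiableAt ℝ (fderiv ℝ v) x :=
    (hv.fderiv_right (m := 1) (by norm_num)).differentiableAt (by simp)
  have h := hd.hasFDerivAt.clm_apply
    (hasFDerivAt_const (EuclideanSpace.single j (1 : ℝ)) x)
  change fderiv ℝ (fun y => fderiv ℝ v y (EuclideanSpace.single j 1)) x _ = _
  rw [h.fderiv]
  simp

lemma hs_symm (hv : ContDiffAt ℝ 2 v x) : (hs v x).transpose = hs v x := by
  ext i j
  have h := (hv.isSymmSndFDerivAt (by simp)) (EuclideanSpace.single j 1)
    (EuclideanSpace.single i (1 : ℝ))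
  simp only [hs, transpose_apply, of_apply, pd2_eq hv, h]

lemma eu_sum (ξ : Eu n) : ξ = ∑ i, ξ i • EuclideanSpace.single i (1 : ℝ) := by
  ext j
  simp [Finset.sum_apply, Pi.single_apply]

lemma fderiv_eq_sum (ℓ : Eu n →L[ℝ] ℝ) (ξ : Eu n) :
    ℓ ξ = ∑ i, ξ i * ℓ (EuclideanSpace.single i 1) := by
  conv_lhs => rw [eu_sum ξ]
  simp

lemma snd_eq_sum (hv : ContDiffAt ℝ 2 v x) (ξ η : Eu n) :
    fderiv ℝ (fderiv ℝ v) x ξ η = ∑ i, ∑ j, ξ i * (pd2 v i j x * η j) := by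
  conv_lhs => rw [eu_sum ξ]
  simp only [map_sum, map_smul, _root_.sum_apply, _root_.smul_apply,
    smul_eq_mul]
  refine Finset.sum_congr rfl fun i _ => ?_
  rw [fderiv_eq_sum _ η, Finset.mul_sum]
  exact Finset.sum_congr rfl fun j _ => by rw [pd2_eq hv]; ring

lemma snd_eq_qf (hv : ContDiffAt ℝ 2 v x) (ξ : Eu n) :
    fderiv ℝ (fderiv ℝ v) x ξ ξ = qf (hs v x) ξ := by
  rw [snd_eq_sum hv, qf_eq_sum]; rfl

lemma Mb_eq (b : ℝ) (v : Eu n → ℝ) (ln : Fin n) (x : Eu n) :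
    Mb b v ln x = hs v x + (b * pd v ln x / x ln) • En ln := by
  ext i j
  by_cases h : i = ln ∧ j = ln
  · obtain ⟨rfl, rfl⟩ := h
    simp [Mb, hs, En]
  · have h' : ¬(ln = i ∧ ln = j) := fun hh => h ⟨hh.1.symm, hh.2.symm⟩
    simp [Mb, hs, En, h, h']

lemma jet2_line_comp (hv : ContDiffAt ℝ 2 v x) (ξ : Eu n) :
    Jet2 (fun t : ℝ => v (x + t • ξ)) 0 (fderiv ℝ v x ξ) (qf (hs v x) ξ) := by
  have h := ContDiffAt.jet2_comp (v := v) (c := fun t : ℝ => x + t • ξ) (t := 0)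
    (by simpa using hv) (jet2_line x ξ 0)
  simpa [snd_eq_qf hv] using h

/-- Second-order information at an interior contact point. -/
lemma touch (hv : ContDiffAt ℝ 2 v x) {Φ : Eu n → ℝ} {ℓ : Eu n → ℝ} {X : Mt n}
    (hX : X.transpose = X)
    (hΦ : ∀ ξ : Eu n, Jet2 (fun t : ℝ => Φ (x + t • ξ)) 0 (ℓ ξ) (qf X ξ))
    (hmin : IsLocalMin (fun y => v y - Φ y) x) :
    (∀ ξ, fderiv ℝ v x ξ = ℓ ξ) ∧ (hs v x - X).PosSemidef := by
  have key : ∀ ξ : Eu n, fderiv ℝ v x ξ - ℓ ξ = 0 ∧ 0 ≤ qf (hs v x) ξ - qf X ξ := fun ξ => by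
    have hj := (jet2_line_comp hv ξ).sub (hΦ ξ)
    refine hj.isLocalMin ?_
    have hc : Tendsto (fun t : ℝ => x + t • ξ) (𝓝 0) (𝓝 x) := by
      have : Continuous fun t : ℝ => x + t • ξ := by fun_prop
      simpa using this.tendsto 0
    have h := hc.eventually hmin
    simpa [IsLocalMin, IsMinFilter] using h
  refine ⟨fun ξ => sub_eq_zero.1 (key ξ).1, psd_iff_qf.2 ⟨?_, fun ξ => ?_⟩⟩
  · rw [transpose_sub, hX, hs_symm hv]
  · rw [qf_sub]; exact (key ξ).2

lemma touch_trace (hv : ContDiffAt ℝ 2 v x) {Φ : Eu n → ℝ} {ℓ : Eu n → ℝ} {X : Mt n}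
    (hX : X.transpose = X)
    (hΦ : ∀ ξ : Eu n, Jet2 (fun t : ℝ => Φ (x + t • ξ)) 0 (ℓ ξ) (qf X ξ))
    (hmin : IsLocalMin (fun y => v y - Φ y) x) (b : ℝ) (ln : Fin n) {a : Mt n}
    (ha : a.PosSemidef) :
    (a * (X + (b * ℓ (EuclideanSpace.single ln 1) / x ln) • En ln)).trace ≤
      (a * Mb b v ln x).trace := by
  obtain ⟨h1, h2⟩ := touch hv hX hΦ hmin
  have h3 := trace_mul_nonneg ha h2
  rw [Mb_eq, pd, h1]
  have e : hs v x + (b * ℓ (EuclideanSpace.single ln 1) / x ln) • En ln =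
      X + (b * ℓ (EuclideanSpace.single ln 1) / x ln) • En ln + (hs v x - X) := by abel
  rw [e, Matrix.mul_add a _ (hs v x - X), trace_add]
  linarith

lemma jet2_coord (x ξ : Eu n) (i : Fin n) (t : ℝ) :
    Jet2 (fun t : ℝ => (x + t • ξ) i) t (ξ i) 0 := by
  simpa using (jet2_line x ξ t).comp_clm (EuclideanSpace.proj i : Eu n →L[ℝ] ℝ)

lemma jet2_half_qf {S : Mt n} (hS : S.transpose = S) (x z ξ : Eu n) :
    Jet2 (fun t : ℝ => qf S (x + t • ξ - z) / 2) 0 ((S *ᵥ (x - z).ofLp) ⬝ᵥ ξ.ofLp) (qf S ξ) := by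
  have hsym : (x - z).ofLp ⬝ᵥ S *ᵥ ξ.ofLp = (S *ᵥ (x - z).ofLp) ⬝ᵥ ξ.ofLp := by
    rw [Matrix.dotProduct_mulVec, ← Matrix.mulVec_transpose, hS]
  have hexp : ∀ t : ℝ, qf S (x + t • ξ - z) / 2 = qf S (x - z) / 2 +
      (t * ((S *ᵥ (x - z).ofLp) ⬝ᵥ ξ.ofLp) + t ^ 2 * (qf S ξ / 2)) := fun t => by
    have : x + t • ξ - z = (x - z) + t • ξ := by abel
    rw [this]
    simp only [qf, WithLp.ofLp_add, WithLp.ofLp_smul, Matrix.mulVec_add, Matrix.mulVec_smul,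
      add_dotProduct, dotProduct_add, smul_dotProduct, dotProduct_smul, hsym, smul_eq_mul]
    rw [dotProduct_comm ξ.ofLp (S *ᵥ (x - z).ofLp)]
    ring
  refine ⟨fun t => (S *ᵥ (x - z).ofLp) ⬝ᵥ ξ.ofLp + t * qf S ξ, .of_forall fun t => ?_, by simp, ?_⟩
  · simp only [hexp]
    have h := (((hasDerivAt_id t).mul_const ((S *ᵥ (x - z).ofLp) ⬝ᵥ ξ.ofLp)).add
      (((hasDerivAt_id t).pow 2).mul_const (qf S ξ / 2))).const_add (qf S (x - z) / 2)
    refine h.congr_deriv ?_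
    simp; ring
  · simpa using ((hasDerivAt_id (0 : ℝ)).mul_const (qf S ξ)).const_add
      ((S *ᵥ (x - z).ofLp) ⬝ᵥ ξ.ofLp)

/-- Jets of test functions `F (q (y - z) / 2) + f (y_n)` along lines. -/
lemma jet2_test {S : Mt n} (hS : S.transpose = S) (x z : Eu n) (ln : Fin n) {F f : ℝ → ℝ}
    {F₁ F₂ f₁ f₂ : ℝ} (hF : Jet2 F (qf S (x - z) / 2) F₁ F₂) (hf : Jet2 f (x ln) f₁ f₂) (ξ : Eu n) :
    Jet2 (fun t : ℝ => F (qf S (x + t • ξ - z) / 2) + f ((x + t • ξ) ln)) 0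
      (F₁ * ((S *ᵥ (x - z).ofLp) ⬝ᵥ ξ.ofLp) + f₁ * ξ ln)
      (qf (F₁ • S + F₂ • vecMulVec (S *ᵥ (x - z).ofLp) (S *ᵥ (x - z).ofLp) + f₂ • En ln) ξ) := by
  have h1 := Jet2.comp (h := fun t : ℝ => qf S (x + t • ξ - z) / 2) (t := 0)
    (by simpa using hF) (jet2_half_qf hS x z ξ)
  have h2 := Jet2.comp (F := f) (h := fun t : ℝ => (x + t • ξ) ln) (t := 0)
    (by simpa using hf) (jet2_coord x ξ ln 0)
  convert h1.add h2 using 1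
  rw [qf_add, qf_add, qf_smul, qf_smul, qf_smul, qf_vecMulVec, qf_En]
  ring

lemma test_symm {S : Mt n} (hS : S.transpose = S) (c₁ c₂ c₃ : ℝ) (w : Fin n → ℝ) (ln : Fin n) :
    (c₁ • S + c₂ • vecMulVec w w + c₃ • En ln).transpose =
      c₁ • S + c₂ • vecMulVec w w + c₃ • En ln := by
  simp [hS, En, transpose_vecMulVec]

end Hessian

/-- Nonnegative supersolutions, in the open half-space, of some equation
`tr (a(x) M_b[v](x)) ≤ 0` with measurable coefficients of ellipticity `l, u`. -/
structure SuperSol {n : ℕ} (b l u : ℝ) (ln : Fin n) (v : Eu n → ℝ) : Prop where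
  smooth : ∀ x : Eu n, 0 < x ln → ContDiffAt ℝ 2 v x
  nonneg : ∀ x : Eu n, 0 < x ln → 0 ≤ v x
  super : ∀ x : Eu n, 0 < x ln → ∃ a : Mt n, Ell l u a ∧ (a * Mb b v ln x).trace ≤ 0

section Aux

variable {n : ℕ}

lemma dot_single (w : Fin n → ℝ) (i : Fin n) :
    w ⬝ᵥ (EuclideanSpace.single i (1 : ℝ)).ofLp = w i := by
  simp [dotProduct]

lemma abs_coord_le (x : Eu n) (i : Fin n) : |x i| ≤ ‖x‖ := by
  simpa using PiLp.norm_apply_le x i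

lemma Ell.quad_ge {l u : ℝ} {a : Mt n} (ha : Ell l u a) (w : Eu n) :
    l * ‖w‖ ^ 2 ≤ qf a w := by
  have := (psd_iff_qf.1 ha.1).2 w
  rw [qf_sub, qf_smul, qf_one] at this
  linarith

lemma Ell.quad_le {l u : ℝ} {a : Mt n} (ha : Ell l u a) (w : Eu n) :
    qf a w ≤ u * ‖w‖ ^ 2 := by
  have := (psd_iff_qf.1 ha.2).2 w
  rw [qf_sub, qf_smul, qf_one] at this
  linarith

lemma Ell.trace_self_le {l u : ℝ} {a : Mt n} (ha : Ell l u a) : a.trace ≤ n * u := by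
  have := ha.2.trace_nonneg
  rw [trace_sub, trace_smul, trace_one, Fintype.card_fin, smul_eq_mul] at this
  linarith

lemma SuperSol.div_const {b l u : ℝ} {ln : Fin n} {v : Eu n → ℝ} (hv : SuperSol b l u ln v)
    {m : ℝ} (hm : 0 < m) : SuperSol b l u ln (fun x => v x / m) := by
  refine ⟨fun x hx => (hv.smooth x hx).div_const m, fun x hx => div_nonneg (hv.nonneg x hx) hm.le,
    fun x hx => ?_⟩
  obtain ⟨a, ha, h⟩ := hv.super x hx
  refine ⟨a, ha, ?_⟩
  have hs0 := hv.smooth x hx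
  have h1 : ∀ i y, pd (fun x => v x / m) i y = m⁻¹ * pd v i y := fun i y => by
    simp only [pd, div_eq_mul_inv, mul_comm _ m⁻¹]
    exact congrArg (fun A => A (EuclideanSpace.single i (1 : ℝ)))
      (congrFun (fderiv_const_smul_field (𝕜 := ℝ) (f := v) m⁻¹) y)
  have h2 : ∀ i j, pd2 (fun x => v x / m) i j x = m⁻¹ * pd2 v i j x := fun i j => by
    have : pd (fun x => v x / m) j = fun y => m⁻¹ * pd v j y := funext (h1 j)
    simp only [pd2, this]
    exact congrArg (fun A => A (EuclideanSpace.single i (1 : ℝ)))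
      (congrFun (fderiv_const_smul_field (𝕜 := ℝ) (f := pd v j) m⁻¹) x)
  have h3 : Mb b (fun x => v x / m) ln x = m⁻¹ • Mb b v ln x := by
    ext i j
    simp only [Mb, of_apply, Matrix.smul_apply, smul_eq_mul, h1, h2]
    split_ifs <;> ring
  rw [h3, Matrix.mul_smul, trace_smul, smul_eq_mul]
  exact mul_nonpos_of_nonneg_of_nonpos (by positivity) h

lemma coord_ge_of_mem_closedBall {ln : Fin n} {x z : Eu n} {r : ℝ}
    (hx : x ∈ Metric.closedBall z r) : z ln - r ≤ x ln := by
  rw [mem_closedBall_iff_norm] at hx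
  have := (abs_le.1 ((abs_coord_le (x - z) ln).trans hx)).1
  simp only [PiLp.sub_apply] at this
  linarith

end Aux

/-- Lower bounds for supersolutions spread from a ball to an eight times larger one. -/
lemma doubling {n : ℕ} (b : ℝ) {l u : ℝ} (hl : 0 < l) (hu : 0 < u) (ln : Fin n) :
    ∃ κ : ℝ, 0 < κ ∧ κ ≤ 1 ∧ ∀ v, SuperSol b l u ln v → ∀ (z : Eu n) (r m : ℝ), 0 < r → 0 ≤ m →
      32 * r ≤ z ln → (∀ x ∈ Metric.closedBall z r, m ≤ v x) →
      ∀ x ∈ Metric.closedBall z (8 * r), κ * m ≤ v x := by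
  set A : ℝ := (n * u + |b| * u + 1) / l with hA
  have hA0 : 0 < A := by positivity
  refine ⟨Real.exp (-(64 * A)) - Real.exp (-(256 * A)), ?_, ?_, ?_⟩
  · rw [sub_pos, Real.exp_lt_exp]; linarith
  · have : Real.exp (-(64 * A)) ≤ 1 := Real.exp_le_one_iff.2 (by linarith)
    linarith [Real.exp_pos (-(256 * A))]
  intro v hv z r m hr hm hz hvm
  rcases hm.eq_or_lt with rfl | hm
  · intro x hx
    rw [mul_zero]
    exact hv.nonneg x (by linarith [coord_ge_of_mem_closedBall (ln := ln) hx])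
  set F : ℝ → ℝ := fun s => m * (Real.exp (-(2 * A / r ^ 2) * s) - Real.exp (-(256 * A))) with hF
  set Φ : Eu n → ℝ := fun y => F (qf 1 (y - z) / 2) + 0 with hΦ
  set K : Set (Eu n) := Metric.closedBall z (16 * r) \ Metric.ball z r with hK
  have hKc : IsCompact K := (isCompact_closedBall z (16 * r)).diff Metric.isOpen_ball
  have hpos : ∀ x ∈ Metric.closedBall z (16 * r), 16 * r ≤ x ln := fun x hx => by
    linarith [coord_ge_of_mem_closedBall (ln := ln) hx]
  have hFmono : Antitone F := by
    intro s t hst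
    simp only [hF]
    gcongr m * (Real.exp ?_ - _)
    have : 0 ≤ 2 * A / r ^ 2 := by positivity
    nlinarith
  have hFval : ∀ c : ℝ, F ((c * r) ^ 2 / 2) =
      m * (Real.exp (-(c ^ 2 * A)) - Real.exp (-(256 * A))) := fun c => by
    simp only [hF]
    congr 3
    field_simp
  have hΦle : ∀ x c, c * r ≤ ‖x - z‖ → 0 ≤ c →
      Φ x ≤ m * (Real.exp (-(c ^ 2 * A)) - Real.exp (-(256 * A))) := fun x c hx hc => by
    rw [← hFval]
    simp only [hΦ, add_zero, qf_one]
    exact hFmono (by gcongr)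
  have hΦge : ∀ x c, ‖x - z‖ ≤ c * r →
      m * (Real.exp (-(c ^ 2 * A)) - Real.exp (-(256 * A))) ≤ Φ x := fun x c hx => by
    rw [← hFval]
    simp only [hΦ, add_zero, qf_one]
    exact hFmono (by gcongr)
  have hjet : ∀ s, Jet2 F s (m * (Real.exp (-(2 * A / r ^ 2) * s) * -(2 * A / r ^ 2)))
      (m * (Real.exp (-(2 * A / r ^ 2) * s) * (2 * A / r ^ 2) ^ 2)) := fun s => by
    have hd : ∀ s, HasDerivAt (fun s => Real.exp (-(2 * A / r ^ 2) * s))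
        (Real.exp (-(2 * A / r ^ 2) * s) * -(2 * A / r ^ 2)) s := fun s => by
      simpa using ((hasDerivAt_id s).const_mul (-(2 * A / r ^ 2))).exp
    refine ⟨fun s => m * (Real.exp (-(2 * A / r ^ 2) * s) * -(2 * A / r ^ 2)),
      .of_forall fun s => ((hd s).sub_const _).const_mul m, rfl, ?_⟩
    exact (((hd s).mul_const _).const_mul m).congr_deriv (by ring)
  have main : ∀ x ∈ K, Φ x ≤ v x := by
    by_contra! hcon
    obtain ⟨x₁, hx₁, hlt⟩ := hcon
    have hcont : ContinuousOn (fun y => v y - Φ y) K := by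
      refine ContinuousOn.sub (fun y hy => ?_) (Continuous.continuousOn ?_)
      · exact (hv.smooth y (by linarith [hpos y hy.1])).continuousAt.continuousWithinAt
      · simp only [hΦ, hF, qf_one]; fun_prop
    obtain ⟨x, hxK, hmin⟩ := hKc.exists_isMinOn ⟨x₁, hx₁⟩ hcont
    have hneg : v x - Φ x < 0 := (hmin hx₁).trans_lt (sub_neg.2 hlt)
    have hxpos := hpos x hxK.1
    have hout : ‖x - z‖ < 16 * r := by
      by_contra! h
      have h1 := hΦle x 16 h (by norm_num)
      norm_num at h1
      linarith [hv.nonneg x (by linarith)]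
    have hr_le : r ≤ ‖x - z‖ := by
      have := hxK.2
      rwa [mem_ball_iff_norm, not_lt] at this
    have hin : r < ‖x - z‖ := by
      refine lt_of_le_of_ne hr_le fun h => ?_
      have h1 := hΦle x 0 (by simp) le_rfl
      have h2 := hvm x (by rw [mem_closedBall_iff_norm, ← h])
      simp only [ne_eq, OfNat.ofNat_ne_zero, not_false_eq_true, zero_pow, zero_mul, neg_zero,
        Real.exp_zero] at h1
      nlinarith [Real.exp_pos (-(256 * A))]
    have hnhds : K ∈ 𝓝 x := by
      refine mem_of_superset (((Metric.isOpen_ball (x := z) (ε := 16 * r)).inter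
        (Metric.isClosed_closedBall (x := z) (ε := r)).isOpen_compl).mem_nhds ?_) ?_
      · simp only [Set.mem_inter_iff, mem_ball_iff_norm, Set.mem_compl_iff,
          mem_closedBall_iff_norm, not_le]
        exact ⟨hout, hin⟩
      · rintro y ⟨h1, h2⟩
        exact ⟨Metric.ball_subset_closedBall h1, fun h => h2 (Metric.ball_subset_closedBall h)⟩
    obtain ⟨a, ha, hsup⟩ := hv.super x (by linarith)
    have hone : (1 : Mt n).transpose = 1 := transpose_one
    have ht := touch_trace (hv.smooth x (by linarith)) (test_symm hone _ _ 0 _ ln)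
      (fun ξ => jet2_test hone x z ln (f := fun _ => 0) (hjet _) (jet2_const 0 _) ξ)
      (hmin.isLocalMin hnhds) b ln (ha.psd hl.le)
    set e := Real.exp (-(2 * A / r ^ 2) * (qf 1 (x - z) / 2)) with he
    have he0 : 0 < e := Real.exp_pos _
    simp only [one_mulVec, zero_smul, add_zero, Matrix.mul_add, trace_add, Matrix.mul_smul,
      trace_smul, smul_eq_mul, Matrix.mul_one, trace_mul_vecMulVec, trace_mul_En,
      dot_single, zero_mul] at ht
    have hq : l * r ^ 2 ≤ (x - z).ofLp ⬝ᵥ a *ᵥ (x - z).ofLp := by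
      refine le_trans ?_ (ha.quad_ge (x - z))
      gcongr
    have h1 := ha.trace_self_le
    have h2 : b * ((x - z).ofLp ln) / x ln * a ln ln ≤ |b| * u := by
      have h3 : |b * ((x - z).ofLp ln) / x ln| ≤ |b| := by
        rw [abs_div, abs_mul, abs_of_pos (by linarith : 0 < x ln), mul_div_assoc]
        refine mul_le_of_le_one_right (abs_nonneg b) ?_
        rw [div_le_one (by linarith)]
        exact ((abs_coord_le (x - z) ln).trans hout.le).trans hxpos
      have h4 := ha.diag_le ln
      have h5 := (hl.le).trans (ha.diag_ge ln)
      calc _ ≤ |b| * a ln ln := by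
            gcongr
            exact (le_abs_self _).trans h3
        _ ≤ _ := by gcongr
    have hk : (0 : ℝ) < m * e * (2 * A / r ^ 2) := by positivity
    have h6 : m * e * (2 * A / r ^ 2) * ((2 * A / r ^ 2) * ((x - z).ofLp ⬝ᵥ a *ᵥ (x - z).ofLp)
        - a.trace - b * ((x - z).ofLp ln) / x ln * a ln ln) ≤ 0 := by
      refine le_trans (le_of_eq ?_) (ht.trans hsup)
      ring
    have h7 : 2 * A * l ≤ (2 * A / r ^ 2) * ((x - z).ofLp ⬝ᵥ a *ᵥ (x - z).ofLp) := by
      calc 2 * A * l = (2 * A / r ^ 2) * (l * r ^ 2) := by field_simp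
        _ ≤ _ := by gcongr
    have h8 : A * l = n * u + |b| * u + 1 := by rw [hA]; field_simp
    have h9 : 0 ≤ |b| * u := by positivity
    have h10 : (0 : ℝ) ≤ n * u := by positivity
    nlinarith [mul_pos hk (by linarith : (0 : ℝ) < (2 * A / r ^ 2) *
      ((x - z).ofLp ⬝ᵥ a *ᵥ (x - z).ofLp) - a.trace - b * ((x - z).ofLp ln) / x ln * a ln ln)]
  intro x hx
  by_cases h : x ∈ Metric.ball z r
  · have h1 := hvm x (Metric.ball_subset_closedBall h)
    have h2 : Real.exp (-(64 * A)) ≤ 1 := Real.exp_le_one_iff.2 (by linarith)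
    nlinarith [Real.exp_pos (-(256 * A))]
  · have h1 := hΦge x 8 (by rwa [mem_closedBall_iff_norm] at hx)
    have h2 := main x ⟨Metric.closedBall_subset_closedBall (by linarith) hx, h⟩
    norm_num at h1
    linarith

section HessianContinuity

variable {n : ℕ} {v : Eu n → ℝ} {x : Eu n}

lemma continuousAt_pd2 (hv : ContDiffAt ℝ 2 v x) (i j : Fin n) :
    ContinuousAt (pd2 v i j) x := by
  have h1 : ContinuousAt (fderiv ℝ (fderiv ℝ v)) x :=
    ((hv.fderiv_right (m := 1) (by norm_num)).fderiv_right (m := 0) (by norm_num)).continuousAt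
  have h2 : ContinuousAt (fun y => fderiv ℝ (fderiv ℝ v) y (EuclideanSpace.single i 1)
      (EuclideanSpace.single j 1)) x :=
    (h1.clm_apply continuousAt_const).clm_apply continuousAt_const
  refine h2.congr ?_
  filter_upwards [hv.eventually (by simp)] with y hy using (pd2_eq hy i j).symm

lemma continuousAt_hs (hv : ContDiffAt ℝ 2 v x) : ContinuousAt (hs v) x :=
  continuousAt_pi.2 fun i => continuousAt_pi.2 fun j => continuousAt_pd2 hv i j

lemma hasFDerivAt_pd (hv : ContDiffAt ℝ 2 v x) (i : Fin n) :
    HasFDerivAt (pd v i) (∑ j, pd2 v i j x • (EuclideanSpace.proj j : Eu n →L[ℝ] ℝ)) x := by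
  have hd : DifferentiableAt ℝ (fderiv ℝ v) x :=
    (hv.fderiv_right (m := 1) (by norm_num)).differentiableAt (by simp)
  have h := hd.hasFDerivAt.clm_apply
    (hasFDerivAt_const (EuclideanSpace.single i (1 : ℝ)) x)
  refine h.congr_fderiv ?_
  ext ξ
  have hsym := (hv.isSymmSndFDerivAt (by simp)) ξ (EuclideanSpace.single i (1 : ℝ))
  simp only [ContinuousLinearMap.comp_zero, zero_add, ContinuousLinearMap.flip_apply, hsym]
  rw [fderiv_eq_sum _ ξ]
  simp [pd2_eq hv, mul_comm]

end HessianContinuity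

/-- The measure estimate of Alexandrov, Bakelman and Pucci, in the form of Cabré and Savin:
paraboloids of fixed opening are slid from below. -/
lemma measure_estimate {n : ℕ} (hn : 0 < n) (b : ℝ) {l u : ℝ} (hl : 0 < l) (hu : 0 < u)
    (ln : Fin n) :
    ∃ C : ℝ, 0 < C ∧ ∀ v, SuperSol b l u ln v → ∀ (z x₁ : Eu n) (r : ℝ), 0 < r →
      10 * r ≤ z ln → ‖x₁ - z‖ ≤ r / 2 → v x₁ < 1 / 2 →
      volume (Metric.ball x₁ (r / 8)) ≤
        ENNReal.ofReal C * volume {x | x ∈ Metric.ball z r ∧ v x ≤ 1} := by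
  set C : ℝ := ((n * u + |b| * u) / l / n) ^ n with hC
  have hn' : (0 : ℝ) < n := by positivity
  refine ⟨C, by positivity, ?_⟩
  intro v hv z x₁ r hr hz hx₁ hvx₁
  set K : ℝ := 16 / r ^ 2 with hK
  have hK0 : 0 < K := by positivity
  have hU : ∀ x ∈ Metric.closedBall z r, 9 * r ≤ x ln := fun x hx => by
    linarith [coord_ge_of_mem_closedBall (ln := ln) hx]
  have hsm : ∀ x ∈ Metric.closedBall z r, ContDiffAt ℝ 2 v x := fun x hx =>
    hv.smooth x (by linarith [hU x hx])
  set J : Eu n → Mt n := fun x => 1 + K⁻¹ • hs v x with hJ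
  set f : Eu n → Eu n := fun x => WithLp.toLp 2 fun i => x i + K⁻¹ * pd v i x with hf
  set f' : Eu n → Eu n →L[ℝ] Eu n := fun x =>
    LinearMap.toContinuousLinearMap (Matrix.toLpLin 2 2 (J x)) with hf'
  have hdet : ∀ x, (f' x).det = (J x).det := fun x => by
    simp [hf', LinearMap.det_toContinuousLinearMap]
  have hfd : ∀ x ∈ Metric.closedBall z r, HasFDerivAt f (f' x) x := fun x hx => by
    rw [← hasFDerivWithinAt_univ, hasFDerivWithinAt_euclidean]
    intro i
    rw [hasFDerivWithinAt_univ]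
    have h1 := ((EuclideanSpace.proj i : Eu n →L[ℝ] ℝ).hasFDerivAt (x := x)).add
      ((hasFDerivAt_pd (hsm x hx) i).const_mul K⁻¹)
    refine h1.congr_fderiv ?_
    ext ξ
    simp [hf', hJ, Matrix.toLpLin_apply, mulVec, dotProduct, hs, Finset.mul_sum, mul_assoc]
  set E : Set (Eu n) := {x | x ∈ Metric.ball z r ∧ v x ≤ 1 ∧ |(J x).det| ≤ C} with hE
  have hEm : MeasurableSet E := by
    have hcl : ∀ g : Eu n → ℝ, (∀ x ∈ Metric.ball z r, ContinuousAt g x) → ∀ c,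
        MeasurableSet {x | x ∈ Metric.ball z r ∧ g x ≤ c} := fun g hg c => by
      have h1 : IsOpen (Metric.ball z r ∩ g ⁻¹' Set.Ioi c) :=
        ContinuousOn.isOpen_inter_preimage (fun x hx => (hg x hx).continuousWithinAt)
          Metric.isOpen_ball isOpen_Ioi
      have h2 : {x | x ∈ Metric.ball z r ∧ g x ≤ c} =
          Metric.ball z r \ (Metric.ball z r ∩ g ⁻¹' Set.Ioi c) := by
        ext x; simp +contextual [and_comm]
      rw [h2]
      exact Metric.isOpen_ball.measurableSet.diff h1.measurableSet
    have h2 : E = {x | x ∈ Metric.ball z r ∧ v x ≤ 1} ∩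
        {x | x ∈ Metric.ball z r ∧ |(J x).det| ≤ C} := by
      ext x; simp only [hE, Set.mem_ofPred_eq, Set.mem_inter_iff]; tauto
    rw [h2]
    refine (hcl v (fun x hx => (hsm x (Metric.ball_subset_closedBall hx)).continuousAt) 1).inter
      (hcl (fun x => |(J x).det|) (fun x hx => ?_) C)
    have h3 := continuousAt_hs (hsm x (Metric.ball_subset_closedBall hx))
    have h4 : ContinuousAt J x := continuousAt_const.add (h3.const_smul K⁻¹)
    exact ((Continuous.matrix_det continuous_id).continuousAt.comp h4).abs
  have himage : Metric.ball x₁ (r / 8) ⊆ f '' E := by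
    intro η hη
    rw [mem_ball_iff_norm] at hη
    set g : Eu n → ℝ := fun x => v x - ((-K) * (qf 1 (x - η) / 2) + 0) with hg
    have hgeq : ∀ x, g x = v x + K * ‖x - η‖ ^ 2 / 2 := fun x => by
      simp only [hg, qf_one]; ring
    have hgc : ContinuousOn g (Metric.closedBall z r) := by
      intro x hx
      refine ContinuousAt.continuousWithinAt ((hsm x hx).continuousAt.sub ?_)
      simp only [qf_one]
      fun_prop
    have hx₁z : x₁ ∈ Metric.closedBall z r := by
      rw [mem_closedBall_iff_norm]; linarith
    obtain ⟨x, hx, hmin⟩ := (isCompact_closedBall z r).exists_isMinOn ⟨x₁, hx₁z⟩ hgc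
    have hmv : v x + K * ‖x - η‖ ^ 2 / 2 < 5 / 8 := by
      have h1 : g x ≤ g x₁ := hmin hx₁z
      rw [hgeq, hgeq] at h1
      have h2 : K * ‖x₁ - η‖ ^ 2 / 2 ≤ 1 / 8 := by
        have : ‖x₁ - η‖ ≤ r / 8 := by rw [norm_sub_rev]; exact hη.le
        calc K * ‖x₁ - η‖ ^ 2 / 2 ≤ K * (r / 8) ^ 2 / 2 := by gcongr
          _ = 1 / 8 := by rw [hK]; field_simp; norm_num
      linarith
    have hxpos := hU x hx
    have hvx := hv.nonneg x (by linarith)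
    have hxb : x ∈ Metric.ball z r := by
      rw [mem_ball_iff_norm]
      rw [mem_closedBall_iff_norm] at hx
      refine lt_of_le_of_ne hx fun h => ?_
      have h3 : 3 * r / 8 ≤ ‖x - η‖ := by
        have e1 : x - z = (x - η) + (η - x₁) + (x₁ - z) := by abel
        have e2 : ‖x - z‖ ≤ ‖x - η‖ + ‖η - x₁‖ + ‖x₁ - z‖ := by
          rw [e1]; exact norm_add₃_le
        linarith
      have h4 : 9 / 8 ≤ K * ‖x - η‖ ^ 2 / 2 := by
        calc (9 / 8 : ℝ) = K * (3 * r / 8) ^ 2 / 2 := by rw [hK]; field_simp; norm_num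
          _ ≤ _ := by gcongr
      linarith
    have hjet : ∀ s, Jet2 (fun s => (-K) * s) s (-K) 0 := fun s =>
      ⟨fun _ => -K, .of_forall fun s => by simpa using (hasDerivAt_id s).const_mul (-K), rfl,
        hasDerivAt_const s _⟩
    have hone : (1 : Mt n).transpose = 1 := transpose_one
    obtain ⟨ht1, ht2⟩ := touch (hsm x hx) (test_symm hone _ _ 0 _ ln)
      (fun ξ => jet2_test hone x η ln (f := fun _ => 0) (hjet _) (jet2_const 0 _) ξ)
      (hmin.isLocalMin (mem_of_superset (Metric.isOpen_ball.mem_nhds hxb)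
        Metric.ball_subset_closedBall))
    simp only [zero_smul, add_zero, one_mulVec, zero_mul, neg_smul, sub_neg_eq_add] at ht1 ht2
    have hpd : ∀ i, pd v i x = -K * (x - η) i := fun i => by rw [pd, ht1, dot_single]
    have hJpsd : (J x).PosSemidef := by
      have h := ht2.smul (a := K⁻¹) (by positivity)
      rw [smul_add, smul_smul, inv_mul_cancel₀ hK0.ne', one_smul, add_comm] at h
      exact h
    refine ⟨x, ⟨hxb, by nlinarith [sq_nonneg ‖x - η‖], ?_⟩, ?_⟩
    · rw [abs_of_nonneg hJpsd.det_nonneg]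
      obtain ⟨a, ha, hsup⟩ := hv.super x (by linarith)
      have hpsd := ha.psd hl.le
      rw [Mb_eq, Matrix.mul_add, trace_add, Matrix.mul_smul, trace_smul, trace_mul_En,
        smul_eq_mul, hpd] at hsup
      have h1 : (a * J x).trace = a.trace + K⁻¹ * (a * hs v x).trace := by
        simp [hJ, Matrix.mul_add]
      have h2 : ‖x - η‖ ≤ 2 * r := by
        have e1 : x - η = (x - z) - (x₁ - z) - (η - x₁) := by abel
        have e2 : ‖x - η‖ ≤ ‖x - z‖ + ‖x₁ - z‖ + ‖η - x₁‖ := by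
          rw [e1]
          exact (norm_sub_le _ _).trans (by gcongr; exact norm_sub_le _ _)
        rw [mem_ball_iff_norm] at hxb
        linarith
      have h3 : b * (x - η) ln / x ln * a ln ln ≤ |b| * u := by
        have h3 : |b * (x - η) ln / x ln| ≤ |b| := by
          rw [abs_div, abs_mul, abs_of_pos (by linarith : 0 < x ln), mul_div_assoc]
          refine mul_le_of_le_one_right (abs_nonneg b) ?_
          rw [div_le_one (by linarith)]
          exact (abs_coord_le (x - η) ln).trans (by linarith)
        have h4 := ha.diag_le ln
        have h5 := (hl.le).trans (ha.diag_ge ln)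
        calc _ ≤ |b| * a ln ln := by
              gcongr
              exact (le_abs_self _).trans h3
          _ ≤ _ := by gcongr
      have h4 : K⁻¹ * (a * hs v x).trace ≤ b * (x - η) ln / x ln * a ln ln := by
        have h5 : b * (-K * (x - η) ln) / x ln * a ln ln =
          -K * (b * (x - η) ln / x ln * a ln ln) := by ring
        rw [h5] at hsup
        rw [inv_mul_le_iff₀ hK0]
        linarith
      have h5 := ha.trace_ge hJpsd
      have h6 := ha.trace_self_le
      have h7 : (J x).trace ≤ (n * u + |b| * u) / l := by
        rw [le_div_iff₀ hl]; linarith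
      refine (det_le_trace_pow hn hJpsd).trans ?_
      rw [hC]
      have := hJpsd.trace_nonneg
      gcongr
    · ext i
      simp only [hf, hpd]
      simp only [PiLp.sub_apply]
      field_simp
      ring
  calc volume (Metric.ball x₁ (r / 8)) ≤ volume (f '' E) := measure_mono himage
    _ ≤ ∫⁻ x in E, ENNReal.ofReal |(f' x).det| :=
        addHaar_image_le_lintegral_abs_det_fderiv _ hEm fun x hx =>
          (hfd x (Metric.ball_subset_closedBall hx.1)).hasFDerivWithinAt
    _ ≤ ∫⁻ x in E, ENNReal.ofReal C := by
        refine setLIntegral_mono' hEm fun x hx => ENNReal.ofReal_le_ofReal ?_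
        rw [hdet]; exact hx.2.2
    _ = ENNReal.ofReal C * volume E := by simp
    _ ≤ _ := by
        gcongr
        rintro x ⟨h1, h2, -⟩
        exact ⟨h1, h2⟩

section Volumes

variable {n : ℕ}

lemma volume_ball_mul (x y : Eu n) {s r : ℝ} (hs : 0 < s) (hr : 0 < r) :
    volume (Metric.ball x (s * r)) = ENNReal.ofReal (s ^ n) * volume (Metric.ball y r) := by
  have h1 := Measure.addHaar_ball_of_pos volume x (mul_pos hs hr)
  have h2 := Measure.addHaar_ball_of_pos volume y hr
  rw [h1, h2, ← mul_assoc, ← ENNReal.ofReal_mul (by positivity), finrank_euclideanSpace,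
    Fintype.card_fin, mul_pow]

lemma volume_closedBall_mul (x y : Eu n) {s r : ℝ} (hs : 0 < s) (hr : 0 < r) :
    volume (Metric.closedBall x (s * r)) = ENNReal.ofReal (s ^ n) * volume (Metric.ball y r) := by
  have h1 := Measure.addHaar_closedBall volume x (mul_pos hs hr).le
  have h2 := Measure.addHaar_ball_of_pos volume y hr
  rw [h1, h2, ← mul_assoc, ← ENNReal.ofReal_mul (by positivity), finrank_euclideanSpace,
    Fintype.card_fin, mul_pow]

end Volumes

/-- A supersolution which is large on most of a ball is large on a larger ball. -/
lemma growth_of_density {n : ℕ} (hn : 0 < n) (b : ℝ) {l u : ℝ} (hl : 0 < l) (hu : 0 < u)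
    (ln : Fin n) :
    ∃ δ k : ℝ, 0 < δ ∧ 0 < k ∧ k ≤ 1 ∧ ∀ v, SuperSol b l u ln v → ∀ (z : Eu n) (t m : ℝ), 0 < t →
      0 < m → 16 * t ≤ z ln →
      volume {x | x ∈ Metric.ball z t ∧ v x ≤ m} ≤ ENNReal.ofReal δ * volume (Metric.ball z t) →
      ∀ x ∈ Metric.closedBall z (4 * t), k * m < v x := by
  obtain ⟨κ, hκ, hκ1, hD⟩ := doubling (n := n) b hl hu ln
  obtain ⟨C, hC, hA⟩ := measure_estimate hn b hl hu ln
  refine ⟨(1 / 8) ^ n / (2 * C), κ / 4, by positivity, by positivity, by linarith, ?_⟩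
  intro v hv z t m ht hm hz hvol x hx
  have hw := hv.div_const hm
  have hpos : ∀ x ∈ Metric.closedBall z (t / 2), m / 2 ≤ v x := by
    by_contra! hcon
    obtain ⟨x₁, hx₁, hlt⟩ := hcon
    have h1 := hA _ hw z x₁ t ht (by linarith) (by rwa [mem_closedBall_iff_norm] at hx₁)
      (by rw [div_lt_iff₀ hm]; linarith)
    have h2 : {x | x ∈ Metric.ball z t ∧ v x / m ≤ 1} = {x | x ∈ Metric.ball z t ∧ v x ≤ m} := by
      ext x; simp [div_le_one hm]
    rw [h2] at h1
    have h3 : volume (Metric.ball x₁ (t / 8)) =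
        ENNReal.ofReal ((1 / 8) ^ n) * volume (Metric.ball z t) := by
      rw [← volume_ball_mul x₁ z (by norm_num) ht]; congr 2; ring
    have h4 : ENNReal.ofReal ((1 / 8) ^ n) * volume (Metric.ball z t) ≤
        ENNReal.ofReal ((1 / 8) ^ n / 2) * volume (Metric.ball z t) := by
      rw [← h3]
      calc _ ≤ _ := h1
        _ ≤ ENNReal.ofReal C * (ENNReal.ofReal ((1 / 8) ^ n / (2 * C)) *
            volume (Metric.ball z t)) := by gcongr
        _ = _ := by
            rw [← mul_assoc, ← ENNReal.ofReal_mul hC.le]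
            congr 2
            field_simp
    rw [ENNReal.mul_le_mul_iff_left (Metric.measure_ball_pos volume z ht).ne'
      measure_ball_lt_top.ne, ENNReal.ofReal_le_ofReal_iff (by positivity)] at h4
    have : (0 : ℝ) < (1 / 8) ^ n := by positivity
    linarith
  have := hD v hv z (t / 2) (m / 2) (by positivity) (by positivity) (by linarith) hpos x
    (by convert hx using 2; ring)
  nlinarith

/-- One step of the ink-spots covering argument. -/
lemma ink_step {n : ℕ} {ln : Fin n} {b l u δ k : ℝ} (hδ : 0 < δ) (hk1 : k ≤ 1)
    (hgrow : ∀ v, SuperSol b l u ln v → ∀ (z : Eu n) (t m : ℝ), 0 < t →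
      0 < m → 16 * t ≤ z ln →
      volume {x | x ∈ Metric.ball z t ∧ v x ≤ m} ≤ ENNReal.ofReal δ * volume (Metric.ball z t) →
      ∀ x ∈ Metric.closedBall z (4 * t), k * m < v x)
    {v : Eu n → ℝ} (hv : SuperSol b l u ln v) {z : Eu n} {ρ m : ℝ} (hρ : 0 < ρ) (hm : 0 < m)
    (hz : 32 * ρ ≤ z ln) :
    (∀ x ∈ Metric.closedBall z ρ, k * m < v x) ∨
      ENNReal.ofReal (1 + δ / 5 ^ n) * volume {x | x ∈ Metric.ball z ρ ∧ m < v x} ≤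
        volume {x | x ∈ Metric.ball z ρ ∧ k * m < v x} := by
  set B := Metric.ball z ρ with hB
  set E : ℝ → Set (Eu n) := fun s => {x | x ∈ B ∧ s < v x} with hE
  have hcont : ContinuousOn v B := fun x hx => by
    refine (hv.smooth x ?_).continuousAt.continuousWithinAt
    linarith [coord_ge_of_mem_closedBall (ln := ln) (Metric.ball_subset_closedBall hx)]
  have hEo : ∀ s, IsOpen (E s) := fun s =>
    hcont.isOpen_inter_preimage Metric.isOpen_ball isOpen_Ioi
  set Bk : Eu n → ℕ → Set (Eu n) := fun x j =>
    Metric.ball (z + (1 - (1 / 2) ^ j : ℝ) • (x - z)) ((1 / 2) ^ j * ρ) with hBk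
  by_cases h0 : volume (B \ E m) ≤ ENNReal.ofReal δ * volume B
  · left
    intro x hx
    refine hgrow v hv z ρ m hρ hm (by linarith) ?_ x
      (Metric.closedBall_subset_closedBall (by linarith) hx)
    convert h0 using 2
    ext x
    simp +contextual [hE, hB]
  right
  have hex : ∀ x ∈ E m, ∃ (c : Eu n) (r : ℝ), 0 < r ∧ r ≤ ρ ∧ x ∈ Metric.ball c r ∧
      Metric.ball c r ⊆ E (k * m) ∧
      ENNReal.ofReal δ * volume (Metric.ball c r) < volume (Metric.ball c r \ E m) := by
    intro x hx
    have hxz : ‖x - z‖ < ρ := mem_ball_iff_norm.1 hx.1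
    have hsub : ∀ j, Bk x j ⊆ B := fun j y hy => by
      rw [hBk, mem_ball_iff_norm] at hy
      rw [hB, mem_ball_iff_norm]
      have hj : (0 : ℝ) < (1 / 2) ^ j := by positivity
      have hj1 : ((1 : ℝ) / 2) ^ j ≤ 1 := pow_le_one₀ (by norm_num) (by norm_num)
      have e : y - z = (y - (z + (1 - (1 / 2) ^ j : ℝ) • (x - z))) +
          (1 - (1 / 2) ^ j : ℝ) • (x - z) := by abel
      have e2 : ‖(1 - (1 / 2) ^ j : ℝ) • (x - z)‖ ≤ (1 - (1 / 2) ^ j) * ρ := by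
        rw [norm_smul, Real.norm_of_nonneg (by linarith)]
        gcongr
      rw [e]
      exact (norm_add_le _ _).trans_lt (by linarith)
    have hxmem : ∀ j, x ∈ Bk x j := fun j => by
      rw [hBk, mem_ball_iff_norm]
      have e : x - (z + (1 - (1 / 2) ^ j : ℝ) • (x - z)) = ((1 / 2) ^ j : ℝ) • (x - z) := by
        rw [sub_smul, one_smul]; abel
      rw [e, norm_smul, Real.norm_of_nonneg (by positivity)]
      gcongr
    have hP : ∃ j, volume (Bk x j \ E m) ≤ ENNReal.ofReal δ * volume (Bk x j) := by
      obtain ⟨ε, hε, hball⟩ := Metric.isOpen_iff.1 (hEo m) x hx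
      obtain ⟨j, hj⟩ := exists_pow_lt_of_lt_one (show 0 < ε / (2 * ρ) by positivity)
        (show (1 / 2 : ℝ) < 1 by norm_num)
      refine ⟨j, ?_⟩
      have : Bk x j \ E m = ∅ := by
        rw [Set.sdiff_eq_empty]
        refine Set.Subset.trans (fun y hy => ?_) hball
        have h1 := hxmem j
        rw [hBk, Metric.mem_ball] at hy h1
        rw [Metric.mem_ball]
        rw [lt_div_iff₀ (by positivity)] at hj
        calc dist y x ≤ _ := dist_triangle_right _ _ _
          _ < (1 / 2) ^ j * ρ + (1 / 2) ^ j * ρ := add_lt_add hy h1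
          _ < ε := by linarith
      rw [this]; simp
    classical
    obtain ⟨j, hj, hjmin⟩ : ∃ j, volume (Bk x j \ E m) ≤ ENNReal.ofReal δ * volume (Bk x j) ∧
        ∀ i < j, ¬ volume (Bk x i \ E m) ≤ ENNReal.ofReal δ * volume (Bk x i) :=
      ⟨Nat.find hP, Nat.find_spec hP, fun i hi => Nat.find_min hP hi⟩
    rcases j with - | j
    · exact absurd (by simpa [hBk, hB] using hj) h0
    have hj2 := hjmin j (Nat.lt_succ_self j)
    set t : ℝ := (1 / 2) ^ j with ht
    have ht0 : 0 < t := by positivity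
    have ht1 : t ≤ 1 := pow_le_one₀ (by norm_num) (by norm_num)
    have hts : ((1 : ℝ) / 2) ^ (j + 1) = t / 2 := by rw [pow_succ, ← ht]; ring
    refine ⟨z + (1 - t) • (x - z), t * ρ, by positivity,
      mul_le_of_le_one_left hρ.le ht1, hxmem j, ?_, not_le.1 hj2⟩
    have hset : {y | y ∈ Bk x (j + 1) ∧ v y ≤ m} = Bk x (j + 1) \ E m := by
      ext y
      have := @hsub (j + 1) y
      simp only [Set.mem_ofPred_eq, Set.mem_sdiff, hE, not_and, not_lt]
      exact and_congr_right fun h => ⟨fun h' _ => h', fun h' => h' (this h)⟩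
    have hc : z + (1 - t / 2) • (x - z) ∈ Metric.closedBall z ρ := by
      rw [mem_closedBall_iff_norm, add_sub_cancel_left, norm_smul,
        Real.norm_of_nonneg (by linarith)]
      nlinarith [norm_nonneg (x - z)]
    have hcc := coord_ge_of_mem_closedBall (ln := ln) hc
    intro y hy
    refine ⟨hsub j hy, ?_⟩
    refine hgrow v hv (z + (1 - t / 2) • (x - z)) (t / 2 * ρ) m (by positivity) hm ?_ ?_ y ?_
    · nlinarith
    · rw [← hset] at hj
      simpa only [hBk, hts] using hj
    · rw [mem_ball_iff_norm] at hy
      rw [mem_closedBall_iff_norm]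
      have e : y - (z + (1 - t / 2) • (x - z)) =
          (y - (z + (1 - t) • (x - z))) - (t / 2) • (x - z) := by
        simp only [sub_smul, one_smul]
        have : t • (x - z) = (t / 2) • (x - z) + (t / 2) • (x - z) := by
          rw [← add_smul]; congr 1; ring
        rw [this]; abel
      have e2 : ‖(t / 2) • (x - z)‖ ≤ t / 2 * ρ := by
        rw [norm_smul, Real.norm_of_nonneg (by positivity)]
        gcongr
      rw [e]
      exact (norm_sub_le _ _).trans (by nlinarith)
  choose! c r hr hrρ hxc hsub hvol using hex
  obtain ⟨w, hw, hdisj, hcov⟩ := Vitali.exists_disjoint_subfamily_covering_enlargement_closedBall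
    (E m) c r ρ hrρ 5 (by norm_num)
  have hwc : w.Countable := hdisj.countable_of_nonempty_interior fun x hx =>
    ⟨c x, mem_interior_iff_mem_nhds.2 (Metric.closedBall_mem_nhds _ (hr x (hw hx)))⟩
  have hdisj' : w.PairwiseDisjoint fun x => Metric.ball (c x) (r x) \ E m :=
    hdisj.mono fun x => Set.sdiff_subset.trans Metric.ball_subset_closedBall
  have hmain : ENNReal.ofReal δ * volume (E m) ≤
      ENNReal.ofReal (5 ^ n) * volume (E (k * m) \ E m) := by
    have hcover : E m ⊆ ⋃ x ∈ w, Metric.closedBall (c x) (5 * r x) := fun x hx => by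
      obtain ⟨y, hy, hxy⟩ := hcov x hx
      exact Set.mem_biUnion hy (hxy (Metric.ball_subset_closedBall (hxc x hx)))
    calc ENNReal.ofReal δ * volume (E m)
        ≤ ENNReal.ofReal δ * ∑' x : w, volume (Metric.closedBall (c x) (5 * r x)) := by
          gcongr
          exact (measure_mono hcover).trans (measure_biUnion_le _ hwc _)
      _ = ∑' x : w, ENNReal.ofReal δ * volume (Metric.closedBall (c x) (5 * r x)) :=
          ENNReal.tsum_mul_left.symm
      _ ≤ ∑' x : w, ENNReal.ofReal (5 ^ n) * volume (Metric.ball (c x) (r x) \ E m) := by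
          refine ENNReal.tsum_le_tsum fun x => ?_
          rw [volume_closedBall_mul (c x) (c x) (by norm_num) (hr x (hw x.2)), mul_left_comm]
          gcongr
          exact (hvol x (hw x.2)).le
      _ = ENNReal.ofReal (5 ^ n) * ∑' x : w, volume (Metric.ball (c x) (r x) \ E m) :=
          ENNReal.tsum_mul_left
      _ = ENNReal.ofReal (5 ^ n) * volume (⋃ x ∈ w, Metric.ball (c x) (r x) \ E m) := by
          rw [measure_biUnion hwc hdisj' fun x _ =>
            Metric.isOpen_ball.measurableSet.diff (hEo m).measurableSet]
      _ ≤ _ := by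
          gcongr
          exact Set.iUnion₂_subset fun x hx => Set.sdiff_subset_sdiff_left (hsub x (hw hx))
  have hmono : E m ⊆ E (k * m) := fun x hx => ⟨hx.1, lt_of_le_of_lt (by nlinarith) hx.2⟩
  have h5 : ENNReal.ofReal (δ / 5 ^ n) * volume (E m) ≤ volume (E (k * m) \ E m) := by
    have h5' : ENNReal.ofReal (δ / 5 ^ n) = (ENNReal.ofReal (5 ^ n))⁻¹ * ENNReal.ofReal δ := by
      rw [ENNReal.ofReal_div_of_pos (by positivity), ENNReal.div_eq_inv_mul]
    rw [h5', mul_assoc, ENNReal.inv_mul_le_iff (by simp) ENNReal.ofReal_ne_top]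
    exact hmain
  have hfin : volume (E m) ≠ ⊤ :=
    ((measure_mono fun x hx => hx.1).trans_lt (measure_ball_lt_top (x := z) (r := ρ))).ne
  calc ENNReal.ofReal (1 + δ / 5 ^ n) * volume (E m)
      = volume (E m) + ENNReal.ofReal (δ / 5 ^ n) * volume (E m) := by
        rw [ENNReal.ofReal_add zero_le_one (by positivity), add_mul, ENNReal.ofReal_one, one_mul]
    _ ≤ volume (E m) + volume (E (k * m) \ E m) := by gcongr
    _ = volume (E (k * m)) := by
        rw [add_comm, measure_sdiff (s₁ := E (k * m)) (s₂ := E m) hmono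
          (hEo m).measurableSet.nullMeasurableSet hfin]
        exact tsub_add_cancel_of_le (measure_mono hmono)

/-- Krylov and Safonov: a supersolution exceeding `m` on a fixed fraction of a ball is bounded
below there by a fixed multiple of `m`. -/
lemma growth_of_fraction {n : ℕ} (hn : 0 < n) (b : ℝ) {l u : ℝ} (hl : 0 < l) (hu : 0 < u)
    (ln : Fin n) {θ : ℝ} (hθ : 0 < θ) :
    ∃ c : ℝ, 0 < c ∧ ∀ v, SuperSol b l u ln v → ∀ (z : Eu n) (ρ m : ℝ), 0 < ρ → 0 < m →
      32 * ρ ≤ z ln →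
      ENNReal.ofReal θ * volume (Metric.ball z ρ) ≤ volume {x | x ∈ Metric.ball z ρ ∧ m < v x} →
      ∀ x ∈ Metric.closedBall z ρ, c * m ≤ v x := by
  obtain ⟨δ, k, hδ, hk, hk1, hgrow⟩ := growth_of_density hn b hl hu ln
  have hη : 1 < 1 + δ / 5 ^ n := by
    have : 0 < δ / 5 ^ n := by positivity
    linarith
  obtain ⟨N, hN⟩ := pow_unbounded_of_one_lt (1 / θ) hη
  refine ⟨k ^ (N + 1), by positivity, ?_⟩
  intro v hv z ρ m hρ hm hz hvol
  by_contra! hcon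
  obtain ⟨x, hx, hlt⟩ := hcon
  have hstep : ∀ j, j ≤ N → ENNReal.ofReal ((1 + δ / 5 ^ n) ^ j * θ) * volume (Metric.ball z ρ) ≤
      volume {x | x ∈ Metric.ball z ρ ∧ k ^ j * m < v x} := by
    intro j
    induction j with
    | zero => simpa using hvol
    | succ j ih =>
      intro hj
      rcases ink_step hδ hk1 hgrow hv hρ (show 0 < k ^ j * m by positivity) hz with h | h
      · have h1 := h x hx
        have h2 : k ^ (N + 1) ≤ k ^ (j + 1) := pow_le_pow_of_le_one hk.le hk1 (by omega)
        have h3 : k * (k ^ j * m) = k ^ (j + 1) * m := by ring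
        nlinarith
      · rw [show k ^ (j + 1) * m = k * (k ^ j * m) by ring]
        refine le_trans ?_ h
        rw [pow_succ', mul_assoc, ENNReal.ofReal_mul (by positivity), mul_assoc]
        gcongr
        exact ih (by omega)
  have h1 := (hstep N le_rfl).trans (measure_mono (fun x hx => hx.1))
  have h2 : (1 : ℝ) < (1 + δ / 5 ^ n) ^ N * θ := by rwa [div_lt_iff₀ hθ] at hN
  have h3 : volume (Metric.ball z ρ) <
      ENNReal.ofReal ((1 + δ / 5 ^ n) ^ N * θ) * volume (Metric.ball z ρ) := by
    conv_lhs => rw [← one_mul (volume (Metric.ball z ρ))]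
    rw [ENNReal.mul_lt_mul_iff_left (Metric.measure_ball_pos volume z hρ).ne'
      measure_ball_lt_top.ne]
    simpa using h2
  exact absurd h1 (not_le.2 h3)

/-- The matrix of the tangential Euclidean form. -/
def Tn {n : ℕ} (ln : Fin n) : Mt n := 1 - En ln

section Cylinder

variable {n : ℕ}

lemma qf_Tn (ln : Fin n) (x : Eu n) : qf (Tn ln) x = ‖x‖ ^ 2 - x ln ^ 2 := by
  rw [Tn, qf_sub, qf_one, qf_En]

lemma Tn_transpose (ln : Fin n) : (Tn ln).transpose = Tn ln := by
  simp [Tn, En]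

lemma Tn_row (ln j : Fin n) : Tn ln ln j = 0 := by
  by_cases h : ln = j <;> simp [Tn, En, h]

lemma trace_mul_Tn (a : Mt n) (ln : Fin n) : (a * Tn ln).trace = a.trace - a ln ln := by
  rw [Tn, Matrix.mul_sub, trace_sub, Matrix.mul_one, trace_mul_En]

lemma qf_Tn_nonneg (ln : Fin n) (x : Eu n) : 0 ≤ qf (Tn ln) x := by
  rw [qf_Tn, sub_nonneg, ← sq_abs (x ln)]
  exact pow_le_pow_left₀ (abs_nonneg _) (abs_coord_le x ln) 2

lemma continuous_qf (X : Mt n) : Continuous fun x : Eu n => qf X x := by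
  simp only [qf_eq_sum]; fun_prop

/-- Touching from below by functions `c q(x')/2 + f(x_n)`. -/
lemma touch_cyl {v : Eu n → ℝ} {x : Eu n} (hv : ContDiffAt ℝ 2 v x) {ln : Fin n} {S : Mt n}
    (hS : S.transpose = S) (hS0 : ∀ j, S ln j = 0) (c : ℝ) {f : ℝ → ℝ} {f₁ f₂ : ℝ}
    (hf : Jet2 f (x ln) f₁ f₂)
    (hmin : IsLocalMin (fun y => v y - (c * (qf S y / 2) + f (y ln))) x) (b : ℝ) {a : Mt n}
    (ha : a.PosSemidef) :
    c * (a * S).trace + (f₂ + b * f₁ / x ln) * a ln ln ≤ (a * Mb b v ln x).trace := by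
  have hF : Jet2 (fun s : ℝ => c * s) (qf S (x - 0) / 2) c 0 := by
    refine ⟨fun _ => c, .of_forall fun s => ?_, rfl, hasDerivAt_const _ _⟩
    simpa using (hasDerivAt_id s).const_mul c
  have hmin' : IsLocalMin (fun y => v y - ((fun s : ℝ => c * s) (qf S (y - 0) / 2) + f (y ln))) x := by
    simpa only [sub_zero] using hmin
  have h := touch_trace hv (test_symm hS c 0 f₂ _ ln)
    (fun ξ => jet2_test hS x 0 ln hF hf ξ) hmin' b ln ha
  have h0 : (S *ᵥ x.ofLp) ln = 0 := by simp [mulVec, dotProduct, hS0]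
  simp only [zero_smul, add_zero, sub_zero, Matrix.mul_add, trace_add, Matrix.mul_smul,
    trace_smul, smul_eq_mul, trace_mul_En, dot_single, h0, mul_zero, zero_add] at h
  refine le_trans (le_of_eq ?_) h
  simp
  ring

lemma isCompact_cylinder (ln : Fin n) (r s t : ℝ) :
    IsCompact {x : Eu n | qf (Tn ln) x ≤ r ∧ s ≤ x ln ∧ x ln ≤ t} := by
  have hclosed : IsClosed {x : Eu n | qf (Tn ln) x ≤ r ∧ s ≤ x ln ∧ x ln ≤ t} := by
    have c : Continuous fun y : Eu n => y ln := by fun_prop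
    exact ((isClosed_le (continuous_qf (Tn ln)) continuous_const).inter
      ((isClosed_le continuous_const c).inter (isClosed_le c continuous_const)) :)
  refine Metric.isCompact_of_isClosed_isBounded hclosed
    ((Metric.isBounded_closedBall (x := (0 : Eu n)) (r := 1 + |r| + s ^ 2 + t ^ 2)).subset ?_)
  rintro x ⟨h1, h2, h3⟩
  rw [mem_closedBall_zero_iff]
  rw [qf_Tn] at h1
  have h4 : x ln ^ 2 ≤ s ^ 2 + t ^ 2 := by
    rcases le_total 0 (x ln) with h | h <;> nlinarith [sq_nonneg s, sq_nonneg t]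
  have h5 : ‖x‖ ^ 2 ≤ |r| + s ^ 2 + t ^ 2 := by linarith [le_abs_self r]
  nlinarith [norm_nonneg x, sq_nonneg (‖x‖ - 1)]

lemma cylinder_mem_nhds {ln : Fin n} {r s t : ℝ} {x : Eu n} (h1 : qf (Tn ln) x < r)
    (h2 : s < x ln) (h3 : x ln < t) :
    {x : Eu n | qf (Tn ln) x ≤ r ∧ s ≤ x ln ∧ x ln ≤ t} ∈ 𝓝 x := by
  have c : Continuous fun y : Eu n => y ln := by fun_prop
  filter_upwards [(isOpen_lt (continuous_qf (Tn ln)) continuous_const).mem_nhds h1,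
    (isOpen_lt continuous_const c).mem_nhds h2, (isOpen_lt c continuous_const).mem_nhds h3]
    with y a b c using ⟨le_of_lt a, le_of_lt b, le_of_lt c⟩

lemma qf_Tn_add_single (ln : Fin n) (x : Eu n) (t : ℝ) :
    qf (Tn ln) (x + t • EuclideanSpace.single ln 1) = qf (Tn ln) x := by
  rw [qf_Tn, qf_Tn, EuclideanSpace.norm_sq_eq, EuclideanSpace.norm_sq_eq]
  rw [← Finset.add_sum_erase _ _ (Finset.mem_univ ln),
    ← Finset.add_sum_erase _ (fun i => ‖x.ofLp i‖ ^ 2) (Finset.mem_univ ln)]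
  have : ∑ i ∈ Finset.univ.erase ln, ‖(x + t • EuclideanSpace.single ln (1 : ℝ)).ofLp i‖ ^ 2 =
      ∑ i ∈ Finset.univ.erase ln, ‖x.ofLp i‖ ^ 2 := by
    refine Finset.sum_congr rfl fun i hi => ?_
    simp [Finset.ne_of_mem_erase hi]
  rw [this]
  simp

end Cylinder

/-- Lower bounds for supersolutions spread along segments. -/
lemma chain {n : ℕ} (b : ℝ) {l u : ℝ} (hl : 0 < l) (hu : 0 < u) (ln : Fin n) :
    ∃ κ : ℝ, 0 < κ ∧ κ ≤ 1 ∧ ∀ v, SuperSol b l u ln v → ∀ (N : ℕ) (z w : Eu n) (r m : ℝ), 0 < r →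
      0 ≤ m → 32 * r ≤ z ln → 32 * r ≤ w ln → ‖w - z‖ ≤ 7 * r * N →
      (∀ x ∈ Metric.closedBall z r, m ≤ v x) →
      ∀ x ∈ Metric.closedBall w r, κ ^ N * m ≤ v x := by
  obtain ⟨κ, hκ, hκ1, hD⟩ := doubling (n := n) b hl hu ln
  refine ⟨κ, hκ, hκ1, fun v hv N => ?_⟩
  induction N with
  | zero =>
    intro z w r m hr hm hz hw hd hv x hx
    have : w = z := by simpa [sub_eq_zero] using hd
    subst this
    simpa using hv x hx
  | succ N ih =>
    intro z w r m hr hm hz hw hd hvm x hx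
    have hN : (0 : ℝ) < N + 1 := by positivity
    set s : ℝ := 1 / (N + 1) with hs
    have hs0 : 0 < s := by positivity
    have hs1 : s ≤ 1 := by rw [hs, div_le_one hN]; linarith [N.cast_nonneg (α := ℝ)]
    push_cast at hd
    have hsN : s * (N + 1) = 1 := by rw [hs]; field_simp
    have h1 : ‖s • (w - z)‖ ≤ 7 * r := by
      rw [norm_smul, Real.norm_of_nonneg hs0.le]
      nlinarith
    have h2 : ‖w - (z + s • (w - z))‖ ≤ 7 * r * N := by
      have : w - (z + s • (w - z)) = (1 - s) • (w - z) := by module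
      rw [this, norm_smul, Real.norm_of_nonneg (by linarith)]
      calc (1 - s) * ‖w - z‖ ≤ (1 - s) * (7 * r * (N + 1)) := by gcongr
        _ = 7 * r * ((N + 1) - s * (N + 1)) := by ring
        _ = _ := by rw [hsN]; ring
    have h3 : 32 * r ≤ (z + s • (w - z)) ln := by
      simp only [PiLp.add_apply, PiLp.smul_apply, PiLp.sub_apply, smul_eq_mul]
      nlinarith
    rw [pow_succ, mul_assoc]
    refine ih (z + s • (w - z)) w r (κ * m) hr (by positivity) h3 hw h2 (fun y hy => ?_) x hx
    refine hD v hv z r m hr hm hz hvm y ?_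
    rw [mem_closedBall_iff_norm] at hy ⊢
    calc ‖y - z‖ = ‖(y - (z + s • (w - z))) + s • (w - z)‖ := by congr 1; abel
      _ ≤ _ := norm_add_le _ _
      _ ≤ 8 * r := by linarith

/-- Lower bounds for supersolutions spread from balls to flat discs, at all scales. -/
lemma spread {n : ℕ} (hn : 0 < n) (b : ℝ) {l u θ : ℝ} (hl : 0 < l) (hu : 0 < u) (ln : Fin n)
    (hθ : 0 < θ) {z : Eu n} {ρ δ : ℝ} (hρ : 0 < ρ) (hz : 32 * ρ ≤ z ln) (hδ : 0 < δ) :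
    ∃ c : ℝ, 0 < c ∧ ∀ v, SuperSol b l u ln v → ∀ R m : ℝ, 0 < R → 0 < m →
      ENNReal.ofReal θ * volume (Metric.ball (R • z) (R * ρ)) ≤
        volume {x | x ∈ Metric.ball (R • z) (R * ρ) ∧ m < v x} →
      ∀ x : Eu n, qf (Tn ln) x ≤ R ^ 2 → x ln = δ * R → c * m ≤ v x := by
  obtain ⟨c, hc, hG⟩ := growth_of_fraction hn b hl hu ln hθ
  obtain ⟨κ, hκ, hκ1, hC⟩ := chain (n := n) b hl hu ln
  set r := min ρ (δ / 32) with hr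
  have hr0 : 0 < r := lt_min hρ (by positivity)
  obtain ⟨N, hN⟩ := exists_nat_ge ((‖z‖ + (1 + δ)) / (7 * r))
  rw [div_le_iff₀ (by positivity)] at hN
  refine ⟨κ ^ N * c, by positivity, fun v hv R m hR hm hfr x hx hxn => ?_⟩
  have h1 := hG v hv (R • z) (R * ρ) m (by positivity) hm (by
    simp only [PiLp.smul_apply, smul_eq_mul]; nlinarith) hfr
  have h2 : ‖x‖ ≤ (1 + δ) * R := by
    rw [qf_Tn, hxn] at hx
    refine abs_le_of_sq_le_sq' ?_ (by positivity) |>.2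
    nlinarith [mul_pos hR hR]
  rw [mul_assoc]
  refine hC v hv N (R • z) x (R * r) (c * m) (by positivity) (by positivity) ?_ ?_ ?_ ?_ x
    (Metric.mem_closedBall_self (by positivity))
  · simp only [PiLp.smul_apply, smul_eq_mul]
    nlinarith [min_le_left ρ (δ / 32)]
  · rw [hxn]; nlinarith [min_le_right ρ (δ / 32)]
  · calc ‖x - R • z‖ ≤ ‖x‖ + ‖R • z‖ := norm_sub_le _ _
      _ ≤ (1 + δ) * R + R * ‖z‖ := by
        rw [norm_smul, Real.norm_of_nonneg hR.le]; gcongr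
      _ = R * (‖z‖ + (1 + δ)) := by ring
      _ ≤ R * (N * (7 * r)) := by gcongr
      _ = _ := by ring
  · intro y hy
    exact h1 y (Metric.closedBall_subset_closedBall (by
      gcongr; exact min_le_left _ _) hy)

set_option maxHeartbeats 1000000 in
/-- Lower bounds for supersolutions spread to the boundary. -/
lemma strip {n : ℕ} {b l u : ℝ} (hb : -1 < b) (hl : 0 < l) (hu : 0 < u) (ln : Fin n) :
    ∃ δ : ℝ, 0 < δ ∧ ∀ v, SuperSol b l u ln v → ContinuousOn v {x | 0 ≤ x ln} →
      (∃ C, ∀ x : Eu n, x ln = 0 → ∀ t : ℝ, 0 ≤ t →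
        v (x + t • EuclideanSpace.single ln 1) ≤ v x + C * t ^ 2) →
      ∀ R m : ℝ, 0 < R → 0 < m →
      (∀ x : Eu n, qf (Tn ln) x ≤ R ^ 2 → x ln = δ * R → m ≤ v x) →
      ∀ x : Eu n, qf (Tn ln) x ≤ R ^ 2 / 4 → 0 < x ln → x ln ≤ δ * R → m / 4 ≤ v x := by
  set K : ℝ := n * u / ((1 + b) * l) + 1 with hK
  have hb1 : 0 < 1 + b := by linarith
  have hK0 : 0 < K := by positivity
  have hKl : n * u < K * ((1 + b) * l) := by
    rw [hK, add_mul, div_mul_cancel₀ _ (by positivity)]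
    have : 0 < (1 + b) * l := by positivity
    linarith
  refine ⟨√(1 / (2 * K)), by positivity, fun v hv hvc hvt R m hR hm htop x hx hx0 hxR => ?_⟩
  set δ := √(1 / (2 * K)) with hδ
  have hδ0 : 0 < δ := by positivity
  have hδ2 : K * δ ^ 2 = 1 / 2 := by
    rw [hδ, Real.sq_sqrt (by positivity)]; field_simp
  set γ := max (1 - b) 1 with hγ
  have hγ1 : 1 ≤ γ := le_max_right _ _
  have hγb : 1 - b ≤ γ := le_max_left _ _
  have hγ2 : γ < 2 := max_lt (by linarith) (by norm_num)
  suffices H : ∀ ε : ℝ, 0 < ε → ∀ y : Eu n, qf (Tn ln) y ≤ R ^ 2 → 0 ≤ y ln → y ln ≤ δ * R →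
      (-(2 * m / R ^ 2)) * (qf (Tn ln) y / 2) +
        (m * (1 / 2 + K * y ln ^ 2 / R ^ 2) + ε * (y ln ^ γ - (δ * R) ^ γ)) ≤ v y by
    refine le_of_forall_pos_le_add fun ε hε => ?_
    have hp : 0 < (δ * R) ^ γ := by positivity
    have h := H (ε / (δ * R) ^ γ) (by positivity) x (hx.trans (by nlinarith)) hx0.le hxR
    have h1 : 2 * m / R ^ 2 * (qf (Tn ln) x / 2) ≤ m / 4 := by
      calc _ ≤ 2 * m / R ^ 2 * (R ^ 2 / 4 / 2) := by gcongr
        _ = _ := by field_simp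
    have h2 : 0 ≤ m * (K * x ln ^ 2 / R ^ 2) := by positivity
    have h3 : -ε ≤ ε / (δ * R) ^ γ * (x ln ^ γ - (δ * R) ^ γ) := by
      rw [mul_sub, div_mul_cancel₀ _ hp.ne']
      have : 0 ≤ ε / (δ * R) ^ γ * x ln ^ γ := by positivity
      linarith
    linarith
  intro ε hε
  set f : ℝ → ℝ := fun t => m * (1 / 2 + K * t ^ 2 / R ^ 2) + ε * (t ^ γ - (δ * R) ^ γ) with hf
  by_contra! hcon
  obtain ⟨x₁, h1, h2, h3, hlt⟩ := hcon
  set D : Set (Eu n) := {x : Eu n | qf (Tn ln) x ≤ R ^ 2 ∧ 0 ≤ x ln ∧ x ln ≤ δ * R} with hD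
  set w : Eu n → ℝ := fun y => v y - (-(2 * m / R ^ 2) * (qf (Tn ln) y / 2) + f (y ln)) with hw
  have hfc : Continuous f := by
    have : Continuous fun t : ℝ => t ^ γ := Real.continuous_rpow_const (by linarith)
    simp only [hf]; fun_prop
  have hwc : ContinuousOn w D := by
    refine (hvc.mono fun y hy => hy.2.1).sub (Continuous.continuousOn ?_)
    have := continuous_qf (Tn ln)
    fun_prop
  obtain ⟨y, hyD, hmin⟩ := (isCompact_cylinder ln (R ^ 2) 0 (δ * R)).exists_isMinOn
    ⟨x₁, h1, h2, h3⟩ hwc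
  have hneg : w y < 0 := (hmin (show x₁ ∈ D from ⟨h1, h2, h3⟩)).trans_lt (sub_neg.2 hlt)
  obtain ⟨hy1, hy2, hy3⟩ := hyD
  have hdR : 0 < δ * R := by positivity
  have hpow : y ln ^ γ ≤ (δ * R) ^ γ := Real.rpow_le_rpow hy2 hy3 (by linarith)
  have hKy : K * y ln ^ 2 / R ^ 2 ≤ 1 / 2 := by
    rw [div_le_iff₀ (by positivity), ← hδ2, mul_assoc, ← mul_pow]
    gcongr
  have hfle : f (y ln) ≤ m := by
    simp only [hf]
    nlinarith [mul_nonneg hε.le (sub_nonneg.2 hpow)]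
  have hT := qf_Tn_nonneg ln y
  have hc0 : 0 < 2 * m / R ^ 2 := by positivity
  -- the minimum is not on the lower face
  have hy0 : 0 < y ln := by
    refine lt_of_le_of_ne hy2 fun h0 => ?_
    obtain ⟨C, hC⟩ := hvt
    have hle : ∀ t : ℝ, 0 < t → t ≤ δ * R → ε * t ^ γ ≤ C * t ^ 2 := fun t ht ht2 => by
      have hcoord : (y + t • EuclideanSpace.single ln (1 : ℝ)) ln = t := by simp [← h0]
      have hm1 : w y ≤ w (y + t • EuclideanSpace.single ln 1) :=
        hmin (show _ ∈ D from ⟨by rw [qf_Tn_add_single]; exact hy1, by rw [hcoord]; exact ht.le,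
          by rw [hcoord]; exact ht2⟩)
      simp only [hw, hf, qf_Tn_add_single, hcoord, ← h0] at hm1
      have h4 := hC y h0.symm t ht.le
      rw [Real.zero_rpow (by linarith)] at hm1
      have h5 : 0 ≤ m * (K * t ^ 2 / R ^ 2) := by positivity
      norm_num at hm1
      linarith
    have hlim : Tendsto (fun t : ℝ => C * t ^ (2 - γ)) (𝓝[>] 0) (𝓝 0) := by
      have : ContinuousAt (fun t : ℝ => C * t ^ (2 - γ)) 0 :=
        continuousAt_const.mul (Real.continuousAt_rpow_const _ _ (Or.inr (by linarith)))
      have h := this.tendsto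
      rw [Real.zero_rpow (by linarith), mul_zero] at h
      exact h.mono_left nhdsWithin_le_nhds
    have hev : ∀ᶠ t : ℝ in 𝓝[>] 0, ε ≤ C * t ^ (2 - γ) := by
      filter_upwards [Ioc_mem_nhdsGT hdR] with t ht
      have h4 := hle t ht.1 ht.2
      have hp : 0 < t ^ γ := Real.rpow_pos_of_pos ht.1 _
      have : t ^ 2 = t ^ (2 - γ) * t ^ γ := by
        rw [← Real.rpow_add ht.1, sub_add_cancel, ← Real.rpow_natCast]; norm_num
      rw [this, ← mul_assoc] at h4
      exact le_of_mul_le_mul_right h4 hp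
    have := ge_of_tendsto hlim hev
    linarith
  have hytop : y ln < δ * R := by
    refine lt_of_le_of_ne hy3 fun h0 => ?_
    have h4 := htop y hy1 h0
    simp only [hw] at hneg
    nlinarith
  have hyside : qf (Tn ln) y < R ^ 2 := by
    refine lt_of_le_of_ne hy1 fun h0 => ?_
    have h4 := hv.nonneg y hy0
    simp only [hw, h0] at hneg
    have : 2 * m / R ^ 2 * (R ^ 2 / 2) = m := by field_simp
    linarith
  have hjet : Jet2 f (y ln) (m * (2 * K * y ln / R ^ 2) + ε * (γ * y ln ^ (γ - 1)))
      (m * (2 * K / R ^ 2) + ε * (γ * ((γ - 1) * y ln ^ (γ - 1 - 1)))) := by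
    refine ⟨fun t => m * (2 * K * t / R ^ 2) + ε * (γ * t ^ (γ - 1)), ?_, rfl, ?_⟩
    · filter_upwards [lt_mem_nhds hy0] with t ht
      have e1 := ((((hasDerivAt_id t).pow 2).const_mul (K / R ^ 2)).const_add (1 / 2)).const_mul m
      have e2 := ((Real.hasDerivAt_rpow_const (p := γ) (Or.inl ht.ne')).sub_const
        ((δ * R) ^ γ)).const_mul ε
      have e3 := e1.add e2
      refine (e3.congr_deriv ?_).congr_of_eventuallyEq ?_
      · simp only [id]; push_cast; ring
      · refine .of_forall fun s => ?_
        simp only [hf, id, Pi.add_apply, Pi.pow_apply]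
        ring
    · have e1 := ((hasDerivAt_id (y ln)).const_mul (2 * K / R ^ 2)).const_mul m
      have e2 := ((Real.hasDerivAt_rpow_const (x := y ln) (p := γ - 1)
        (Or.inl hy0.ne')).const_mul γ).const_mul ε
      refine ((e1.add e2).congr_deriv (by ring)).congr_of_eventuallyEq (.of_forall fun s => ?_)
      simp only [id, Pi.add_apply]
      ring
  obtain ⟨a, ha, hsup⟩ := hv.super y hy0
  have ht := touch_cyl (hv.smooth y hy0) (Tn_transpose ln) (Tn_row ln) _ hjet
    (hmin.isLocalMin (cylinder_mem_nhds hyside hy0 hytop)) b (ha.psd hl.le)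
  rw [trace_mul_Tn] at ht
  have ha1 := ha.diag_ge ln
  have ha2 := ha.trace_self_le
  have hp : 0 < y ln ^ (γ - 1 - 1) := Real.rpow_pos_of_pos hy0 _
  have hpp : y ln ^ (γ - 1) = y ln ^ (γ - 1 - 1) * y ln := by
    nth_rewrite 3 [← Real.rpow_one (y ln)]
    rw [← Real.rpow_add hy0]; congr 1; ring
  have hform : m * (2 * K / R ^ 2) + ε * (γ * ((γ - 1) * y ln ^ (γ - 1 - 1))) +
      b * (m * (2 * K * y ln / R ^ 2) + ε * (γ * y ln ^ (γ - 1))) / y ln =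
      (2 * m / R ^ 2) * (K * (1 + b)) + ε * γ * (γ - 1 + b) * y ln ^ (γ - 1 - 1) := by
    rw [hpp]; field_simp; ring
  rw [hform] at ht
  have h6 : 0 ≤ ε * γ * (γ - 1 + b) * y ln ^ (γ - 1 - 1) * a ln ln := by
    have : 0 ≤ γ - 1 + b := by linarith
    have : 0 ≤ a ln ln := by linarith
    positivity
  have h7 : n * u < K * (1 + b) * a ln ln :=
    hKl.trans_le (by rw [← mul_assoc]; gcongr)
  have h8 : 0 < a ln ln := by linarith
  nlinarith [mul_pos hc0 (by linarith : 0 < K * (1 + b) * a ln ln - (a.trace - a ln ln))]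

/-- The standing hypotheses on the solution `ψ`, with gradient `Dψ`. -/
structure Sol {n : ℕ} (b Λ L : ℝ) (ln : Fin n) (ψ : Eu n → ℝ) (Dψ : Eu n → (Eu n →L[ℝ] ℝ)) :
    Prop where
  pos : 0 < Λ
  lip_nonneg : 0 ≤ L
  der : ∀ x, 0 ≤ x ln → HasFDerivWithinAt ψ (Dψ x) {y | 0 ≤ y ln} x
  lip : ∀ x y, 0 ≤ x ln → 0 ≤ y ln → ‖Dψ x - Dψ y‖ ≤ L * ‖x - y‖
  smooth : ∀ x, 0 < x ln → ContDiffAt ℝ 2 ψ x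
  det : ∀ x, 0 < x ln → (Mb b ψ ln x).det = 1
  bdry : ∀ x, x ln = 0 → Dψ x (EuclideanSpace.single ln 1) = 0
  ell : ∀ x, 0 < x ln → Ell Λ⁻¹ Λ (Mb b ψ ln x)

/-- Symmetric second differences. -/
def sd {n : ℕ} (ψ : Eu n → ℝ) (ξ x : Eu n) : ℝ := ψ (x + ξ) + ψ (x - ξ) - 2 * ψ x

/-- The supremum of the second derivative in the direction `ξ`. -/
def Mx {n : ℕ} (b : ℝ) (ψ : Eu n → ℝ) (ln : Fin n) (ξ : Eu n) : ℝ :=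
  ⨆ x : {x : Eu n // 0 < x ln}, qf (Mb b ψ ln x) ξ

section Basic

variable {n : ℕ} {b Λ L : ℝ} {ln : Fin n} {ψ : Eu n → ℝ} {Dψ : Eu n → (Eu n →L[ℝ] ℝ)}

lemma isOpen_upper (ln : Fin n) : IsOpen {x : Eu n | 0 < x ln} :=
  isOpen_lt continuous_const (by fun_prop)

lemma convex_closedUpper (ln : Fin n) : Convex ℝ {x : Eu n | 0 ≤ x ln} := by
  intro x hx y hy s t hs ht _
  simp only [Set.mem_ofPred_eq, PiLp.add_apply, PiLp.smul_apply, smul_eq_mul] at *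
  positivity

lemma convex_upper (ln : Fin n) : Convex ℝ {x : Eu n | 0 < x ln} := by
  intro x hx y hy s t hs ht hst
  simp only [Set.mem_ofPred_eq, PiLp.add_apply, PiLp.smul_apply, smul_eq_mul] at *
  rcases hs.eq_or_lt with rfl | hs
  · have : t = 1 := by linarith
    simpa [this] using hy
  · have := mul_nonneg ht hy.le
    have := mul_pos hs hx
    linarith

lemma Sol.hasFDerivAt (h : Sol b Λ L ln ψ Dψ) {x : Eu n} (hx : 0 < x ln) :
    HasFDerivAt ψ (Dψ x) x :=
  (h.der x hx.le).hasFDerivAt (mem_of_superset ((isOpen_upper ln).mem_nhds hx)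
    fun y hy => (show 0 < y ln from hy).le)

lemma Sol.pd_eq (h : Sol b Λ L ln ψ Dψ) {x : Eu n} (hx : 0 < x ln) (i : Fin n) :
    pd ψ i x = Dψ x (EuclideanSpace.single i 1) := by
  rw [pd, (h.hasFDerivAt hx).fderiv]

lemma Sol.continuousOn (h : Sol b Λ L ln ψ Dψ) : ContinuousOn ψ {x | 0 ≤ x ln} :=
  fun x hx => (h.der x hx).continuousWithinAt

lemma Sol.taylor (h : Sol b Λ L ln ψ Dψ) {x y : Eu n} (hx : 0 ≤ x ln) (hy : 0 ≤ y ln) :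
    |ψ y - ψ x - Dψ x (y - x)| ≤ L * ‖y - x‖ ^ 2 := by
  have hc : Convex ℝ ({z : Eu n | 0 ≤ z ln} ∩ Metric.closedBall x ‖y - x‖) :=
    (convex_closedUpper ln).inter (convex_closedBall _ _)
  have key := hc.norm_image_sub_le_of_norm_hasFDerivWithin_le' (f := ψ) (f' := Dψ) (φ := Dψ x)
    (C := L * ‖y - x‖) (x := x) (y := y)
    (fun z hz => (h.der z hz.1).mono Set.inter_subset_left)
    (fun z hz => (h.lip z x hz.1 hx).trans (by
      have := h.lip_nonneg
      gcongr
      exact mem_closedBall_iff_norm.1 hz.2))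
    ⟨hx, Metric.mem_closedBall_self (norm_nonneg _)⟩ ⟨hy, by rw [mem_closedBall_iff_norm]⟩
  rw [Real.norm_eq_abs] at key
  linarith [key, (by ring : L * ‖y - x‖ * ‖y - x‖ = L * ‖y - x‖ ^ 2)]

lemma norm_single_one (i : Fin n) : ‖(EuclideanSpace.single i (1 : ℝ) : Eu n)‖ = 1 := by simp

lemma Sol.abs_normal_le (h : Sol b Λ L ln ψ Dψ) {x : Eu n} (hx : 0 ≤ x ln) :
    |Dψ x (EuclideanSpace.single ln 1)| ≤ L * x ln := by
  have h0 : (x - x ln • EuclideanSpace.single ln (1 : ℝ)) ln = 0 := by simp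
  have h1 := h.lip x (x - x ln • EuclideanSpace.single ln 1) hx h0.ge
  have h2 := h.bdry _ h0
  have h3 := (Dψ x - Dψ (x - x ln • EuclideanSpace.single ln 1)).le_opNorm
    (EuclideanSpace.single ln 1)
  rw [_root_.sub_apply, h2, sub_zero, norm_single_one, mul_one,
    Real.norm_eq_abs] at h3
  refine (h3.trans h1).trans (le_of_eq ?_)
  rw [sub_sub_cancel, norm_smul, norm_single_one, mul_one, Real.norm_of_nonneg hx]

lemma qf_Mb_of_tangential (b : ℝ) (ψ : Eu n → ℝ) (x : Eu n) {ξ : Eu n} (hξ : ξ ln = 0) :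
    qf (Mb b ψ ln x) ξ = qf (hs ψ x) ξ := by
  rw [Mb_eq, qf_add, qf_smul, qf_En, hξ]; simp

lemma Sol.qf_le (h : Sol b Λ L ln ψ Dψ) {x : Eu n} (hx : 0 < x ln) (ξ : Eu n) :
    qf (Mb b ψ ln x) ξ ≤ Mx b ψ ln ξ := by
  refine le_ciSup (f := fun x : {x : Eu n // 0 < x ln} => qf (Mb b ψ ln x) ξ)
    ⟨Λ * ‖ξ‖ ^ 2, ?_⟩ ⟨x, hx⟩
  rintro _ ⟨y, rfl⟩
  exact (h.ell y y.2).quad_le ξ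

instance (ln : Fin n) : Nonempty {x : Eu n // 0 < x ln} :=
  ⟨⟨EuclideanSpace.single ln 1, by simp⟩⟩

lemma Sol.Mx_le (h : Sol b Λ L ln ψ Dψ) (ξ : Eu n) : Mx b ψ ln ξ ≤ Λ * ‖ξ‖ ^ 2 :=
  ciSup_le fun y => (h.ell y y.2).quad_le ξ

lemma Sol.le_Mx (h : Sol b Λ L ln ψ Dψ) (ξ : Eu n) : Λ⁻¹ * ‖ξ‖ ^ 2 ≤ Mx b ψ ln ξ := by
  have h0 : 0 < (EuclideanSpace.single ln 1 : Eu n) ln := by simp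
  exact ((h.ell _ h0).quad_ge ξ).trans (h.qf_le h0 ξ)

lemma Mx_smul (c : ℝ) (ξ : Eu n) : Mx b ψ ln (c • ξ) = c ^ 2 * Mx b ψ ln ξ := by
  simp only [Mx, qf_vec_smul]
  rw [Real.mul_iSup_of_nonneg (sq_nonneg c)]

/-- Second differences are bounded below by lower bounds of the second derivative. -/
lemma sd_ge_of_le {v : Eu n → ℝ} {x ξ : Eu n} {c : ℝ}
    (hv : ∀ t : ℝ, |t| ≤ 1 → ContDiffAt ℝ 2 v (x + t • ξ))
    (hc : ∀ t : ℝ, |t| ≤ 1 → c ≤ qf (hs v (x + t • ξ)) ξ) : c ≤ sd v ξ x := by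
  have hj : ∀ t : ℝ, |t| ≤ 1 → Jet2 (fun t : ℝ => v (x + t • ξ)) t (fderiv ℝ v (x + t • ξ) ξ)
      (qf (hs v (x + t • ξ)) ξ) := fun t ht => by
    have := (hv t ht).jet2_comp (c := fun s : ℝ => x + s • ξ) (jet2_line x ξ t)
    simpa [snd_eq_qf (hv t ht)] using this
  have hd : ∀ t : ℝ, |t| ≤ 1 → HasDerivAt (fun t : ℝ => v (x + t • ξ) - c * (t ^ 2 / 2))
      (fderiv ℝ v (x + t • ξ) ξ - c * t) t := fun t ht => by
    have h1 := (hj t ht).hasDerivAt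
    have h2 := (((hasDerivAt_id t).pow 2).div_const 2).const_mul c
    refine (h1.sub h2).congr_deriv ?_
    simp
  have hd2 : ∀ t : ℝ, |t| < 1 → HasDerivAt (fun t : ℝ => fderiv ℝ v (x + t • ξ) ξ - c * t)
      (qf (hs v (x + t • ξ)) ξ - c) t := fun t ht => by
    have h2 := (hasDerivAt_id t).const_mul c
    have h1 : HasDerivAt (fun t : ℝ => fderiv ℝ v (x + t • ξ) ξ) (qf (hs v (x + t • ξ)) ξ) t := by
      obtain ⟨f', e1, e2, e3⟩ := hj t ht.le
      refine e3.congr_of_eventuallyEq ?_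
      filter_upwards [e1, (isOpen_lt continuous_abs continuous_const).mem_nhds ht] with s hs hs1
      exact (hj s (le_of_lt hs1)).hasDerivAt.unique hs
    refine (h1.sub h2).congr_deriv ?_
    simp
  have habs : ∀ t ∈ Set.Icc (-1 : ℝ) 1, |t| ≤ 1 := fun t ht => abs_le.2 ht
  have hconv : ConvexOn ℝ (Set.Icc (-1 : ℝ) 1) (fun t : ℝ => v (x + t • ξ) - c * (t ^ 2 / 2)) := by
    refine convexOn_of_hasDerivWithinAt2_nonneg (convex_Icc _ _)
      (f' := fun t => fderiv ℝ v (x + t • ξ) ξ - c * t)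
      (f'' := fun t => qf (hs v (x + t • ξ)) ξ - c)
      (fun t ht => (hd t (habs t ht)).continuousAt.continuousWithinAt) ?_ ?_ ?_
    all_goals
      intro t ht
      rw [interior_Icc] at ht
    · exact (hd t (habs t ⟨ht.1.le, ht.2.le⟩)).hasDerivWithinAt
    · exact (hd2 t (abs_lt.2 ht)).hasDerivWithinAt
    · exact sub_nonneg.2 (hc t (habs t ⟨ht.1.le, ht.2.le⟩))
  have := hconv.2 (show (-1 : ℝ) ∈ Set.Icc (-1 : ℝ) 1 by norm_num)
    (show (1 : ℝ) ∈ Set.Icc (-1 : ℝ) 1 by norm_num) (show (0 : ℝ) ≤ 1 / 2 by norm_num)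
    (show (0 : ℝ) ≤ 1 / 2 by norm_num) (by norm_num)
  simp only [smul_eq_mul] at this
  norm_num at this
  rw [sd, sub_eq_add_neg x ξ]
  linarith

lemma hs_neg (v : Eu n → ℝ) (x : Eu n) : hs (fun y => -v y) x = -hs v x := by
  have h0 : ∀ (w : Eu n → ℝ) i y, pd (fun y => -w y) i y = -pd w i y := fun w i y => by
    simp [pd, fderiv_fun_neg]
  ext i j
  simp only [hs, Matrix.of_apply, Matrix.neg_apply, pd2]
  rw [← h0]
  congr 1
  exact funext fun y => h0 v j y

/-- Second differences are bounded above by upper bounds of the second derivative. -/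
lemma sd_le_of_le {v : Eu n → ℝ} {x ξ : Eu n} {c : ℝ}
    (hv : ∀ t : ℝ, |t| ≤ 1 → ContDiffAt ℝ 2 v (x + t • ξ))
    (hc : ∀ t : ℝ, |t| ≤ 1 → qf (hs v (x + t • ξ)) ξ ≤ c) : sd v ξ x ≤ c := by
  have := sd_ge_of_le (v := fun y => -v y) (x := x) (ξ := ξ) (c := -c) (fun t ht => (hv t ht).neg)
    (fun t ht => by
      have h0 : qf (-hs v (x + t • ξ)) ξ = -qf (hs v (x + t • ξ)) ξ := by
        rw [← neg_one_smul ℝ, qf_smul]; ring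
      rw [hs_neg, h0]
      exact neg_le_neg (hc t ht))
  simp only [sd] at *
  linarith

lemma Sol.sd_le (h : Sol b Λ L ln ψ Dψ) {x ξ : Eu n} (hx : 0 < x ln) (hξ : ξ ln = 0) :
    sd ψ ξ x ≤ Mx b ψ ln ξ := by
  have h0 : ∀ t : ℝ, 0 < (x + t • ξ) ln := fun t => by simpa [hξ] using hx
  refine sd_le_of_le (fun t _ => h.smooth _ (h0 t)) fun t _ => ?_
  rw [← qf_Mb_of_tangential b _ _ hξ]
  exact h.qf_le (h0 t) ξ

lemma Sol.sd_nonneg (h : Sol b Λ L ln ψ Dψ) {x ξ : Eu n} (hx : 0 < x ln) (hξ : ξ ln = 0) :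
    0 ≤ sd ψ ξ x := by
  have h0 : ∀ t : ℝ, 0 < (x + t • ξ) ln := fun t => by simpa [hξ] using hx
  refine sd_ge_of_le (fun t _ => h.smooth _ (h0 t)) fun t _ => ?_
  rw [← qf_Mb_of_tangential b _ _ hξ]
  refine le_trans ?_ ((h.ell _ (h0 t)).quad_ge ξ)
  have := h.pos
  positivity

end Basic

section Jets

variable {n : ℕ}

lemma Jet2.unique {f : ℝ → ℝ} {t d₁ d₂ e₁ e₂ : ℝ} (h : Jet2 f t d₁ d₂) (h' : Jet2 f t e₁ e₂) :
    d₁ = e₁ ∧ d₂ = e₂ := by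
  refine ⟨h.hasDerivAt.unique h'.hasDerivAt, ?_⟩
  obtain ⟨f', a1, -, a2⟩ := h
  obtain ⟨g', b1, -, b2⟩ := h'
  refine a2.unique (b2.congr_of_eventuallyEq ?_)
  filter_upwards [a1, b1] with s hs ht using hs.unique ht

/-- The matrix `M_b[v]` is determined by the second-order jets of `v` along lines. -/
lemma Mb_of_jets {v : Eu n → ℝ} {x : Eu n} (hv : ContDiffAt ℝ 2 v x) {ℓ : Eu n → ℝ} {X : Mt n}
    (hX : X.transpose = X) (hΦ : ∀ ξ : Eu n, Jet2 (fun t : ℝ => v (x + t • ξ)) 0 (ℓ ξ) (qf X ξ))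
    (b : ℝ) (ln : Fin n) :
    Mb b v ln x = X + (b * ℓ (EuclideanSpace.single ln 1) / x ln) • En ln := by
  have hmin : IsLocalMin (fun y => v y - v y) x := by
    simp only [sub_self]; exact .of_forall fun _ => le_rfl
  obtain ⟨h1, h2⟩ := touch hv hX hΦ hmin
  have h3 : ∀ ξ, qf (hs v x - X) ξ = 0 := fun ξ => by
    rw [qf_sub, ((jet2_line_comp hv ξ).unique (hΦ ξ)).2, sub_self]
  have h4 : (hs v x - X).trace = 0 := by
    refine Finset.sum_eq_zero fun i _ => ?_
    have := h3 (EuclideanSpace.single i 1)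
    simpa [qf] using this
  have h5 : hs v x = X := sub_eq_zero.1 (h2.trace_eq_zero_iff.1 h4)
  rw [Mb_eq, h5, pd, h1]

lemma Mb_scale {v : Eu n → ℝ} {R : ℝ} (hR : 0 < R) {x : Eu n} (hv : ContDiffAt ℝ 2 v (R • x))
    (b : ℝ) (ln : Fin n) :
    ContDiffAt ℝ 2 (fun y => v (R • y) / R ^ 2) x ∧
      Mb b (fun y => v (R • y) / R ^ 2) ln x = Mb b v ln (R • x) := by
  have hc : ContDiffAt ℝ 2 (fun y => v (R • y) / R ^ 2) x :=
    (ContDiffAt.comp x (g := v) hv (by fun_prop : ContDiffAt ℝ 2 (fun y : Eu n => R • y) x)).div_const _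
  refine ⟨hc, ?_⟩
  rw [Mb_of_jets hc (ℓ := fun ξ => R⁻¹ * fderiv ℝ v (R • x) ξ) (X := hs v (R • x)) (hs_symm hv)
    (fun ξ => ?_) b ln, Mb_eq b v]
  · congr 2
    simp only [pd, PiLp.smul_apply, smul_eq_mul]
    field_simp
  · have h := (jet2_line_comp hv (R • ξ)).const_mul (1 / R ^ 2)
    have e1 : 1 / R ^ 2 * fderiv ℝ v (R • x) (R • ξ) = R⁻¹ * fderiv ℝ v (R • x) ξ := by
      rw [map_smul, smul_eq_mul]; field_simp
    have e2 : 1 / R ^ 2 * qf (hs v (R • x)) (R • ξ) = qf (hs v (R • x)) ξ := by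
      rw [qf_vec_smul]; field_simp
    rw [e1, e2] at h
    convert h using 2 with t
    rw [smul_add, smul_comm R t ξ]
    ring

lemma Mb_sd {v : Eu n → ℝ} {x ξ : Eu n} {ln : Fin n} (hξ : ξ ln = 0) (hv : ContDiffAt ℝ 2 v x)
    (hv₁ : ContDiffAt ℝ 2 v (x + ξ)) (hv₂ : ContDiffAt ℝ 2 v (x - ξ)) (b c : ℝ) :
    ContDiffAt ℝ 2 (fun y => c - sd v ξ y) x ∧ Mb b (fun y => c - sd v ξ y) ln x =
      (2 : ℝ) • Mb b v ln x - Mb b v ln (x + ξ) - Mb b v ln (x - ξ) := by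
  have hc : ContDiffAt ℝ 2 (fun y => c - sd v ξ y) x := by
    have c1 : ContDiffAt ℝ 2 (fun y => v (y + ξ)) x :=
      ContDiffAt.comp x (g := v) hv₁ (by fun_prop : ContDiffAt ℝ 2 (fun y : Eu n => y + ξ) x)
    have c2 : ContDiffAt ℝ 2 (fun y => v (y - ξ)) x :=
      ContDiffAt.comp x (g := v) hv₂ (by fun_prop : ContDiffAt ℝ 2 (fun y : Eu n => y - ξ) x)
    exact contDiffAt_const.sub ((c1.add c2).sub (contDiffAt_const.mul hv))
  refine ⟨hc, ?_⟩
  rw [Mb_of_jets hc (ℓ := fun ζ => 2 * fderiv ℝ v x ζ - fderiv ℝ v (x + ξ) ζ -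
    fderiv ℝ v (x - ξ) ζ) (X := (2 : ℝ) • hs v x - hs v (x + ξ) - hs v (x - ξ)) ?_ ?_ b ln]
  · have e1 : (x + ξ) ln = x ln := by simp [hξ]
    have e2 : (x - ξ) ln = x ln := by simp [hξ]
    simp only [Mb_eq, pd, e1, e2]
    ext i j
    simp only [Matrix.add_apply, Matrix.sub_apply, Matrix.smul_apply, smul_eq_mul]
    ring
  · simp [hs_symm hv, hs_symm hv₁, hs_symm hv₂]
  · intro ζ
    have h := (jet2_const c (0 : ℝ)).sub ((((jet2_line_comp hv₁ ζ).add (jet2_line_comp hv₂ ζ))).sub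
      ((jet2_line_comp hv ζ).const_mul 2))
    have e1 : 0 - (fderiv ℝ v (x + ξ) ζ + fderiv ℝ v (x - ξ) ζ - 2 * fderiv ℝ v x ζ) =
      2 * fderiv ℝ v x ζ - fderiv ℝ v (x + ξ) ζ - fderiv ℝ v (x - ξ) ζ := by ring
    have e2 : 0 - (qf (hs v (x + ξ)) ζ + qf (hs v (x - ξ)) ζ - 2 * qf (hs v x) ζ) =
        qf ((2 : ℝ) • hs v x - hs v (x + ξ) - hs v (x - ξ)) ζ := by
      simp only [qf_sub, qf_smul]; ring
    rw [e1, e2] at h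
    convert h using 2 with t
    rw [sd, add_right_comm x ξ, ← sub_add_eq_add_sub x ξ (t • ζ)]

end Jets

section Deficit

variable {n : ℕ} {b Λ L : ℝ} {ln : Fin n} {ψ : Eu n → ℝ} {Dψ : Eu n → (Eu n →L[ℝ] ℝ)}

lemma Sol.scale (h : Sol b Λ L ln ψ Dψ) {R : ℝ} (hR : 0 < R) :
    Sol b Λ L ln (fun x => ψ (R • x) / R ^ 2) (fun x => R⁻¹ • Dψ (R • x)) := by
  have hp : ∀ x : Eu n, 0 < x ln → 0 < (R • x) ln := fun x hx => by
    simpa using mul_pos hR hx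
  have hp' : ∀ x : Eu n, 0 ≤ x ln → 0 ≤ (R • x) ln := fun x hx => by
    simpa using mul_nonneg hR.le hx
  refine ⟨h.pos, h.lip_nonneg, fun x hx => ?_, fun x y hx hy => ?_, fun x hx => ?_, fun x hx => ?_,
    fun x hx => ?_, fun x hx => ?_⟩
  · have h1 := (h.der (R • x) (hp' x hx)).comp x (f := fun y : Eu n => R • y)
      ((hasFDerivAt_id x).const_smul R).hasFDerivWithinAt (fun y hy => hp' y hy)
    have h2 := h1.const_mul (1 / R ^ 2)
    refine (h2.congr_fderiv ?_).congr_of_eventuallyEq (.of_forall fun y => ?_) ?_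
    · ext ζ
      simp
      field_simp
    · simp; ring
    · simp; ring
  · have e : R⁻¹ • Dψ (R • x) - R⁻¹ • Dψ (R • y) = R⁻¹ • (Dψ (R • x) - Dψ (R • y)) :=
      (smul_sub _ _ _).symm
    rw [e, norm_smul, Real.norm_of_nonneg (by positivity)]
    have := h.lip (R • x) (R • y) (hp' x hx) (hp' y hy)
    rw [← smul_sub, norm_smul, Real.norm_of_nonneg hR.le] at this
    calc R⁻¹ * ‖Dψ (R • x) - Dψ (R • y)‖ ≤ R⁻¹ * (L * (R * ‖x - y‖)) := by gcongr
      _ = _ := by field_simp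
  · exact (Mb_scale hR (h.smooth _ (hp x hx)) b ln).1
  · rw [(Mb_scale hR (h.smooth _ (hp x hx)) b ln).2]; exact h.det _ (hp x hx)
  · rw [_root_.smul_apply, h.bdry (R • x) (by simp [hx]), smul_zero]
  · rw [(Mb_scale hR (h.smooth _ (hp x hx)) b ln).2]; exact h.ell _ (hp x hx)

lemma Mx_scale (h : Sol b Λ L ln ψ Dψ) {R : ℝ} (hR : 0 < R) (ξ : Eu n) :
    Mx b (fun x => ψ (R • x) / R ^ 2) ln ξ = Mx b ψ ln ξ := by
  have h' := h.scale hR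
  refine le_antisymm (ciSup_le fun x => ?_) (ciSup_le fun x => ?_)
  · have hx : 0 < (R • x.1) ln := by simpa using mul_pos hR x.2
    rw [(Mb_scale hR (h.smooth _ hx) b ln).2]
    exact h.qf_le hx ξ
  · have hx : 0 < (R⁻¹ • x.1) ln := by simpa using mul_pos (inv_pos.2 hR) x.2
    have := h'.qf_le hx ξ
    rw [(Mb_scale hR (by rw [smul_inv_smul₀ hR.ne']; exact h.smooth _ x.2) b ln).2,
      smul_inv_smul₀ hR.ne'] at this
    exact this

/-- The deficit of the second difference is a supersolution. -/
lemma Sol.superSol (h : Sol b Λ L ln ψ Dψ) {ξ : Eu n} (hξ : ξ ln = 0) :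
    SuperSol b Λ⁻¹ Λ ln (fun x => Mx b ψ ln ξ - sd ψ ξ x) := by
  have hΛ := h.pos
  have h1 : ∀ x : Eu n, 0 < x ln → 0 < (x + ξ) ln := fun x hx => by simpa [hξ] using hx
  have h2 : ∀ x : Eu n, 0 < x ln → 0 < (x - ξ) ln := fun x hx => by simpa [hξ] using hx
  refine ⟨fun x hx => ?_, fun x hx => sub_nonneg.2 (h.sd_le hx hξ), fun x hx => ?_⟩
  · exact (Mb_sd hξ (h.smooth x hx) (h.smooth _ (h1 x hx)) (h.smooth _ (h2 x hx)) b _).1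
  · have ha : Ell Λ⁻¹ Λ (Mb b ψ ln x)⁻¹ := by
      have := (h.ell x hx).inv (inv_pos.2 hΛ) hΛ
      rwa [inv_inv] at this
    have hap := ha.psd (inv_pos.2 hΛ).le
    have hdet : (Mb b ψ ln x)⁻¹.det = 1 := by simp [Matrix.det_nonsing_inv, h.det x hx]
    have hmul : (Mb b ψ ln x)⁻¹ * Mb b ψ ln x = 1 :=
      Matrix.nonsing_inv_mul _ (by rw [h.det x hx]; exact isUnit_one)
    have key : ∀ y : Eu n, 0 < y ln → (n : ℝ) ≤ ((Mb b ψ ln x)⁻¹ * Mb b ψ ln y).trace := fun y hy =>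
      trace_mul_ge ln.pos hap ((h.ell y hy).psd (inv_pos.2 hΛ).le)
        (by rw [hdet, h.det y hy, one_mul])
    refine ⟨_, ha, ?_⟩
    rw [(Mb_sd hξ (h.smooth x hx) (h.smooth _ (h1 x hx)) (h.smooth _ (h2 x hx)) b _).2]
    simp only [Matrix.mul_sub, Matrix.mul_smul, trace_sub, trace_smul, hmul, trace_one,
      Fintype.card_fin, smul_eq_mul]
    linarith [key _ (h1 x hx), key _ (h2 x hx)]

end Deficit

section Decay

variable {n : ℕ} {b Λ L : ℝ} {ln : Fin n} {ψ : Eu n → ℝ} {Dψ : Eu n → (Eu n →L[ℝ] ℝ)}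

/-- Normalised deficits, which are nonnegative supersolutions. -/
lemma Sol.superSol_pow (h : Sol b Λ L ln ψ Dψ) {ξ : Eu n} (hξ : ξ ln = 0) (m : ℕ) :
    SuperSol b Λ⁻¹ Λ ln (fun x => Mx b ψ ln ξ - 4 ^ m * sd ψ ((1 / 2 : ℝ) ^ m • ξ) x) := by
  have hm : ((1 / 2 : ℝ) ^ m • ξ) ln = 0 := by simp [hξ]
  have h1 := (h.superSol hm).div_const (m := (1 / 4 : ℝ) ^ m) (by positivity)
  convert h1 using 2 with x
  have e : ((1 / 2 : ℝ) ^ m) ^ 2 = (1 / 4) ^ m := by rw [← pow_mul, mul_comm, pow_mul]; norm_num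
  have e4 : (4 : ℝ) ^ m * (1 / 4) ^ m = 1 := by rw [← mul_pow]; norm_num
  rw [Mx_smul, e, eq_div_iff (by positivity), sub_mul, mul_right_comm, e4]
  ring

lemma Sol.sd_boundary (h : Sol b Λ L ln ψ Dψ) {ξ : Eu n} (hξ : ξ ln = 0) {x : Eu n}
    (hx : x ln = 0) {t : ℝ} (ht : 0 ≤ t) :
    sd ψ ξ x - 4 * L * t ^ 2 ≤ sd ψ ξ (x + t • EuclideanSpace.single ln 1) := by
  have key : ∀ y : Eu n, y ln = 0 → |ψ (y + t • EuclideanSpace.single ln 1) - ψ y| ≤ L * t ^ 2 := by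
    intro y hy
    have h1 := h.taylor (x := y) (y := y + t • EuclideanSpace.single ln 1) hy.ge
      (by simpa [hy] using ht)
    rw [add_sub_cancel_left, map_smul, h.bdry y hy, smul_zero, sub_zero, norm_smul,
      norm_single_one, mul_one, Real.norm_of_nonneg ht] at h1
    exact h1
  have k1 := abs_le.1 (key x hx)
  have k2 := abs_le.1 (key (x + ξ) (by simp [hx, hξ]))
  have k3 := abs_le.1 (key (x - ξ) (by simp [hx, hξ]))
  have e1 := add_right_comm x (t • EuclideanSpace.single ln (1 : ℝ)) ξ
  have e2 := sub_add_eq_add_sub x ξ (t • EuclideanSpace.single ln (1 : ℝ))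
  rw [sd, sd, e1, ← e2]
  linarith

/-- Near points of almost maximal second derivative the normalised deficit is small. -/
lemma Sol.exists_small (h : Sol b Λ L ln ψ Dψ) {ξ : Eu n} (hξ : ξ ln = 0) {ε : ℝ} (hε : 0 < ε) :
    ∃ (x : Eu n) (m : ℕ), 0 < x ln ∧ Mx b ψ ln ξ - 4 ^ m * sd ψ ((1 / 2 : ℝ) ^ m • ξ) x < ε := by
  obtain ⟨⟨x, hx⟩, hlt⟩ := exists_lt_of_lt_ciSup
    (show Mx b ψ ln ξ - ε / 2 < ⨆ x : {x : Eu n // 0 < x ln}, qf (Mb b ψ ln x) ξ from by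
      change _ < Mx b ψ ln ξ; linarith)
  have hcont : ContinuousAt (fun y => qf (hs ψ y) ξ) x := by
    have := continuousAt_hs (h.smooth x hx)
    have h2 : Continuous fun X : Mt n => qf X ξ := by simp only [qf_eq_sum]; fun_prop
    exact h2.continuousAt.comp this
  rw [qf_Mb_of_tangential b _ _ hξ] at hlt
  have hnear := hcont.eventually (lt_mem_nhds hlt)
  obtain ⟨r, hr, hball⟩ := Metric.eventually_nhds_iff.1 hnear
  have hlim : Tendsto (fun m : ℕ => (1 / 2 : ℝ) ^ m * ‖ξ‖) atTop (𝓝 0) := by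
    simpa using (tendsto_pow_atTop_nhds_zero_of_lt_one (by norm_num : (0 : ℝ) ≤ 1 / 2)
      (by norm_num)).mul_const ‖ξ‖
  obtain ⟨m, hm⟩ := (hlim.eventually (gt_mem_nhds hr)).exists
  refine ⟨x, m, hx, ?_⟩
  have h0 : ∀ t : ℝ, 0 < (x + t • (1 / 2 : ℝ) ^ m • ξ) ln := fun t => by simpa [hξ] using hx
  have e : ((1 / 2 : ℝ) ^ m) ^ 2 = (1 / 4) ^ m := by rw [← pow_mul, mul_comm, pow_mul]; norm_num
  have e4 : (4 : ℝ) ^ m * (1 / 4) ^ m = 1 := by rw [← mul_pow]; norm_num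
  have hsd := sd_ge_of_le (v := ψ) (x := x) (ξ := (1 / 2 : ℝ) ^ m • ξ)
    (c := (1 / 4) ^ m * (Mx b ψ ln ξ - ε / 2)) (fun t _ => h.smooth _ (h0 t)) fun t ht => by
      rw [qf_vec_smul, e]
      have : dist (x + t • (1 / 2 : ℝ) ^ m • ξ) x < r := by
        rw [dist_eq_norm, add_sub_cancel_left, norm_smul, norm_smul,
          Real.norm_of_nonneg (by positivity : (0 : ℝ) ≤ (1 / 2) ^ m), Real.norm_eq_abs]
        refine lt_of_le_of_lt ?_ hm
        exact mul_le_of_le_one_left (by positivity) ht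
      have := hball this
      gcongr
  have h4 : (4 : ℝ) ^ m * ((1 / 4) ^ m * (Mx b ψ ln ξ - ε / 2)) ≤
      4 ^ m * sd ψ ((1 / 2 : ℝ) ^ m • ξ) x := by gcongr
  rw [← mul_assoc, e4, one_mul] at h4
  linarith

/-- The normalised deficit is small in measure at large scales. -/
lemma Sol.decay (h : Sol b Λ L ln ψ Dψ) (hb : -1 < b) {ξ : Eu n} (hξ : ξ ln = 0) {z : Eu n}
    {ρ η : ℝ} (hρ : 0 < ρ) (hz : 32 * ρ ≤ z ln) (hη : 0 < η) :
    ∃ (m : ℕ) (R₀ : ℝ), ∀ R, R₀ ≤ R → 0 < R →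
      volume {x | x ∈ Metric.ball (R • z) (R * ρ) ∧
        η < Mx b ψ ln ξ - 4 ^ m * sd ψ ((1 / 2 : ℝ) ^ m • ξ) x} ≤
      ENNReal.ofReal η * volume (Metric.ball (R • z) (R * ρ)) := by
  have hΛ := h.pos
  obtain ⟨δ, hδ, hstrip⟩ := strip hb (inv_pos.2 hΛ) hΛ ln
  obtain ⟨c, hc, hspread⟩ := spread ln.pos b (inv_pos.2 hΛ) hΛ ln hη hρ hz hδ
  obtain ⟨x₀, m, hx₀, hlt⟩ := h.exists_small hξ (ε := c * η / 4) (by positivity)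
  refine ⟨m, max (2 * ‖x₀‖) (x₀ ln / δ), fun R hR hR0 => ?_⟩
  by_contra! hcon
  have hv := h.superSol_pow hξ m
  have hm : ((1 / 2 : ℝ) ^ m • ξ) ln = 0 := by simp [hξ]
  have h1 := hspread _ hv R η hR0 hη hcon.le
  have hpos : ∀ x : Eu n, 0 ≤ x ln → 0 ≤ (x + (1 / 2 : ℝ) ^ m • ξ) ln := fun x hx => by
    simpa [hξ] using hx
  have hpos' : ∀ x : Eu n, 0 ≤ x ln → 0 ≤ (x - (1 / 2 : ℝ) ^ m • ξ) ln := fun x hx => by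
    simpa [hξ] using hx
  have h2 := hstrip _ hv (by
      refine continuousOn_const.sub (continuousOn_const.mul ((ContinuousOn.add ?_ ?_).sub
        (continuousOn_const.mul h.continuousOn)))
      · exact h.continuousOn.comp (by fun_prop) fun x hx => hpos x hx
      · exact h.continuousOn.comp (by fun_prop) fun x hx => hpos' x hx)
    ⟨4 ^ m * (4 * L), fun x hx t ht => by
      have := h.sd_boundary hm hx ht
      have h4 : (0 : ℝ) < 4 ^ m := by positivity
      nlinarith⟩ R (c * η) hR0 (by positivity) h1 x₀ ?_ hx₀ ?_
  · linarith
  · have : 2 * ‖x₀‖ ≤ R := (le_max_left _ _).trans hR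
    rw [qf_Tn]
    nlinarith [norm_nonneg x₀, sq_nonneg (x₀ ln)]
  · have := (le_max_right (2 * ‖x₀‖) (x₀ ln / δ)).trans hR
    rw [div_le_iff₀ hδ] at this
    linarith

end Decay

section Doubling

variable {n : ℕ} {b Λ L : ℝ} {ln : Fin n} {ψ : Eu n → ℝ} {Dψ : Eu n → (Eu n →L[ℝ] ℝ)}

lemma setLIntegral_ball_add (f : Eu n → ℝ≥0∞) (y ζ : Eu n) (s : ℝ) :
    ∫⁻ x in Metric.ball y s, f (x + ζ) = ∫⁻ x in Metric.ball (y + ζ) s, f x := by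
  rw [← lintegral_indicator Metric.isOpen_ball.measurableSet,
    ← lintegral_indicator Metric.isOpen_ball.measurableSet,
    ← lintegral_add_right_eq_self ((Metric.ball (y + ζ) s).indicator f) ζ]
  refine lintegral_congr fun x => ?_
  have : x ∈ Metric.ball y s ↔ x + ζ ∈ Metric.ball (y + ζ) s := by
    simp
  by_cases hx : x ∈ Metric.ball y s
  · rw [Set.indicator_of_mem hx, Set.indicator_of_mem (this.1 hx)]
  · rw [Set.indicator_of_notMem hx, Set.indicator_of_notMem (fun h => hx (this.2 h))]

/-- Doubling the step of the second difference. -/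
lemma Sol.lintegral_deficit (h : Sol b Λ L ln ψ Dψ) {ξ : Eu n} (hξ : ξ ln = 0) (j : ℕ) :
    ∀ (y : Eu n) (s : ℝ), s < y ln →
      ∫⁻ x in Metric.ball y s, ENNReal.ofReal (Mx b ψ ln ((2 : ℝ) ^ j • ξ) -
        sd ψ ((2 : ℝ) ^ j • ξ) x) ≤
      4 ^ j * ∫⁻ x in Metric.ball y (s + 2 ^ j * ‖ξ‖),
        ENNReal.ofReal (Mx b ψ ln ξ - sd ψ ξ x) := by
  induction j with
  | zero =>
    intro y s hs
    simp only [pow_zero, one_smul, one_mul]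
    exact lintegral_mono_set (Metric.ball_subset_ball (by linarith [norm_nonneg ξ]))
  | succ j ih =>
    intro y s hs
    set ζ : Eu n := (2 : ℝ) ^ j • ξ with hζ
    have hζn : ζ ln = 0 := by simp [hζ, hξ]
    have hζnorm : ‖ζ‖ = 2 ^ j * ‖ξ‖ := by
      rw [hζ, norm_smul, Real.norm_of_nonneg (by positivity)]
    have e : (2 : ℝ) ^ (j + 1) • ξ = (2 : ℝ) • ζ := by rw [hζ, smul_smul, pow_succ']
    set d : Eu n → ℝ := fun x => Mx b ψ ln ζ - sd ψ ζ x with hd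
    set g : Eu n → ℝ≥0∞ := fun x => ENNReal.ofReal (d x) with hg
    have hd0 : ∀ x : Eu n, 0 < x ln → 0 ≤ d x := fun x hx => sub_nonneg.2 (h.sd_le hx hζn)
    have hball : ∀ x ∈ Metric.ball y s, 0 < x ln := fun x hx => by
      linarith [coord_ge_of_mem_closedBall (ln := ln) (Metric.ball_subset_closedBall hx)]
    have hdc : ∀ τ : Eu n, τ ln = 0 →
        AEMeasurable (fun x => g (x + τ)) (volume.restrict (Metric.ball y s)) := fun τ hτ => by
      have hc : ContinuousOn (fun x => d (x + τ)) (Metric.ball y s) := by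
        have : ∀ σ : Eu n, σ ln = 0 →
            ContinuousOn (fun x => ψ (x + σ)) (Metric.ball y s) := fun σ hσ =>
          h.continuousOn.comp (by fun_prop) fun x hx => by
            simpa [hσ] using (hball x hx).le
        have h1 := this (τ + ζ) (by simp [hτ, hζn])
        have h2 := this (τ - ζ) (by simp [hτ, hζn])
        have h3 := this τ hτ
        simp only [← add_assoc, ← add_sub_assoc] at h1 h2
        exact continuousOn_const.sub ((h1.add h2).sub (continuousOn_const.mul h3))
      exact (hc.aemeasurable Metric.isOpen_ball.measurableSet).ennreal_ofReal
    have hsplit : ∀ x ∈ Metric.ball y s, ENNReal.ofReal (Mx b ψ ln ((2 : ℝ) • ζ) -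
        sd ψ ((2 : ℝ) • ζ) x) = g (x + ζ) + 2 * g (x + 0) + g (x + -ζ) := fun x hx => by
      have hx0 := hball x hx
      have p1 := hd0 (x + ζ) (by simpa [hζn] using hx0)
      have p2 := hd0 (x + -ζ) (by simpa [hζn] using hx0)
      have p3 := hd0 (x + 0) (by simpa using hx0)
      have e2 : 2 * ENNReal.ofReal (d (x + 0)) = ENNReal.ofReal (2 * d (x + 0)) := by
        rw [ENNReal.ofReal_mul (by norm_num)]
        norm_num
      simp only [hg]
      rw [e2, ← ENNReal.ofReal_add p1 (by positivity),
        ← ENNReal.ofReal_add (by positivity) p2]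
      congr 1
      simp only [hd, sd, Mx_smul, add_zero]
      have a1 : x + ζ + ζ = x + (2 : ℝ) • ζ := by module
      have a2 : x + ζ - ζ = x := by module
      have a3 : x + -ζ + ζ = x := by module
      have a4 : x + -ζ - ζ = x - (2 : ℝ) • ζ := by module
      have a5 : x - ζ = x + -ζ := by module
      rw [a1, a2, a3, a4, a5]
      ring
    have hI : ∀ τ : Eu n, τ ln = 0 → ‖τ‖ ≤ 2 ^ j * ‖ξ‖ →
        ∫⁻ x in Metric.ball y s, g (x + τ) ≤ 4 ^ j *
          ∫⁻ x in Metric.ball y (s + 2 ^ (j + 1) * ‖ξ‖), ENNReal.ofReal (Mx b ψ ln ξ - sd ψ ξ x) := by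
      intro τ hτ hτn
      rw [setLIntegral_ball_add]
      refine (ih (y + τ) s (by simpa [hτ] using hs)).trans ?_
      gcongr
      refine Metric.ball_subset_ball' ?_
      rw [dist_eq_norm, add_sub_cancel_left, pow_succ]
      linarith
    rw [e, setLIntegral_congr_fun Metric.isOpen_ball.measurableSet hsplit,
      lintegral_add_right' _ (hdc (-ζ) (by simp [hζn])),
      lintegral_add_left' (hdc ζ hζn), lintegral_const_mul'' _ (hdc 0 (by simp))]
    have i1 := hI ζ hζn hζnorm.le
    have i2 := hI 0 (by simp) (by simp)
    have i3 := hI (-ζ) (by simp [hζn]) (by rw [norm_neg]; exact hζnorm.le)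
    refine (add_le_add (add_le_add i1 (mul_le_mul_right i2 2)) i3).trans (le_of_eq ?_)
    rw [pow_succ]
    ring

end Doubling

/-- The blow-down of `ψ` at scale `2 ^ k`. -/
def bd {n : ℕ} (ψ : Eu n → ℝ) (k : ℕ) (x : Eu n) : ℝ := ψ ((2 : ℝ) ^ k • x) / ((2 : ℝ) ^ k) ^ 2

/-- The gradient of the blow-down of `ψ` at scale `2 ^ k`. -/
def bdGrad {n : ℕ} (Dψ : Eu n → (Eu n →L[ℝ] ℝ)) (k : ℕ) (x : Eu n) : Eu n →L[ℝ] ℝ :=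
  ((2 : ℝ) ^ k)⁻¹ • Dψ ((2 : ℝ) ^ k • x)

lemma lintegral_le_of_level {n : ℕ} {v : Eu n → ℝ} {S : Set (Eu n)} {B η : ℝ}
    (hS : MeasurableSet S) (hvB : ∀ x ∈ S, v x ≤ B) (hB : 0 ≤ B) (hη : 0 ≤ η)
    (hm : volume {x | x ∈ S ∧ η < v x} ≤ ENNReal.ofReal η * volume S) :
    ∫⁻ x in S, ENNReal.ofReal (v x) ≤ ENNReal.ofReal (η * (1 + B)) * volume S := by
  set T := {x | x ∈ S ∧ η < v x} with hT
  have h1 : ∫⁻ x in S, ENNReal.ofReal (v x) ≤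
      ∫⁻ x in S, (ENNReal.ofReal η + T.indicator (fun _ => ENNReal.ofReal B) x) := by
    refine setLIntegral_mono' hS fun x hx => ?_
    by_cases hxT : x ∈ T
    · rw [Set.indicator_of_mem hxT]
      exact (ENNReal.ofReal_le_ofReal (hvB x hx)).trans le_add_self
    · rw [Set.indicator_of_notMem hxT, add_zero]
      refine ENNReal.ofReal_le_ofReal ?_
      by_contra! hlt
      exact hxT ⟨hx, hlt⟩
  refine h1.trans ?_
  rw [lintegral_add_left measurable_const, setLIntegral_const]
  have h2 : ∫⁻ x in S, T.indicator (fun _ => ENNReal.ofReal B) x ≤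
      ENNReal.ofReal B * (ENNReal.ofReal η * volume S) :=
    (lintegral_indicator_const_le _ _).trans
      (mul_le_mul_right ((Measure.restrict_le_self _).trans hm) _)
  refine (add_le_add_right h2 _).trans (le_of_eq ?_)
  rw [← mul_assoc, ← add_mul, ← ENNReal.ofReal_mul hB, ← ENNReal.ofReal_add hη (by positivity)]
  congr 2
  ring

section Limit

variable {n : ℕ} {b Λ L : ℝ} {ln : Fin n} {ψ : Eu n → ℝ} {Dψ : Eu n → (Eu n →L[ℝ] ℝ)}

lemma Sol.blowDown (h : Sol b Λ L ln ψ Dψ) (k : ℕ) : Sol b Λ L ln (bd ψ k) (bdGrad Dψ k) :=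
  h.scale (by positivity)

lemma Mx_bd (h : Sol b Λ L ln ψ Dψ) (k : ℕ) (ξ : Eu n) : Mx b (bd ψ k) ln ξ = Mx b ψ ln ξ :=
  Mx_scale h (by positivity) ξ

lemma sd_bd (ψ : Eu n → ℝ) (k : ℕ) (ξ x : Eu n) :
    sd (bd ψ k) ξ x = sd ψ ((2 : ℝ) ^ k • ξ) ((2 : ℝ) ^ k • x) / 4 ^ k := by
  have e : ((2 : ℝ) ^ k) ^ 2 = 4 ^ k := by rw [← pow_mul, mul_comm, pow_mul]; norm_num
  simp only [sd, bd, e, smul_add, smul_sub]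
  ring

lemma Sol.Mx_nonneg (h : Sol b Λ L ln ψ Dψ) (ξ : Eu n) : 0 ≤ Mx b ψ ln ξ := by
  have := h.pos
  exact le_trans (by positivity) (h.le_Mx ξ)

/-- Almost maximal second differences occur near every point at large scales. -/
lemma Sol.exists_near (h : Sol b Λ L ln ψ Dψ) (hb : -1 < b) {ξ : Eu n} (hξ : ξ ln = 0) {z : Eu n}
    {ρ ε : ℝ} (hρ : 0 < ρ) (hz : 32 * (ρ + ‖ξ‖) ≤ z ln) (hε : 0 < ε) :
    ∀ᶠ k : ℕ in atTop, ∃ x ∈ Metric.ball z ρ, Mx b ψ ln ξ - ε ≤ sd (bd ψ k) ξ x := by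
  set B := Mx b ψ ln ξ with hBdef
  have hB : 0 ≤ B := h.Mx_nonneg ξ
  set ρ₁ := ρ + ‖ξ‖ with hρ₁
  have hρ₁0 : 0 < ρ₁ := by positivity
  obtain ⟨η, hη, hηε⟩ : ∃ η : ℝ, 0 < η ∧ η * (1 + B) * (ρ₁ / ρ) ^ n < ε := by
    refine ⟨ε / (2 * ((1 + B) * (ρ₁ / ρ) ^ n)), by positivity, ?_⟩
    have : 0 < (1 + B) * (ρ₁ / ρ) ^ n := by positivity
    rw [mul_assoc, div_mul_eq_mul_div, div_lt_iff₀ (by positivity)]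
    nlinarith
  obtain ⟨m, R₀, hdec⟩ := h.decay hb hξ hρ₁0 hz hη
  have hlarge : ∀ᶠ k : ℕ in atTop, R₀ ≤ (2 : ℝ) ^ k :=
    (tendsto_pow_atTop_atTop_of_one_lt (by norm_num : (1 : ℝ) < 2)).eventually_ge_atTop R₀
  filter_upwards [hlarge] with k hk
  set R : ℝ := 2 ^ k with hR
  have hR0 : 0 < R := by positivity
  have e4 : R ^ 2 = 4 ^ k := by rw [hR, ← pow_mul, mul_comm, pow_mul]; norm_num
  set ζ : Eu n := (1 / 2 : ℝ) ^ m • ξ with hζ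
  have hζn : ζ ln = 0 := by simp [hζ, hξ]
  have eζ : ((1 / 2 : ℝ) ^ m) ^ 2 = (1 / 4) ^ m := by rw [← pow_mul, mul_comm, pow_mul]; norm_num
  have em : (1 / 4 : ℝ) ^ m * 4 ^ m = 1 := by rw [← mul_pow]; norm_num
  have hballpos : ∀ {x : Eu n} {s : ℝ}, s ≤ R * ρ₁ → x ∈ Metric.ball (R • z) s → 0 < x ln := by
    intro x s hs hx
    have := coord_ge_of_mem_closedBall (ln := ln) (Metric.ball_subset_closedBall hx)
    rw [PiLp.smul_apply, smul_eq_mul] at this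
    nlinarith
  have hup := lintegral_le_of_level (v := fun x => B - 4 ^ m * sd ψ ζ x) (B := B)
    Metric.isOpen_ball.measurableSet
    (fun x hx => by
      have := h.sd_nonneg (hballpos le_rfl hx) hζn
      have : (0 : ℝ) ≤ 4 ^ m * sd ψ ζ x := by positivity
      linarith) hB hη.le (hdec R hk hR0)
  have hrw : ∫⁻ x in Metric.ball (R • z) (R * ρ₁), ENNReal.ofReal (Mx b ψ ln ζ - sd ψ ζ x) =
      ENNReal.ofReal ((1 / 4) ^ m) *
        ∫⁻ x in Metric.ball (R • z) (R * ρ₁), ENNReal.ofReal (B - 4 ^ m * sd ψ ζ x) := by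
    rw [← lintegral_const_mul' _ _ ENNReal.ofReal_ne_top]
    refine lintegral_congr fun x => ?_
    rw [← ENNReal.ofReal_mul (by positivity)]
    congr 1
    rw [hζ, Mx_smul, eζ, mul_sub, ← mul_assoc, em, one_mul]
  have hdef := h.lintegral_deficit hζn (k + m) (R • z) (R * ρ) (by
    rw [PiLp.smul_apply, smul_eq_mul]
    have := norm_nonneg ξ
    nlinarith)
  have e1 : (2 : ℝ) ^ (k + m) • ζ = R • ξ := by
    rw [hζ, smul_smul, pow_add, mul_assoc, ← mul_pow, hR]
    norm_num
  have e2 : R * ρ + 2 ^ (k + m) * ‖ζ‖ = R * ρ₁ := by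
    have : 2 ^ (k + m) * ‖ζ‖ = ‖(2 : ℝ) ^ (k + m) • ζ‖ := by
      rw [norm_smul _ ζ, Real.norm_of_nonneg (by positivity : (0 : ℝ) ≤ 2 ^ (k + m))]
    rw [this, e1, norm_smul, Real.norm_of_nonneg hR0.le, hρ₁, mul_add]
  rw [e1, e2, hrw] at hdef
  by_contra! hcon
  have hlow : ENNReal.ofReal (R ^ 2 * ε) * volume (Metric.ball (R • z) (R * ρ)) ≤
      ∫⁻ x in Metric.ball (R • z) (R * ρ), ENNReal.ofReal (Mx b ψ ln (R • ξ) - sd ψ (R • ξ) x) := by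
    rw [← setLIntegral_const]
    refine setLIntegral_mono' Metric.isOpen_ball.measurableSet fun x hx => ?_
    refine ENNReal.ofReal_le_ofReal ?_
    have hmem : R⁻¹ • x ∈ Metric.ball z ρ := by
      rw [mem_ball_iff_norm] at hx ⊢
      have : R⁻¹ • x - z = R⁻¹ • (x - R • z) := by
        rw [smul_sub, smul_smul, inv_mul_cancel₀ hR0.ne', one_smul]
      rw [this, norm_smul, norm_inv, Real.norm_of_nonneg hR0.le, inv_mul_lt_iff₀ hR0]
      exact hx
    have := hcon _ hmem
    rw [sd_bd, ← hR, smul_smul, mul_inv_cancel₀ hR0.ne', one_smul, ← e4,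
      div_lt_iff₀ (by positivity)] at this
    rw [Mx_smul, ← hBdef]
    linarith
  have hvol := volume_ball_mul (R • z) (R • z) (s := ρ₁ / ρ) (r := R * ρ) (by positivity)
    (by positivity)
  have e3 : ρ₁ / ρ * (R * ρ) = R * ρ₁ := by field_simp
  rw [e3] at hvol
  rw [hvol] at hup
  have h44 : (4 : ℝ≥0∞) ^ (k + m) = ENNReal.ofReal (4 ^ (k + m)) := by
    rw [ENNReal.ofReal_pow (by norm_num)]; norm_num
  have hall := hlow.trans (hdef.trans (mul_le_mul_right (mul_le_mul_right hup _) _))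
  rw [h44, ← mul_assoc, ← mul_assoc, ← mul_assoc, ← ENNReal.ofReal_mul (by positivity),
    ← ENNReal.ofReal_mul (by positivity), ← ENNReal.ofReal_mul (by positivity)] at hall
  rw [ENNReal.mul_le_mul_iff_left (Metric.measure_ball_pos volume _ (by positivity)).ne'
    measure_ball_lt_top.ne, ENNReal.ofReal_le_ofReal_iff (by positivity)] at hall
  have e5 : (4 : ℝ) ^ (k + m) * (1 / 4) ^ m = R ^ 2 := by
    rw [e4, pow_add, mul_assoc, mul_comm ((4 : ℝ) ^ m), em, mul_one]
  rw [e5, mul_assoc] at hall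
  have := mul_lt_mul_of_pos_left hηε (by positivity : 0 < R ^ 2)
  linarith

lemma Sol.sd_lipschitz (h : Sol b Λ L ln ψ Dψ) {ξ : Eu n} (hξ : ξ ln = 0) {x y : Eu n}
    (hx : 0 < x ln) (hy : 0 < y ln) : |sd ψ ξ x - sd ψ ξ y| ≤ 2 * L * ‖ξ‖ * ‖x - y‖ := by
  have key := (convex_upper ln).norm_image_sub_le_of_norm_hasFDerivWithin_le (f := sd ψ ξ)
    (f' := fun z => Dψ (z + ξ) + Dψ (z - ξ) - (2 : ℝ) • Dψ z) (C := 2 * L * ‖ξ‖) (x := y) (y := x)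
    (fun z hz => ?_) (fun z hz => ?_) hy hx
  · simpa [Real.norm_eq_abs] using key
  · have h1 := (h.hasFDerivAt (x := z + ξ) (by simpa [hξ] using hz)).comp z
      ((hasFDerivAt_id z).add_const ξ)
    have h2 := (h.hasFDerivAt (x := z - ξ) (by simpa [hξ] using hz)).comp z
      ((hasFDerivAt_id z).sub_const ξ)
    have h3 := (h.hasFDerivAt hz).const_mul 2
    exact ((h1.add h2).sub h3).hasFDerivWithinAt
  · have hz' : 0 ≤ z ln := le_of_lt hz
    have h1 := h.lip (z + ξ) z (by simpa [hξ] using hz') hz'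
    have h2 := h.lip (z - ξ) z (by simpa [hξ] using hz') hz'
    rw [add_sub_cancel_left] at h1
    rw [sub_sub_cancel_left, norm_neg] at h2
    have : Dψ (z + ξ) + Dψ (z - ξ) - (2 : ℝ) • Dψ z = (Dψ (z + ξ) - Dψ z) + (Dψ (z - ξ) - Dψ z) := by
      module
    rw [this]
    exact (norm_add_le _ _).trans (by linarith)

/-- Second differences of blow-downs converge to the maximal second derivative. -/
lemma Sol.tendsto_sd (h : Sol b Λ L ln ψ Dψ) (hb : -1 < b) {ξ : Eu n} (hξ : ξ ln = 0) {z : Eu n}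
    (hz : 32 * ‖ξ‖ < z ln) :
    Tendsto (fun k => sd (bd ψ k) ξ z) atTop (𝓝 (Mx b ψ ln ξ)) := by
  have hz0 : 0 < z ln := lt_of_le_of_lt (by positivity) hz
  have hle : ∀ k, sd (bd ψ k) ξ z ≤ Mx b ψ ln ξ := fun k => by
    rw [← Mx_bd h k]; exact (h.blowDown k).sd_le hz0 hξ
  rw [tendsto_order]
  refine ⟨fun c hc => ?_, fun c hc => Eventually.of_forall fun k => (hle k).trans_lt hc⟩
  set δ := Mx b ψ ln ξ - c with hδ
  have hδ0 : 0 < δ := by linarith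
  have hL := h.lip_nonneg
  obtain ⟨ρ, hρ, hρz, hρL⟩ : ∃ ρ : ℝ, 0 < ρ ∧ 32 * (ρ + ‖ξ‖) ≤ z ln ∧
      2 * L * ‖ξ‖ * ρ ≤ δ / 2 := by
    refine ⟨min ((z ln - 32 * ‖ξ‖) / 32) (δ / 2 / (2 * L * ‖ξ‖ + 1)),
      lt_min (by linarith) (by positivity), ?_, ?_⟩
    · have := min_le_left ((z ln - 32 * ‖ξ‖) / 32) (δ / 2 / (2 * L * ‖ξ‖ + 1))
      linarith
    · have := min_le_right ((z ln - 32 * ‖ξ‖) / 32) (δ / 2 / (2 * L * ‖ξ‖ + 1))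
      calc _ ≤ 2 * L * ‖ξ‖ * (δ / 2 / (2 * L * ‖ξ‖ + 1)) := by gcongr
        _ ≤ δ / 2 := by
          rw [mul_div_assoc', div_le_iff₀ (by positivity)]
          nlinarith
  filter_upwards [h.exists_near hb hξ hρ hρz (by linarith : 0 < δ / 4)] with k ⟨x, hx, hxk⟩
  have hxn : 0 < x ln := by
    have := coord_ge_of_mem_closedBall (ln := ln) (Metric.ball_subset_closedBall hx)
    have := norm_nonneg ξ
    linarith
  have h1 := (h.blowDown k).sd_lipschitz hξ hxn hz0
  have h2 : 2 * L * ‖ξ‖ * ‖x - z‖ ≤ 2 * L * ‖ξ‖ * ρ := by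
    gcongr
    exact (mem_ball_iff_norm.1 hx).le
  have := (abs_le.1 h1).2
  linarith

end Limit

/-- `Ψ` and `G` are the limits of the blow-downs of `ψ` and of their gradients. -/
structure BlowLim {n : ℕ} (ln : Fin n) (ψ : Eu n → ℝ) (Dψ : Eu n → (Eu n →L[ℝ] ℝ))
    (𝒰 : Ultrafilter ℕ) (Ψ : Eu n → ℝ) (G : Eu n → (Eu n →L[ℝ] ℝ)) : Prop where
  le_atTop : (𝒰 : Filter ℕ) ≤ atTop
  val : ∀ x, 0 ≤ x ln → Tendsto (fun k => bd ψ k x) 𝒰 (𝓝 (Ψ x))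
  grad : ∀ x, 0 ≤ x ln → Tendsto (fun k => bdGrad Dψ k x) 𝒰 (𝓝 (G x))

lemma exists_tendsto_ultrafilter {X ι : Type*} [TopologicalSpace X] {K : Set X} (hK : IsCompact K)
    (𝒰 : Ultrafilter ι) {u : ι → X} (hu : ∀ i, u i ∈ K) : ∃ l ∈ K, Tendsto u 𝒰 (𝓝 l) :=
  hK.ultrafilter_le_nhds (𝒰.map u) (by
    rw [le_principal_iff]
    exact Filter.Eventually.of_forall (f := (𝒰 : Filter ι)) hu)

section BlowDown

variable {n : ℕ} {b Λ L : ℝ} {ln : Fin n} {ψ : Eu n → ℝ} {Dψ : Eu n → (Eu n →L[ℝ] ℝ)}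

lemma Sol.exists_blowLim (h : Sol b Λ L ln ψ Dψ) :
    ∃ (𝒰 : Ultrafilter ℕ) (Ψ : Eu n → ℝ) (G : Eu n → (Eu n →L[ℝ] ℝ)),
      BlowLim ln ψ Dψ 𝒰 Ψ G := by
  have hG : ∀ k x, 0 ≤ x ln → ‖bdGrad Dψ k x‖ ≤ ‖Dψ 0‖ + L * ‖x‖ := fun k x hx => by
    have h1 := (h.blowDown k).lip x 0 hx (by simp)
    have h2 : ‖bdGrad Dψ k 0‖ ≤ ‖Dψ 0‖ := by
      rw [bdGrad, smul_zero, norm_smul, norm_inv, Real.norm_of_nonneg (by positivity)]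
      exact mul_le_of_le_one_left (norm_nonneg _) (inv_le_one_of_one_le₀ (one_le_pow₀ (by norm_num)))
    rw [sub_zero] at h1
    have h3 := norm_le_norm_add_norm_sub (bdGrad Dψ k 0) (bdGrad Dψ k x)
    rw [norm_sub_rev] at h3
    linarith
  have hψ : ∀ k x, 0 ≤ x ln → |bd ψ k x| ≤ |ψ 0| + ‖Dψ 0‖ * ‖x‖ + L * ‖x‖ ^ 2 := fun k x hx => by
    have h1 := (h.blowDown k).taylor (x := 0) (y := x) (by simp) hx
    rw [sub_zero] at h1
    have h2 : |bdGrad Dψ k 0 x| ≤ ‖Dψ 0‖ * ‖x‖ := by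
      refine ((bdGrad Dψ k 0).le_opNorm x).trans ?_
      have := hG k 0 (by simp)
      rw [norm_zero, mul_zero, add_zero] at this
      gcongr
    have h3 : |bd ψ k 0| ≤ |ψ 0| := by
      rw [bd, smul_zero, abs_div, abs_of_nonneg (by positivity : (0 : ℝ) ≤ (2 ^ k) ^ 2)]
      exact div_le_self (abs_nonneg _) (one_le_pow₀ (one_le_pow₀ (by norm_num)))
    rw [abs_le] at *
    constructor <;> linarith
  have : ∀ x : Eu n, ∃ l : ℝ × (Eu n →L[ℝ] ℝ), 0 ≤ x ln →
      Tendsto (fun k => bd ψ k x) (hyperfilter ℕ) (𝓝 l.1) ∧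
      Tendsto (fun k => bdGrad Dψ k x) (hyperfilter ℕ) (𝓝 l.2) := fun x => by
    by_cases hx : 0 ≤ x ln
    · obtain ⟨l, -, hl⟩ := exists_tendsto_ultrafilter
        (isCompact_Icc (a := -(|ψ 0| + ‖Dψ 0‖ * ‖x‖ + L * ‖x‖ ^ 2))
          (b := |ψ 0| + ‖Dψ 0‖ * ‖x‖ + L * ‖x‖ ^ 2))
        (hyperfilter ℕ) (u := fun k => bd ψ k x) fun k => abs_le.1 (hψ k x hx)
      have : ProperSpace (Eu n →L[ℝ] ℝ) := FiniteDimensional.proper ℝ _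
      obtain ⟨g, -, hg⟩ := exists_tendsto_ultrafilter
        (isCompact_closedBall (0 : Eu n →L[ℝ] ℝ) (‖Dψ 0‖ + L * ‖x‖))
        (hyperfilter ℕ) (u := fun k => bdGrad Dψ k x) fun k =>
          mem_closedBall_zero_iff.2 (hG k x hx)
      exact ⟨(l, g), fun _ => ⟨hl, hg⟩⟩
    · exact ⟨0, fun h => absurd h hx⟩
  choose l hl using this
  exact ⟨hyperfilter ℕ, fun x => (l x).1, fun x => (l x).2, Nat.hyperfilter_le_atTop,
    fun x hx => (hl x hx).1, fun x hx => (hl x hx).2⟩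

variable {𝒰 : Ultrafilter ℕ} {Ψ : Eu n → ℝ} {G : Eu n → (Eu n →L[ℝ] ℝ)}

lemma BlowLim.taylor (H : BlowLim ln ψ Dψ 𝒰 Ψ G) (h : Sol b Λ L ln ψ Dψ) {x y : Eu n}
    (hx : 0 ≤ x ln) (hy : 0 ≤ y ln) : |Ψ y - Ψ x - G x (y - x)| ≤ L * ‖y - x‖ ^ 2 := by
  have h1 : Tendsto (fun k => bdGrad Dψ k x (y - x)) 𝒰 (𝓝 (G x (y - x))) :=
    ((ContinuousLinearMap.apply ℝ ℝ (y - x)).continuous.tendsto _).comp (H.grad x hx)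
  exact le_of_tendsto (((H.val y hy).sub (H.val x hx)).sub h1).abs
    (Eventually.of_forall fun k => (h.blowDown k).taylor hx hy)

lemma BlowLim.lip (H : BlowLim ln ψ Dψ 𝒰 Ψ G) (h : Sol b Λ L ln ψ Dψ) {x y : Eu n}
    (hx : 0 ≤ x ln) (hy : 0 ≤ y ln) : ‖G x - G y‖ ≤ L * ‖x - y‖ :=
  le_of_tendsto ((H.grad x hx).sub (H.grad y hy)).norm
    (Eventually.of_forall fun k => (h.blowDown k).lip x y hx hy)

lemma BlowLim.bdry (H : BlowLim ln ψ Dψ 𝒰 Ψ G) (h : Sol b Λ L ln ψ Dψ) {x : Eu n}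
    (hx : x ln = 0) : G x (EuclideanSpace.single ln 1) = 0 := by
  have h1 : Tendsto (fun k => bdGrad Dψ k x (EuclideanSpace.single ln 1)) 𝒰
      (𝓝 (G x (EuclideanSpace.single ln 1))) :=
    ((ContinuousLinearMap.apply ℝ ℝ (EuclideanSpace.single ln 1)).continuous.tendsto _).comp
      (H.grad x hx.ge)
  refine tendsto_nhds_unique h1 ?_
  simp only [(h.blowDown _).bdry x hx]
  exact tendsto_const_nhds

lemma BlowLim.val_zero (H : BlowLim ln ψ Dψ 𝒰 Ψ G) : Ψ 0 = 0 := by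
  refine tendsto_nhds_unique (H.val 0 (by simp)) ?_
  simp only [bd, smul_zero]
  refine Tendsto.mono_left ?_ H.le_atTop
  refine tendsto_const_nhds.div_atTop ?_
  simp only [← pow_mul, mul_comm _ 2]
  simp only [pow_mul]
  exact tendsto_pow_atTop_atTop_of_one_lt (by norm_num)

lemma BlowLim.grad_zero (H : BlowLim ln ψ Dψ 𝒰 Ψ G) : G 0 = 0 := by
  refine tendsto_nhds_unique (H.grad 0 (by simp)) ?_
  simp only [bdGrad, smul_zero]
  refine Tendsto.mono_left ?_ H.le_atTop
  have : Tendsto (fun k : ℕ => ((2 : ℝ) ^ k)⁻¹) atTop (𝓝 0) :=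
    (tendsto_pow_atTop_atTop_of_one_lt (by norm_num)).inv_tendsto_atTop
  simpa using this.smul_const (Dψ 0)

lemma BlowLim.continuousOn (H : BlowLim ln ψ Dψ 𝒰 Ψ G) (h : Sol b Λ L ln ψ Dψ) :
    ContinuousOn Ψ {x | 0 ≤ x ln} := fun x hx => by
  have h1 : Tendsto (fun y => L * ‖y - x‖ ^ 2) (𝓝[{x | 0 ≤ x ln}] x) (𝓝 0) := by
    have : Continuous fun y : Eu n => L * ‖y - x‖ ^ 2 := by fun_prop
    simpa using (this.tendsto x).mono_left nhdsWithin_le_nhds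
  have h2 : Tendsto (fun y => Ψ y - Ψ x - G x (y - x)) (𝓝[{x | 0 ≤ x ln}] x) (𝓝 0) :=
    squeeze_zero_norm' (by
      filter_upwards [self_mem_nhdsWithin] with y hy
      exact H.taylor h hx hy) h1
  have h3 : Tendsto (fun y => G x (y - x)) (𝓝[{x | 0 ≤ x ln}] x) (𝓝 0) := by
    have : Continuous fun y : Eu n => G x (y - x) := by fun_prop
    simpa using (this.tendsto x).mono_left nhdsWithin_le_nhds
  have h4 := (h2.add h3).add_const (Ψ x)
  simpa [ContinuousWithinAt] using h4

lemma BlowLim.continuousOn_grad (H : BlowLim ln ψ Dψ 𝒰 Ψ G) (h : Sol b Λ L ln ψ Dψ) :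
    ContinuousOn G {x | 0 ≤ x ln} := by
  have : LipschitzOnWith (Real.toNNReal L) G {x | 0 ≤ x ln} :=
    LipschitzOnWith.of_dist_le_mul fun x hx y hy => by
      rw [dist_eq_norm, dist_eq_norm, Real.coe_toNNReal _ h.lip_nonneg]
      exact H.lip h hx hy
  exact this.continuousOn

lemma BlowLim.hasFDerivAt (H : BlowLim ln ψ Dψ 𝒰 Ψ G) (h : Sol b Λ L ln ψ Dψ) {x : Eu n}
    (hx : 0 < x ln) : HasFDerivAt Ψ (G x) x := by
  have h1 : HasFDerivAt (fun y => Ψ y - Ψ x - G x (y - x)) (0 : Eu n →L[ℝ] ℝ) x := by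
    refine Asymptotics.IsBigO.hasFDerivAt (n := 2) ?_ (by norm_num)
    refine Asymptotics.IsBigO.of_bound L ?_
    filter_upwards [(isOpen_upper ln).mem_nhds hx] with y hy
    rw [Real.norm_eq_abs, Real.norm_of_nonneg (by positivity)]
    exact H.taylor h hx.le (le_of_lt hy)
  have h2 := (h1.add ((G x).hasFDerivAt.comp x ((hasFDerivAt_id x).sub_const x))).add_const (Ψ x)
  refine (h2.congr_fderiv ?_).congr_of_eventuallyEq (Eventually.of_forall fun y => ?_)
  · ext; simp
  · simp

/-- Second differences of the limit are constant. -/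
lemma BlowLim.sd_eq (H : BlowLim ln ψ Dψ 𝒰 Ψ G) (h : Sol b Λ L ln ψ Dψ) (hb : -1 < b)
    {ξ z : Eu n} (hξ : ξ ln = 0) (hz : 0 < z ln) : sd Ψ ξ z = Mx b ψ ln ξ := by
  have base : ∀ ξ z : Eu n, ξ ln = 0 → 32 * ‖ξ‖ < z ln → sd Ψ ξ z = Mx b ψ ln ξ := by
    intro ξ z hξ hz
    have hz0 : 0 ≤ z ln := le_trans (by positivity) hz.le
    refine tendsto_nhds_unique ?_ ((h.tendsto_sd hb hξ hz).mono_left H.le_atTop)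
    exact ((H.val _ (by simpa [hξ] using hz0)).add (H.val _ (by simpa [hξ] using hz0))).sub
      ((H.val z hz0).const_mul 2)
  have step : ∀ j : ℕ, ∀ ξ z : Eu n, ξ ln = 0 → 32 * ‖ξ‖ < 2 ^ j * z ln →
      sd Ψ ξ z = Mx b ψ ln ξ := by
    intro j
    induction j with
    | zero => intro ξ z hξ hz; exact base ξ z hξ (by simpa using hz)
    | succ j ih =>
      intro ξ z hξ hz
      obtain ⟨ζ, rfl⟩ : ∃ ζ : Eu n, ξ = (2 : ℝ) • ζ := ⟨(1 / 2 : ℝ) • ξ, by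
        rw [smul_smul]; norm_num⟩
      have hζ : ζ ln = 0 := by simpa using hξ
      rw [norm_smul, Real.norm_of_nonneg (by norm_num), pow_succ] at hz
      have hz' : 32 * ‖ζ‖ < 2 ^ j * z ln := by linarith
      have i1 := ih ζ z hζ hz'
      have i2 := ih ζ (z + ζ) hζ (by simpa [hζ] using hz')
      have i3 := ih ζ (z - ζ) hζ (by simpa [hζ] using hz')
      rw [Mx_smul]
      simp only [sd] at *
      have a1 : z + ζ + ζ = z + (2 : ℝ) • ζ := by module
      have a2 : z - ζ - ζ = z - (2 : ℝ) • ζ := by module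
      rw [a1, add_sub_cancel_right] at i2
      rw [a2, sub_add_cancel] at i3
      linarith
  obtain ⟨j, hj⟩ := pow_unbounded_of_one_lt (32 * ‖ξ‖ / z ln) (by norm_num : (1 : ℝ) < 2)
  exact step j ξ z hξ (by rwa [div_lt_iff₀ hz] at hj)

/-- A quantity that doubles with its argument and vanishes to second order vanishes. -/
lemma eq_zero_of_doubling {f : Eu n → ℝ} {C : ℝ} (hd : ∀ ξ : Eu n, ξ ln = 0 →
    f ((2 : ℝ) • ξ) = 2 * f ξ) (hC : ∀ ξ : Eu n, ξ ln = 0 → |f ξ| ≤ C * ‖ξ‖ ^ 2) {ξ : Eu n}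
    (hξ : ξ ln = 0) : f ξ = 0 := by
  have key : ∀ j : ℕ, f ξ = 2 ^ j * f ((1 / 2 : ℝ) ^ j • ξ) := by
    intro j
    induction j with
    | zero => simp
    | succ j ih =>
      have e : (1 / 2 : ℝ) ^ j • ξ = (2 : ℝ) • (1 / 2 : ℝ) ^ (j + 1) • ξ := by
        rw [smul_smul, pow_succ]; congr 1; ring
      rw [ih, e, hd _ (by simp [hξ]), pow_succ]
      ring
  have hb : ∀ j : ℕ, |f ξ| ≤ C * ‖ξ‖ ^ 2 * (1 / 2) ^ j := fun j => by
    rw [key j, abs_mul, abs_of_nonneg (by positivity)]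
    have := hC ((1 / 2 : ℝ) ^ j • ξ) (by simp [hξ])
    rw [norm_smul, Real.norm_of_nonneg (by positivity), mul_pow] at this
    calc _ ≤ 2 ^ j * (C * (((1 / 2) ^ j) ^ 2 * ‖ξ‖ ^ 2)) := by gcongr
      _ = C * ‖ξ‖ ^ 2 * (1 / 2) ^ j * (2 ^ j * (1 / 2) ^ j) := by ring
      _ = _ := by rw [← mul_pow]; norm_num
  have hlim : Tendsto (fun j : ℕ => C * ‖ξ‖ ^ 2 * (1 / 2 : ℝ) ^ j) atTop (𝓝 0) := by
    simpa using (tendsto_pow_atTop_nhds_zero_of_lt_one (by norm_num : (0 : ℝ) ≤ 1 / 2)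
      (by norm_num)).const_mul (C * ‖ξ‖ ^ 2)
  exact abs_nonpos_iff.1 (ge_of_tendsto' hlim hb)

lemma BlowLim.val_add (H : BlowLim ln ψ Dψ 𝒰 Ψ G) (h : Sol b Λ L ln ψ Dψ) (hb : -1 < b)
    {ξ z : Eu n} (hξ : ξ ln = 0) (hz : 0 < z ln) :
    Ψ (z + ξ) = Ψ z + G z ξ + Mx b ψ ln ξ / 2 := by
  have h0 : ∀ ξ : Eu n, ξ ln = 0 → 0 ≤ (z + ξ) ln := fun ξ hξ => by simpa [hξ] using hz.le
  have := eq_zero_of_doubling (ln := ln) (C := L + Λ / 2)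
    (f := fun ξ => Ψ (z + ξ) - Ψ z - G z ξ - Mx b ψ ln ξ / 2) (fun ξ hξ => ?_) (fun ξ hξ => ?_) hξ
  · linarith
  · have h1 := H.sd_eq h hb (z := z + ξ) hξ (by simpa [hξ] using hz)
    rw [sd, add_sub_cancel_right, show z + ξ + ξ = z + (2 : ℝ) • ξ by module] at h1
    simp only [Mx_smul, map_smul, smul_eq_mul]
    linarith
  · have h1 := H.taylor h hz.le (h0 ξ hξ)
    rw [add_sub_cancel_left] at h1
    have h2 := h.Mx_le ξ
    have h3 := h.Mx_nonneg ξ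
    rw [abs_le] at *
    constructor <;> linarith

lemma upper_add_single (ln : Fin n) {z : Eu n} (hz : 0 ≤ z ln) {t : ℝ} (ht : 0 < t) :
    0 < (z + t • EuclideanSpace.single ln (1 : ℝ)) ln := by
  simp only [PiLp.add_apply, PiLp.smul_apply, PiLp.single_apply, if_true, smul_eq_mul]
  linarith

lemma tendsto_add_single (ln : Fin n) {z : Eu n} (hz : 0 ≤ z ln) :
    Tendsto (fun t : ℝ => z + t • EuclideanSpace.single ln (1 : ℝ)) (𝓝[>] 0)
      (𝓝[{x | 0 ≤ x ln}] z) := by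
  refine tendsto_nhdsWithin_iff.2 ⟨?_, ?_⟩
  · have : Continuous fun t : ℝ => z + t • (EuclideanSpace.single ln (1 : ℝ) : Eu n) := by fun_prop
    simpa using (this.tendsto 0).mono_left nhdsWithin_le_nhds
  · filter_upwards [self_mem_nhdsWithin] with t ht
    exact (upper_add_single ln hz ht).le

lemma BlowLim.val_add' (H : BlowLim ln ψ Dψ 𝒰 Ψ G) (h : Sol b Λ L ln ψ Dψ) (hb : -1 < b)
    {ξ z : Eu n} (hξ : ξ ln = 0) (hz : 0 ≤ z ln) :
    Ψ (z + ξ) = Ψ z + G z ξ + Mx b ψ ln ξ / 2 := by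
  have hzξ : 0 ≤ (z + ξ) ln := by simpa [hξ] using hz
  have t1 := (H.continuousOn h z hz).tendsto.comp (tendsto_add_single ln hz)
  have t2 := (H.continuousOn h _ hzξ).tendsto.comp (tendsto_add_single ln hzξ)
  have t3 : Tendsto (fun t : ℝ => G (z + t • EuclideanSpace.single ln 1) ξ) (𝓝[>] 0)
      (𝓝 (G z ξ)) :=
    ((ContinuousLinearMap.apply ℝ ℝ ξ).continuous.tendsto _).comp
      ((H.continuousOn_grad h z hz).tendsto.comp (tendsto_add_single ln hz))
  refine tendsto_nhds_unique t2 (((t1.add t3).add_const _).congr' ?_)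
  filter_upwards [self_mem_nhdsWithin] with t ht
  simp only [Function.comp]
  rw [add_right_comm z ξ, H.val_add h hb hξ (upper_add_single ln hz ht)]

/-- The normal derivative of the limit only depends on the height. -/
lemma BlowLim.normal_add (H : BlowLim ln ψ Dψ 𝒰 Ψ G) (h : Sol b Λ L ln ψ Dψ) (hb : -1 < b)
    {ξ z : Eu n} (hξ : ξ ln = 0) (hz : 0 < z ln) :
    G (z + ξ) (EuclideanSpace.single ln 1) = G z (EuclideanSpace.single ln 1) := by
  set e : Eu n := EuclideanSpace.single ln 1
  have hmid : ∀ ξ z : Eu n, ξ ln = 0 → 0 < z ln → G (z + ξ) e + G (z - ξ) e = 2 * G z e := by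
    intro ξ z hξ hz
    have h1 := (H.hasFDerivAt h (x := z + ξ) (by simpa [hξ] using hz)).comp z
      ((hasFDerivAt_id z).add_const ξ)
    have h2 := (H.hasFDerivAt h (x := z - ξ) (by simpa [hξ] using hz)).comp z
      ((hasFDerivAt_id z).sub_const ξ)
    have h3 := (H.hasFDerivAt h hz).const_mul 2
    have h4 : HasFDerivAt (sd Ψ ξ) _ z := (h1.add h2).sub h3
    have h5 : HasFDerivAt (sd Ψ ξ) (0 : Eu n →L[ℝ] ℝ) z :=
      (hasFDerivAt_const (Mx b ψ ln ξ) z).congr_of_eventuallyEq (by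
        filter_upwards [(isOpen_upper ln).mem_nhds hz] with y hy
        exact H.sd_eq h hb hξ hy)
    have := congrArg (fun g : Eu n →L[ℝ] ℝ => g e) (h4.unique h5)
    simp at this
    linarith
  have hbd : ∀ z : Eu n, 0 < z ln → |G z e| ≤ L * z ln := by
    intro z hz
    have h0 : (z - z ln • e) ln = 0 := by simp [e]
    have h1 := H.bdry h h0
    have h2 := H.lip h hz.le h0.ge
    rw [sub_sub_cancel, norm_smul, norm_single_one, mul_one, Real.norm_of_nonneg hz.le] at h2
    have h3 := (G z - G (z - z ln • e)).le_opNorm e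
    rw [norm_single_one, mul_one, _root_.sub_apply, h1, sub_zero,
      Real.norm_eq_abs] at h3
    exact h3.trans h2
  have hpow : ∀ j : ℕ, G (z + (2 : ℝ) ^ j • ξ) e - G z e = 2 ^ j * (G (z + ξ) e - G z e) := by
    intro j
    induction j with
    | zero => simp
    | succ j ih =>
      have := hmid ((2 : ℝ) ^ j • ξ) (z + (2 : ℝ) ^ j • ξ) (by simp [hξ]) (by simpa [hξ] using hz)
      rw [add_sub_cancel_right, show z + (2 : ℝ) ^ j • ξ + (2 : ℝ) ^ j • ξ =
        z + (2 : ℝ) ^ (j + 1) • ξ by rw [pow_succ]; module] at this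
      have e2 : (2 : ℝ) ^ (j + 1) * (G (z + ξ) e - G z e) =
          2 * (2 ^ j * (G (z + ξ) e - G z e)) := by ring
      rw [e2, ← ih]
      linarith
  by_contra hne
  have hpos : 0 < |G (z + ξ) e - G z e| := abs_pos.2 (sub_ne_zero.2 hne)
  obtain ⟨j, hj⟩ := pow_unbounded_of_one_lt (2 * (L * z ln) / |G (z + ξ) e - G z e|)
    (by norm_num : (1 : ℝ) < 2)
  rw [div_lt_iff₀ hpos] at hj
  have h1 := hbd z hz
  have h2 := hbd (z + (2 : ℝ) ^ j • ξ) (by simpa [hξ] using hz)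
  have h3 : |2 ^ j * (G (z + ξ) e - G z e)| = 2 ^ j * |G (z + ξ) e - G z e| := by
    rw [abs_mul, abs_of_nonneg (by positivity)]
  rw [← hpow j] at h3
  have h4 := abs_sub (G (z + (2 : ℝ) ^ j • ξ) e) (G z e)
  simp only [PiLp.add_apply, PiLp.smul_apply, hξ, smul_zero, add_zero] at h2
  linarith

end BlowDown

/-- `P` represents the maximal second derivatives in the tangential directions. -/
structure TanForm {n : ℕ} (b : ℝ) (ψ : Eu n → ℝ) (ln : Fin n) (P : Mt n) : Prop where
  symm : P.transpose = P
  row : ∀ j, P ln j = 0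
  eq : ∀ ξ : Eu n, ξ ln = 0 → qf P ξ = Mx b ψ ln ξ

section Matrices

variable {n : ℕ} {ln : Fin n} {S : Mt n}

lemma row_mul_En (hS : S.transpose = S) (h0 : ∀ j, S ln j = 0) : S * En ln = 0 := by
  ext i j
  have : S i ln = 0 := by rw [← hS, transpose_apply, h0]
  by_cases hj : j = ln
  · subst hj; simp [En, this]
  · simp [En, hj]

lemma En_mul_self (ln : Fin n) : En ln * En ln = En ln := by simp [En]

lemma En_transpose (ln : Fin n) : (En ln).transpose = En ln := by simp [En]

lemma En_mul_row (h0 : ∀ j, S ln j = 0) : En ln * S = 0 := by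
  ext i j
  by_cases hi : i = ln
  · subst hi; simp [En, h0]
  · simp [En, hi]

lemma qf_conj (C X : Mt n) (ξ : Eu n) :
    qf (C * X * C.transpose) ξ = qf X (WithLp.toLp 2 (C.transpose *ᵥ ξ.ofLp)) := by
  simp only [qf, ← Matrix.mulVec_mulVec]
  rw [Matrix.dotProduct_mulVec, ← Matrix.mulVec_transpose]

lemma Tn_mulVec (ln : Fin n) (ξ : Eu n) :
    WithLp.toLp 2 (Tn ln *ᵥ ξ.ofLp) = ξ - ξ ln • EuclideanSpace.single ln (1 : ℝ) := by
  ext i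
  by_cases hi : i = ln
  · subst hi; simp [Tn, En, sub_mulVec, Matrix.single_mulVec]
  · simp [Tn, En, sub_mulVec, Matrix.single_mulVec, hi]

lemma qf_sub_single (hS : S.transpose = S) (h0 : ∀ j, S ln j = 0) (ξ : Eu n) :
    qf S (ξ - ξ ln • EuclideanSpace.single ln (1 : ℝ)) = qf S ξ := by
  rw [← Tn_mulVec]
  conv_lhs => rw [← Tn_transpose]
  rw [← qf_conj, Tn_transpose, Tn, Matrix.sub_mul, Matrix.one_mul, En_mul_row h0, sub_zero,
    Matrix.mul_sub, Matrix.mul_one, row_mul_En hS h0, sub_zero]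

lemma det_add_smul_En (h0 : ∀ j, S ln j = 0) (N : ℝ) :
    (S + N • En ln).det = N * (S + En ln).det := by
  have : S + N • En ln = updateRow (S + En ln) ln (N • (S + En ln) ln) := by
    ext i j
    by_cases hi : i = ln
    · subst hi; simp [h0]
    · simp [hi, En, Ne.symm hi]
  rw [this, det_updateRow_smul, updateRow_eq_self]

end Matrices

section Tangential

variable {n : ℕ} {b Λ L : ℝ} {ln : Fin n} {ψ : Eu n → ℝ} {Dψ : Eu n → (Eu n →L[ℝ] ℝ)} {P : Mt n}

lemma TanForm.ell (T : TanForm b ψ ln P) (h : Sol b Λ L ln ψ Dψ) {N : ℝ} :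
    Ell (min Λ⁻¹ N) (max Λ N) (P + N • En ln) := by
  have hqf : ∀ ξ : Eu n, qf P ξ = Mx b ψ ln (ξ - ξ ln • EuclideanSpace.single ln (1 : ℝ)) ∧
      ‖ξ - ξ ln • EuclideanSpace.single ln (1 : ℝ)‖ ^ 2 = qf (Tn ln) ξ := fun ξ => by
    have h0 : (ξ - ξ ln • EuclideanSpace.single ln (1 : ℝ)) ln = 0 := by simp
    refine ⟨by rw [← T.eq _ h0, qf_sub_single T.symm T.row], ?_⟩
    rw [← qf_sub_single (Tn_transpose ln) (Tn_row ln) ξ, qf_Tn, h0]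
    ring
  have e : ∀ c d : ℝ, P + N • En ln - c • (1 : Mt n) =
      (P - d • Tn ln) + ((d - c) • Tn ln + (N - c) • En ln) := fun c d => by
    simp only [Tn]; module
  have psdT : (Tn ln).PosSemidef := psd_iff_qf.2 ⟨Tn_transpose ln, qf_Tn_nonneg ln⟩
  constructor
  · rw [e _ Λ⁻¹]
    refine Matrix.PosSemidef.add (psd_iff_qf.2 ⟨?_, fun ξ => ?_⟩)
      (Matrix.PosSemidef.add (psdT.smul (sub_nonneg.2 (min_le_left _ _)))
        ((psd_En ln).smul (sub_nonneg.2 (min_le_right _ _))))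
    · rw [transpose_sub, transpose_smul, T.symm, Tn_transpose]
    · rw [qf_sub, qf_smul, (hqf ξ).1, ← (hqf ξ).2]
      exact sub_nonneg.2 (h.le_Mx _)
  · rw [← neg_sub, e _ Λ, neg_add, neg_add, neg_sub, ← neg_smul, ← neg_smul, neg_sub, neg_sub]
    refine Matrix.PosSemidef.add (psd_iff_qf.2 ⟨?_, fun ξ => ?_⟩)
      (Matrix.PosSemidef.add (psdT.smul (sub_nonneg.2 (le_max_left _ _)))
        ((psd_En ln).smul (sub_nonneg.2 (le_max_right _ _))))
    · rw [transpose_sub, transpose_smul, T.symm, Tn_transpose]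
    · rw [qf_sub, qf_smul, (hqf ξ).1, ← (hqf ξ).2]
      exact sub_nonneg.2 (h.Mx_le _)

lemma TanForm.posDef (T : TanForm b ψ ln P) (h : Sol b Λ L ln ψ Dψ) {N : ℝ} (hN : 0 < N) :
    (P + N • En ln).PosDef :=
  (T.ell h).posDef (lt_min (inv_pos.2 h.pos) hN)

/-- The normal entry for which the block matrix with tangential part `P` has determinant one. -/
def nrm {n : ℕ} (ln : Fin n) (P : Mt n) : ℝ := (P + En ln).det⁻¹

lemma TanForm.nrm_pos (T : TanForm b ψ ln P) (h : Sol b Λ L ln ψ Dψ) : 0 < nrm ln P := by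
  have := T.posDef h one_pos
  rw [one_smul] at this
  exact inv_pos.2 this.det_pos

lemma TanForm.det_eq (T : TanForm b ψ ln P) (N : ℝ) :
    (P + N • En ln).det = N / nrm ln P := by
  rw [det_add_smul_En T.row, nrm, div_inv_eq_mul]

lemma TanForm.psd_sub (T : TanForm b ψ ln P) (h : Sol b Λ L ln ψ Dψ) {x : Eu n} (hx : 0 < x ln) :
    (P - Tn ln * Mb b ψ ln x * Tn ln).PosSemidef := by
  have hM := (h.ell x hx).psd (inv_pos.2 h.pos).le
  refine psd_iff_qf.2 ⟨?_, fun ξ => ?_⟩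
  · rw [transpose_sub, T.symm, transpose_mul, transpose_mul, Tn_transpose,
      (psd_iff_qf.1 hM).1, Matrix.mul_assoc]
  · have e : qf (Tn ln * Mb b ψ ln x * Tn ln) ξ =
        qf (Mb b ψ ln x) (ξ - ξ ln • EuclideanSpace.single ln (1 : ℝ)) := by
      rw [← Tn_mulVec]
      have := qf_conj (Tn ln) (Mb b ψ ln x) ξ
      rwa [Tn_transpose] at this
    rw [qf_sub, e, ← qf_sub_single T.symm T.row, T.eq _ (by simp)]
    exact sub_nonneg.2 (h.qf_le hx _)

/-- The tangential defect is controlled by the normal entry. -/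
lemma TanForm.trace_defect (T : TanForm b ψ ln P) (h : Sol b Λ L ln ψ Dψ) {x : Eu n}
    (hx : 0 < x ln) :
    ((P + nrm ln P • En ln)⁻¹ * (P - Tn ln * Mb b ψ ln x * Tn ln)).trace ≤
      Mb b ψ ln x ln ln / nrm ln P - 1 := by
  set N := nrm ln P with hNdef
  have hN : 0 < N := T.nrm_pos h
  set Q := P + N • En ln with hQ
  set M := Mb b ψ ln x
  have hQp : Q.PosDef := T.posDef h hN
  have hQu : IsUnit Q.det := hQp.det_pos.ne'.isUnit
  have hQd : Q.det = 1 := by rw [hQ, T.det_eq, div_self hN.ne']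
  set a := Q⁻¹ with ha
  have haQ : a * Q = 1 := nonsing_inv_mul Q hQu
  have hQa : Q * a = 1 := mul_nonsing_inv Q hQu
  have hQE : Q * En ln = N • En ln := by
    rw [hQ, Matrix.add_mul, row_mul_En T.symm T.row, Matrix.smul_mul, En_mul_self, zero_add]
  have hEQ : En ln * Q = N • En ln := by
    rw [hQ, Matrix.mul_add, En_mul_row T.row, Matrix.mul_smul, En_mul_self, zero_add]
  have haE : a * En ln = N⁻¹ • En ln := by
    have : a * (Q * En ln) = N • (a * En ln) := by rw [hQE, Matrix.mul_smul]
    rw [← Matrix.mul_assoc, haQ, Matrix.one_mul] at this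
    rw [eq_inv_smul_iff₀ hN.ne']
    exact this.symm
  have hEa : En ln * a = N⁻¹ • En ln := by
    have : (En ln * Q) * a = N • (En ln * a) := by rw [hEQ, Matrix.smul_mul]
    rw [Matrix.mul_assoc, hQa, Matrix.mul_one] at this
    rw [eq_inv_smul_iff₀ hN.ne']
    exact this.symm
  have hTaT : Tn ln * a * Tn ln = a - N⁻¹ • En ln := by
    rw [Tn, Matrix.sub_mul, Matrix.one_mul, hEa, Matrix.mul_sub, Matrix.mul_one, Matrix.sub_mul, haE,
      Matrix.smul_mul, En_mul_self, sub_self, sub_zero]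
  have hM := (h.ell x hx).psd (inv_pos.2 h.pos).le
  have hge := trace_mul_ge ln.pos hQp.inv.posSemidef hM (by
    rw [h.det x hx, mul_one, det_nonsing_inv, hQd]; simp)
  have t1 : (a * P).trace = n - 1 := by
    have : P = Q - N • En ln := by rw [hQ]; abel
    rw [this, Matrix.mul_sub, haQ, Matrix.mul_smul, haE, smul_smul, mul_inv_cancel₀ hN.ne', one_smul]
    simp [En]
  have t2 : (a * (Tn ln * M * Tn ln)).trace = (a * M).trace - M ln ln / N := by
    have : (a * (Tn ln * M * Tn ln)).trace = (Tn ln * a * Tn ln * M).trace := by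
      rw [← Matrix.mul_assoc, Matrix.trace_mul_comm]
      simp only [Matrix.mul_assoc]
    rw [this, hTaT, Matrix.sub_mul, trace_sub, Matrix.smul_mul, trace_smul, Matrix.trace_mul_comm,
      Matrix.trace_mul_comm (En ln), trace_mul_En, smul_eq_mul, Matrix.trace_mul_comm M a]
    ring
  rw [Matrix.mul_sub, trace_sub, t1, t2]
  linarith

lemma TanForm.normal_ge (T : TanForm b ψ ln P) (h : Sol b Λ L ln ψ Dψ) {x : Eu n}
    (hx : 0 < x ln) : nrm ln P ≤ Mb b ψ ln x ln ln := by
  have h1 := T.trace_defect h hx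
  have h2 := trace_mul_nonneg (T.posDef h (T.nrm_pos h)).inv.posSemidef (T.psd_sub h hx)
  have h3 := h2.trans h1
  rwa [sub_nonneg, one_le_div (T.nrm_pos h)] at h3

/-- A differential inequality with a singular drift. -/
lemma ode_lower {p p' : ℝ → ℝ} {b N C : ℝ} (hb : -1 < b) (hd : ∀ t, 0 < t → HasDerivAt p (p' t) t)
    (hN : ∀ t, 0 < t → N ≤ p' t + b * p t / t) (hC : ∀ t, 0 < t → |p t| ≤ C * t) {t : ℝ}
    (ht : 0 < t) : N / (1 + b) * t ≤ p t := by
  have hb1 : 0 < 1 + b := by linarith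
  set F : ℝ → ℝ := fun t => t ^ b * p t - N / (1 + b) * t ^ (1 + b) with hF
  have hFd : ∀ t, 0 < t → HasDerivAt F (t ^ b * (p' t + b * p t / t - N)) t := fun t ht => by
    have h1 := (Real.hasDerivAt_rpow_const (p := b) (Or.inl ht.ne')).mul (hd t ht)
    have h2 := (Real.hasDerivAt_rpow_const (p := 1 + b) (Or.inl ht.ne')).const_mul (N / (1 + b))
    refine (h1.sub h2).congr_deriv ?_
    rw [Real.rpow_sub_one ht.ne', add_sub_cancel_left]
    field_simp
    ring
  have hmono : MonotoneOn F (Set.Ioi 0) := by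
    refine monotoneOn_of_deriv_nonneg (convex_Ioi 0)
      (fun s hs => (hFd s hs).continuousAt.continuousWithinAt) ?_ ?_
    · rw [interior_Ioi]
      exact fun s hs => (hFd s hs).differentiableAt.differentiableWithinAt
    · rw [interior_Ioi]
      intro s hs
      rw [(hFd s hs).deriv]
      exact mul_nonneg (Real.rpow_nonneg (le_of_lt hs) _) (sub_nonneg.2 (hN s hs))
  have hpow : ∀ s : ℝ, 0 < s → s ^ (1 + b) = s ^ b * s := fun s hs => by
    rw [add_comm, Real.rpow_add_one hs.ne']
  have hlow : ∀ s, 0 < s → -((C + N / (1 + b)) * s ^ (1 + b)) ≤ F s := fun s hs => by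
    have h1 := (abs_le.1 (hC s hs)).1
    have h2 := Real.rpow_nonneg hs.le b
    rw [hF]
    simp only
    rw [hpow s hs]
    nlinarith
  have hlim : Tendsto (fun s : ℝ => -((C + N / (1 + b)) * s ^ (1 + b))) (𝓝[>] 0) (𝓝 0) := by
    have : ContinuousAt (fun s : ℝ => -((C + N / (1 + b)) * s ^ (1 + b))) 0 :=
      (continuousAt_const.mul (Real.continuousAt_rpow_const _ _ (Or.inr hb1.le))).neg
    have := this.tendsto.mono_left (nhdsWithin_le_nhds (s := Set.Ioi 0))
    simpa [Real.zero_rpow hb1.ne'] using this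
  have hFt : 0 ≤ F t := by
    refine le_of_tendsto hlim ?_
    filter_upwards [Ioo_mem_nhdsGT ht] with s hs
    exact (hlow s hs.1).trans (hmono hs.1 ht hs.2.le)
  have hp := Real.rpow_pos_of_pos ht b
  have : 0 ≤ t ^ b * (p t - N / (1 + b) * t) := by
    have := hFt
    rw [hF] at this
    simp only at this
    rw [hpow t ht] at this
    linarith
  linarith [nonneg_of_mul_nonneg_right this hp]

lemma TanForm.normal_deriv_ge (T : TanForm b ψ ln P) (h : Sol b Λ L ln ψ Dψ) (hb : -1 < b)
    {x : Eu n} (hx : 0 < x ln) :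
    nrm ln P / (1 + b) * x ln ≤ Dψ x (EuclideanSpace.single ln 1) := by
  set e : Eu n := EuclideanSpace.single ln 1 with he
  set y : Eu n := x - x ln • e with hy
  have hln : ∀ t : ℝ, (y + t • e) ln = t := fun t => by simp [hy, he]
  have key := ode_lower (p := fun t => Dψ (y + t • e) e) (p' := fun t => pd2 ψ ln ln (y + t • e))
    (N := nrm ln P) (C := L) hb (fun t ht => ?_) (fun t ht => ?_) (fun t ht => ?_) hx
  · have : y + x ln • e = x := by rw [hy]; abel
    rwa [this] at key
  · have h0 : 0 < (y + t • e) ln := by rwa [hln]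
    have h1 := (h.smooth _ h0)
    have h2 : HasFDerivAt (pd ψ ln) _ (y + t • e) := hasFDerivAt_pd h1 ln
    have h3 : HasDerivAt (fun s : ℝ => y + s • e) e t := by
      simpa using ((hasDerivAt_id t).smul_const e).const_add y
    have h4 := h2.comp_hasDerivAt t h3
    refine (h4.congr_deriv ?_).congr_of_eventuallyEq ?_
    · rw [← h2.fderiv]; rfl
    · filter_upwards [lt_mem_nhds ht] with s hs
      exact (h.pd_eq (by rwa [hln]) ln).symm
  · have h0 : 0 < (y + t • e) ln := by rwa [hln]
    have h1 := T.normal_ge h h0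
    rw [Mb_eq] at h1
    simpa [Matrix.add_apply, Matrix.smul_apply, hs, En, hln, h.pd_eq h0, ← he] using h1
  · have := h.abs_normal_le (x := y + t • e) (by rw [hln]; exact ht.le)
    rwa [hln] at this

end Tangential

/-- Minimizers of a continuously convergent sequence accumulate at minimizers of the limit. -/
lemma exists_tendsto_minimizers {X : Type*} [TopologicalSpace X] {K : Set X} (hK : IsCompact K)
    (hne : K.Nonempty) (𝒰 : Ultrafilter ℕ) {u : ℕ → X → ℝ} {U : X → ℝ}
    (hu : ∀ k, ContinuousOn (u k) K)
    (hconv : ∀ (y : X) (ys : ℕ → X), y ∈ K → (∀ k, ys k ∈ K) → Tendsto ys 𝒰 (𝓝 y) →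
      Tendsto (fun k => u k (ys k)) 𝒰 (𝓝 (U y))) :
    ∃ (x : X) (xs : ℕ → X), x ∈ K ∧ (∀ k, xs k ∈ K) ∧ (∀ k, IsMinOn (u k) K (xs k)) ∧
      Tendsto xs 𝒰 (𝓝 x) ∧ IsMinOn U K x := by
  choose xs hxs hmin using fun k => hK.exists_isMinOn hne (hu k)
  obtain ⟨x, hx, hlim⟩ := exists_tendsto_ultrafilter hK 𝒰 hxs
  refine ⟨x, xs, hx, hxs, hmin, hlim, fun y hy => ?_⟩
  exact le_of_tendsto_of_tendsto (hconv x xs hx hxs hlim)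
    (hconv y (fun _ => y) hy (fun _ => hy) tendsto_const_nhds)
    (Eventually.of_forall fun k => hmin k hy)

section BlowDownForm

variable {n : ℕ} {b Λ L : ℝ} {ln : Fin n} {ψ : Eu n → ℝ} {Dψ : Eu n → (Eu n →L[ℝ] ℝ)}
  {𝒰 : Ultrafilter ℕ} {Ψ : Eu n → ℝ} {G : Eu n → (Eu n →L[ℝ] ℝ)}

lemma BlowLim.val_tangential (H : BlowLim ln ψ Dψ 𝒰 Ψ G) (h : Sol b Λ L ln ψ Dψ) (hb : -1 < b)
    {ξ : Eu n} (hξ : ξ ln = 0) : Ψ ξ = Mx b ψ ln ξ / 2 := by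
  have := H.val_add' h hb hξ (z := 0) (by simp)
  rw [zero_add, H.val_zero, H.grad_zero] at this
  simpa using this

lemma BlowLim.grad_symm (H : BlowLim ln ψ Dψ 𝒰 Ψ G) (h : Sol b Λ L ln ψ Dψ) (hb : -1 < b)
    {ξ η : Eu n} (hξ : ξ ln = 0) (hη : η ln = 0) : G ξ η = G η ξ := by
  have h1 := H.val_add' h hb hξ hη.ge
  have h2 := H.val_add' h hb hη hξ.ge
  rw [add_comm, H.val_tangential h hb hξ] at h2
  rw [H.val_tangential h hb hη] at h1
  linarith

lemma BlowLim.grad_self (H : BlowLim ln ψ Dψ 𝒰 Ψ G) (h : Sol b Λ L ln ψ Dψ) (hb : -1 < b)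
    {ξ : Eu n} (hξ : ξ ln = 0) : G ξ ξ = Mx b ψ ln ξ := by
  have h1 := H.val_add' h hb hξ hξ.ge
  have h2 := H.val_tangential h hb (ξ := ξ + ξ) (by simp [hξ])
  rw [← two_smul ℝ, Mx_smul, two_smul] at h2
  rw [H.val_tangential h hb hξ] at h1
  linarith

lemma BlowLim.exists_tanForm (H : BlowLim ln ψ Dψ 𝒰 Ψ G) (h : Sol b Λ L ln ψ Dψ)
    (hb : -1 < b) : ∃ P, TanForm b ψ ln P := by
  refine ⟨Matrix.of fun i j => if i = ln ∨ j = ln then 0 else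
    G (EuclideanSpace.single i 1) (EuclideanSpace.single j 1), ?_, ?_, ?_⟩
  · ext i j
    simp only [transpose_apply, of_apply, or_comm]
    split_ifs with hij
    · rfl
    · rw [not_or] at hij
      exact H.grad_symm h hb (by simp [Ne.symm hij.2]) (by simp [Ne.symm hij.1])
  · intro j; simp
  · intro ξ hξ
    rw [← H.grad_self h hb hξ, fderiv_eq_sum (G ξ) ξ, qf_eq_sum]
    refine Finset.sum_congr rfl fun i _ => ?_
    by_cases hi : i = ln
    · subst hi; simp [hξ]
    · rw [H.grad_symm h hb hξ (η := EuclideanSpace.single i 1) (by simp [Ne.symm hi]),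
        fderiv_eq_sum (G (EuclideanSpace.single i 1)) ξ, Finset.mul_sum]
      refine Finset.sum_congr rfl fun j _ => ?_
      by_cases hj : j = ln
      · subst hj; simp [hξ]
      · simp only [of_apply, hi, hj, or_self, if_false]; ring

lemma BlowLim.val_split (H : BlowLim ln ψ Dψ 𝒰 Ψ G) (h : Sol b Λ L ln ψ Dψ) (hb : -1 < b)
    {ξ : Eu n} (hξ : ξ ln = 0) {t : ℝ} (ht : 0 ≤ t) :
    Ψ (ξ + t • EuclideanSpace.single ln 1) =
      Mx b ψ ln ξ / 2 + Ψ (t • EuclideanSpace.single ln 1) := by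
  set e : Eu n := EuclideanSpace.single ln 1 with he
  rcases ht.eq_or_lt with rfl | ht
  · simp [H.val_zero, H.val_tangential h hb hξ]
  have hd : ∀ z : Eu n, z ln = 0 → ∀ s : ℝ, 0 < s →
      HasDerivAt (fun s : ℝ => Ψ (z + s • e)) (G (z + s • e) e) s := fun z hz s hs => by
    have h3 : HasDerivAt (fun s : ℝ => z + s • e) e s := by
      simpa using ((hasDerivAt_id s).smul_const e).const_add z
    exact (H.hasFDerivAt h (upper_add_single ln hz.ge hs)).comp_hasDerivAt s h3
  have hc : ∀ z : Eu n, z ln = 0 → ContinuousOn (fun s : ℝ => Ψ (z + s • e)) (Set.Icc 0 t) :=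
    fun z hz => (H.continuousOn h).comp (by fun_prop) fun s hs => by
      simpa [he, hz] using hs.1
  obtain ⟨s, hs, hslope⟩ := exists_hasDerivAt_eq_slope
    (fun s : ℝ => Ψ (ξ + s • e) - Ψ (0 + s • e)) _ ht ((hc ξ hξ).sub (hc 0 (by simp)))
    (fun s hs => (hd ξ hξ s hs.1).sub (hd 0 (by simp) s hs.1))
  have hn := H.normal_add h hb hξ (upper_add_single ln (z := 0) (by simp) hs.1)
  rw [← he, zero_add] at hn
  rw [zero_add, add_comm ξ (s • e), hn, sub_self, eq_comm, div_eq_zero_iff] at hslope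
  rcases hslope with h0 | h0
  · simp only [zero_add, zero_smul, add_zero, H.val_zero, H.val_tangential h hb hξ] at h0
    linarith
  · linarith

lemma BlowLim.tendsto_val (H : BlowLim ln ψ Dψ 𝒰 Ψ G) (h : Sol b Λ L ln ψ Dψ) {y : Eu n}
    {ys : ℕ → Eu n} (hy : 0 ≤ y ln) (hys : ∀ k, 0 ≤ ys k ln) (hlim : Tendsto ys 𝒰 (𝓝 y)) :
    Tendsto (fun k => bd ψ k (ys k)) 𝒰 (𝓝 (Ψ y)) := by
  have h0 : Tendsto (fun k => ys k - y) 𝒰 (𝓝 0) := by simpa using hlim.sub_const y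
  have h1 : Tendsto (fun k => L * ‖ys k - y‖ ^ 2) 𝒰 (𝓝 0) := by
    simpa using (h0.norm.pow 2).const_mul L
  have h2 := squeeze_zero_norm (a := fun k => L * ‖ys k - y‖ ^ 2)
    (f := fun k => bd ψ k (ys k) - bd ψ k y - bdGrad Dψ k y (ys k - y))
    (fun k => (h.blowDown k).taylor hy (hys k)) h1
  have h3 : Tendsto (fun k => bdGrad Dψ k y (ys k - y)) 𝒰 (𝓝 (G y 0)) := by
    have : Continuous fun p : (Eu n →L[ℝ] ℝ) × Eu n => p.1 p.2 := by fun_prop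
    exact (this.tendsto (G y, 0)).comp ((H.grad y hy).prodMk_nhds h0)
  have := (h2.add h3).add (H.val y hy)
  simpa using this

end BlowDownForm

lemma exists_lt_of_deriv_neg {f : ℝ → ℝ} {d t s : ℝ} (hf : HasDerivAt f d t) (hd : d < 0)
    (hs : t < s) : ∃ r ∈ Set.Ioo t s, f r < f t := by
  have h1 := (hasDerivAt_iff_tendsto_slope.1 hf).mono_left
    (nhdsWithin_mono t (s := Set.Ioi t) fun r hr => ne_of_gt hr)
  obtain ⟨r, hr, hr'⟩ := ((h1.eventually (gt_mem_nhds hd)).and (Ioo_mem_nhdsGT hs)).exists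
  refine ⟨r, hr', ?_⟩
  rw [slope_def_field, div_lt_iff₀ (sub_pos.2 hr'.1)] at hr
  linarith

lemma exists_lt_of_deriv_pos {f : ℝ → ℝ} {d t s : ℝ} (hf : HasDerivAt f d t) (hd : 0 < d)
    (hs : s < t) : ∃ r ∈ Set.Ioo s t, f r < f t := by
  have h1 := (hasDerivAt_iff_tendsto_slope.1 hf).mono_left
    (nhdsWithin_mono t (s := Set.Iio t) fun r hr => ne_of_lt hr)
  obtain ⟨r, hr, hr'⟩ := ((h1.eventually (lt_mem_nhds hd)).and (Ioo_mem_nhdsLT hs)).exists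
  refine ⟨r, hr', ?_⟩
  rw [slope_def_field] at hr
  have h2 := (div_pos_iff.1 hr).resolve_left fun h => by linarith [h.2, hr'.2]
  linarith [h2.1]

lemma exists_antideriv_rpow (b : ℝ) :
    ∃ W : ℝ → ℝ, ∀ t, 0 < t → HasDerivAt W (t ^ (-b)) t := by
  by_cases hb : b = 1
  · subst hb
    refine ⟨Real.log, fun t ht => ?_⟩
    rw [Real.rpow_neg_one]
    exact Real.hasDerivAt_log ht.ne'
  · have hb' : 1 - b ≠ 0 := fun h => hb (by linarith)
    refine ⟨fun t => t ^ (1 - b) / (1 - b), fun t ht => ?_⟩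
    refine ((Real.hasDerivAt_rpow_const (p := 1 - b) (Or.inl ht.ne')).div_const _).congr_deriv ?_
    rw [show 1 - b - 1 = -b by ring]
    field_simp

/-- A one-dimensional test function touching from below a function violating the upper bound. -/
lemma exists_normal_test {g p : ℝ → ℝ} {b C N : ℝ} (hb : -1 < b)
    (hg : ∀ t, 0 < t → HasDerivAt g (p t) t) (hC : ∀ t, 0 < t → |p t| ≤ C * t) {t₂ : ℝ}
    (ht₂ : 0 < t₂) (hlt : N / (1 + b) * t₂ < p t₂) :
    ∃ (q q₁ q₂ : ℝ → ℝ) (N₁ t₁ t₀ : ℝ), N < N₁ ∧ 0 < t₁ ∧ t₁ < t₀ ∧ t₀ < t₂ ∧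
      (∀ t, 0 < t → Jet2 q t (q₁ t) (q₂ t) ∧ q₂ t + b * q₁ t / t = N₁) ∧
      (∀ t, t₁ ≤ t → t ≤ t₂ → g t₀ - q t₀ ≤ g t - q t) ∧
      g t₀ - q t₀ < g t₁ - q t₁ ∧ g t₀ - q t₀ < g t₂ - q t₂ := by
  have hb1 : 0 < 1 + b := by linarith
  obtain ⟨N₁, hN, hN₁⟩ : ∃ N₁, N < N₁ ∧ N₁ < p t₂ * (1 + b) / t₂ :=
    exists_between (by rw [lt_div_iff₀ ht₂]; rw [div_mul_eq_mul_div, div_lt_iff₀ hb1] at hlt; exact hlt)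
  have hpow : ∀ s : ℝ, 0 < s → s ^ (1 + b) = s ^ b * s := fun s hs => by
    rw [add_comm, Real.rpow_add_one hs.ne']
  set F : ℝ → ℝ := fun t => t ^ b * p t - N₁ / (1 + b) * t ^ (1 + b) with hF
  have hF₂ : 0 < F t₂ := by
    simp only [hF]
    rw [hpow t₂ ht₂]
    have h1 : N₁ / (1 + b) * t₂ < p t₂ := by
      rw [lt_div_iff₀ ht₂] at hN₁
      rwa [div_mul_eq_mul_div, div_lt_iff₀ hb1]
    have := mul_pos (Real.rpow_pos_of_pos ht₂ b) (sub_pos.2 h1)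
    linarith
  set k := F t₂ / 2 with hk
  have hup : ∀ s, 0 < s → F s ≤ (C - N₁ / (1 + b)) * s ^ (1 + b) := fun s hs => by
    have h1 := (abs_le.1 (hC s hs)).2
    have h2 := Real.rpow_nonneg hs.le b
    simp only [hF]
    rw [hpow s hs]
    nlinarith
  have hlim : Tendsto (fun s : ℝ => (C - N₁ / (1 + b)) * s ^ (1 + b)) (𝓝[>] 0) (𝓝 0) := by
    have : ContinuousAt (fun s : ℝ => (C - N₁ / (1 + b)) * s ^ (1 + b)) 0 :=
      continuousAt_const.mul (Real.continuousAt_rpow_const _ _ (Or.inr hb1.le))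
    have := this.tendsto.mono_left (nhdsWithin_le_nhds (s := Set.Ioi 0))
    simpa [Real.zero_rpow hb1.ne'] using this
  have hk0 : 0 < k := by rw [hk]; linarith
  obtain ⟨t₁, hlt1, ht₁⟩ := ((hlim.eventually (gt_mem_nhds hk0)).and (Ioo_mem_nhdsGT ht₂)).exists
  have hF₁ : F t₁ < k := (hup t₁ ht₁.1).trans_lt hlt1
  obtain ⟨W, hW⟩ := exists_antideriv_rpow b
  set q : ℝ → ℝ := fun t => k * W t + N₁ / (1 + b) * (t ^ 2 / 2) with hq
  set q₁ : ℝ → ℝ := fun t => k * t ^ (-b) + N₁ / (1 + b) * t with hq₁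
  set q₂ : ℝ → ℝ := fun t => k * (-b * t ^ (-b - 1)) + N₁ / (1 + b) with hq₂
  have hqd : ∀ t, 0 < t → HasDerivAt q (q₁ t) t := fun t ht => by
    have h1 := ((hasDerivAt_id t).pow 2).div_const 2
    refine (((hW t ht).const_mul k).add (h1.const_mul _)).congr_deriv ?_
    simp [hq₁]
  have hq₁d : ∀ t, 0 < t → HasDerivAt q₁ (q₂ t) t := fun t ht => by
    have h1 := Real.hasDerivAt_rpow_const (p := -b) (x := t) (Or.inl ht.ne')
    refine ((h1.const_mul k).add ((hasDerivAt_id t).const_mul (N₁ / (1 + b)))).congr_deriv ?_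
    simp [hq₂]
  have hder : ∀ t, 0 < t → HasDerivAt (fun t => g t - q t) (t ^ (-b) * (F t - k)) t :=
    fun t ht => by
      refine ((hg t ht).sub (hqd t ht)).congr_deriv ?_
      have : t ^ (-b) * t ^ b = 1 := by rw [← Real.rpow_add ht]; simp
      simp only [hF, hq₁]
      rw [hpow t ht]
      linear_combination (N₁ / (1 + b) * t - p t) * this
  obtain ⟨t₀, ht₀, hmin⟩ := isCompact_Icc.exists_isMinOn (Set.nonempty_Icc.2 ht₁.2.le)
    (f := fun t => g t - q t)
    (fun t ht => (hder t (ht₁.1.trans_le ht.1)).continuousAt.continuousWithinAt)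
  obtain ⟨r, hr, hr'⟩ := exists_lt_of_deriv_neg (hder t₁ ht₁.1)
    (mul_neg_of_pos_of_neg (Real.rpow_pos_of_pos ht₁.1 _) (sub_neg.2 hF₁)) ht₁.2
  obtain ⟨r', hr₂, hr₂'⟩ := exists_lt_of_deriv_pos (hder t₂ ht₂)
    (mul_pos (Real.rpow_pos_of_pos ht₂ _) (by rw [hk]; linarith)) ht₁.2
  have h1 : g t₀ - q t₀ < g t₁ - q t₁ :=
    lt_of_le_of_lt (hmin ⟨hr.1.le, hr.2.le⟩ : g t₀ - q t₀ ≤ g r - q r) hr'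
  have h2 : g t₀ - q t₀ < g t₂ - q t₂ :=
    lt_of_le_of_lt (hmin ⟨hr₂.1.le, hr₂.2.le⟩ : g t₀ - q t₀ ≤ g r' - q r') hr₂'
  refine ⟨q, q₁, q₂, N₁, t₁, t₀, hN, ht₁.1, lt_of_le_of_ne ht₀.1 ?_, lt_of_le_of_ne ht₀.2 ?_,
    fun t ht => ⟨⟨q₁, ?_, rfl, hq₁d t ht⟩, ?_⟩, fun t h1 h2 => hmin ⟨h1, h2⟩, h1, h2⟩
  · rintro rfl; exact lt_irrefl _ h1
  · rintro rfl; exact lt_irrefl _ h2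
  · filter_upwards [lt_mem_nhds ht] with s hs using hqd s hs
  · simp only [hq₁, hq₂]
    rw [Real.rpow_sub_one ht.ne']
    field_simp
    ring

section NormalBound

variable {n : ℕ} {b Λ L : ℝ} {ln : Fin n} {ψ : Eu n → ℝ} {Dψ : Eu n → (Eu n →L[ℝ] ℝ)} {P : Mt n}
  {𝒰 : Ultrafilter ℕ} {Ψ : Eu n → ℝ} {G : Eu n → (Eu n →L[ℝ] ℝ)}

lemma TanForm.bd (T : TanForm b ψ ln P) (h : Sol b Λ L ln ψ Dψ) (k : ℕ) :
    TanForm b (bd ψ k) ln P :=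
  ⟨T.symm, T.row, fun ξ hξ => by rw [Mx_bd h, T.eq ξ hξ]⟩

lemma TanForm.qf_ge (T : TanForm b ψ ln P) (h : Sol b Λ L ln ψ Dψ) (x : Eu n) :
    Λ⁻¹ * qf (Tn ln) x ≤ qf P x := by
  have h0 : (x - x ln • EuclideanSpace.single ln (1 : ℝ)) ln = 0 := by simp
  rw [← qf_sub_single T.symm T.row x, T.eq _ h0,
    ← qf_sub_single (Tn_transpose ln) (Tn_row ln) x, qf_Tn, h0]
  simpa using h.le_Mx (x - x ln • EuclideanSpace.single ln (1 : ℝ))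

lemma BlowLim.val_eq (H : BlowLim ln ψ Dψ 𝒰 Ψ G) (h : Sol b Λ L ln ψ Dψ) (hb : -1 < b)
    (T : TanForm b ψ ln P) {x : Eu n} (hx : 0 ≤ x ln) :
    Ψ x = qf P x / 2 + Ψ (x ln • EuclideanSpace.single ln 1) := by
  have h0 : (x - x ln • EuclideanSpace.single ln (1 : ℝ)) ln = 0 := by simp
  have := H.val_split h hb h0 hx
  rwa [sub_add_cancel, ← T.eq _ h0, qf_sub_single T.symm T.row] at this

/-- Upper bound for the normal derivative of the blow-down. -/
lemma BlowLim.normal_le (H : BlowLim ln ψ Dψ 𝒰 Ψ G) (h : Sol b Λ L ln ψ Dψ) (hb : -1 < b)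
    (T : TanForm b ψ ln P) {t : ℝ} (ht : 0 < t) :
    G (t • EuclideanSpace.single ln 1) (EuclideanSpace.single ln 1) ≤ nrm ln P / (1 + b) * t := by
  set e : Eu n := EuclideanSpace.single ln 1 with he
  have hln : ∀ t : ℝ, (t • e) ln = t := fun t => by simp [he]
  by_contra! hlt
  obtain ⟨q, q₁, q₂, N₁, t₁, t₀, hN, ht₁, ht₁₀, ht₀₂, hq, hmin, hm1, hm2⟩ :=
    exists_normal_test (g := fun t => Ψ (t • e)) (p := fun t => G (t • e) e) (C := L) hb
      (fun s hs => (H.hasFDerivAt h (x := s • e) (by rwa [hln])).comp_hasDerivAt s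
        (by simpa using (hasDerivAt_id s).smul_const e))
      (fun s hs => by
        have h1 : Tendsto (fun k => bdGrad Dψ k (s • e) e) 𝒰 (𝓝 (G (s • e) e)) :=
          ((ContinuousLinearMap.apply ℝ ℝ e).continuous.tendsto _).comp
            (H.grad (s • e) (by rw [hln]; exact hs.le))
        refine le_of_tendsto h1.abs (Eventually.of_forall fun k => ?_)
        have := (h.blowDown k).abs_normal_le (x := s • e) (by rw [hln]; exact hs.le)
        rwa [hln] at this) ht hlt
  have hN0 := T.nrm_pos h
  have hN1 : 0 < N₁ := hN0.trans hN
  obtain ⟨r, hr0, hr1, hr⟩ : ∃ r : ℝ, 0 < r ∧ r < 1 ∧ 1 < r ^ n * (N₁ / nrm ln P) := by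
    have hc : ContinuousAt (fun r : ℝ => r ^ n * (N₁ / nrm ln P)) 1 := by fun_prop
    have h1 : 1 < (fun r : ℝ => r ^ n * (N₁ / nrm ln P)) 1 := by
      simpa using (one_lt_div hN0).2 hN
    obtain ⟨r, hr, hr'⟩ := (((hc.tendsto.mono_left nhdsWithin_le_nhds).eventually
      (lt_mem_nhds h1)).and (Ioo_mem_nhdsLT (zero_lt_one (α := ℝ)))).exists
    exact ⟨r, hr'.1, hr'.2, hr⟩
  set K := {x : Eu n | qf (Tn ln) x ≤ 1 ∧ t₁ ≤ x ln ∧ x ln ≤ t} with hK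
  have hKup : ∀ x ∈ K, 0 < x ln := fun x hx => ht₁.trans_le hx.2.1
  have hqc : ∀ x : Eu n, 0 < x ln → ContinuousAt (fun x : Eu n => q (x ln)) x := fun x hx =>
    ContinuousAt.comp (f := fun x : Eu n => x ln) (hq _ hx).1.hasDerivAt.continuousAt (by fun_prop)
  have htest : ∀ x ∈ K, ContinuousAt (fun x : Eu n => r * (qf P x / 2) + q (x ln)) x := fun x hx =>
    (continuousAt_const.mul ((continuous_qf P).continuousAt.div_const 2)).add (hqc x (hKup x hx))
  have hzT : qf (Tn ln) (t₀ • e) = 0 := by rw [qf_Tn, hln, norm_smul, he]; simp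
  have hzK : t₀ • e ∈ K := ⟨by rw [hzT]; exact zero_le_one, by rw [hln]; exact ht₁₀.le,
    by rw [hln]; exact ht₀₂.le⟩
  obtain ⟨x, xs, hx, hxs, hxmin, hlim, hUmin⟩ := exists_tendsto_minimizers
    (isCompact_cylinder ln 1 t₁ t) ⟨_, hzK⟩ 𝒰
    (u := fun k x => _root_.bd ψ k x - (r * (qf P x / 2) + q (x ln)))
    (U := fun x => Ψ x - (r * (qf P x / 2) + q (x ln)))
    (fun k x hx => (((h.blowDown k).hasFDerivAt (hKup x hx)).continuousAt.sub
      (htest x hx)).continuousWithinAt)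
    (fun y ys hy hys hl => (H.tendsto_val h (hKup y hy).le (fun k => (hKup _ (hys k)).le) hl).sub
      ((htest y hy).tendsto.comp hl))
  have hle : (1 - r) / 2 * qf P x + (Ψ (x ln • e) - q (x ln)) ≤ Ψ (t₀ • e) - q t₀ := by
    have h1 : Ψ x - (r * (qf P x / 2) + q (x ln)) ≤
      Ψ (t₀ • e) - (r * (qf P (t₀ • e) / 2) + q ((t₀ • e) ln)) := hUmin hzK
    have h2 := H.val_eq h hb T (hKup x hx).le
    have h3 : qf P (t₀ • e) = 0 := by
      rw [← qf_sub_single T.symm T.row, hln, ← he, sub_self]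
      simp [qf]
    rw [hln, h3] at h1
    linarith
  have hge := T.qf_ge h x
  have hTge := qf_Tn_nonneg ln x
  have hΛ := inv_pos.2 h.pos
  have hPge : 0 ≤ qf P x := le_trans (by positivity) hge
  have hP' : 0 ≤ (1 - r) / 2 * qf P x := mul_nonneg (by linarith) hPge
  have i1 : qf (Tn ln) x < 1 := by
    refine lt_of_le_of_ne hx.1 fun h1 => ?_
    rw [h1, mul_one] at hge
    have h2 := mul_pos (by linarith : 0 < (1 - r) / 2) (hΛ.trans_le hge)
    have h3 := hmin _ hx.2.1 hx.2.2
    linarith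
  have i2 : t₁ < x ln := by
    refine lt_of_le_of_ne hx.2.1 fun h1 => ?_
    rw [← h1] at hle
    linarith
  have i3 : x ln < t := by
    refine lt_of_le_of_ne hx.2.2 fun h1 => ?_
    rw [h1] at hle
    linarith
  have hKnhds : ∀ᶠ y in 𝓝 x, K ∈ 𝓝 y := eventually_mem_nhds_iff.2 (cylinder_mem_nhds i1 i2 i3)
  obtain ⟨k, hk⟩ := (hlim.eventually hKnhds).exists
  have hy := hKup _ (hxs k)
  set y := xs k
  have hs := h.blowDown k
  set M := Mb b (_root_.bd ψ k) ln y with hM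
  have hMp : M.PosDef := (hs.ell y hy).posDef hΛ
  have hMd : M.det = 1 := hs.det y hy
  have htouch := touch_cyl (hs.smooth y hy) T.symm T.row r (hq _ hy).1
    ((hxmin k).isLocalMin hk) b hMp.inv.posSemidef
  rw [(hq _ hy).2, nonsing_inv_mul M (by rw [hMd]; exact isUnit_one), trace_one, Fintype.card_fin]
    at htouch
  have htr : (M⁻¹ * (r • P + N₁ • En ln)).trace = r * (M⁻¹ * P).trace + N₁ * M⁻¹ ln ln := by
    rw [Matrix.mul_add, trace_add, Matrix.mul_smul, Matrix.mul_smul, trace_smul, trace_smul,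
      trace_mul_En, smul_eq_mul, smul_eq_mul]
  have hfac : r • P + N₁ • En ln = r • (P + (N₁ / r) • En ln) := by
    rw [smul_add, smul_smul, mul_div_cancel₀ _ hr0.ne']
  have hgt := trace_mul_gt ln.pos (hMp.inv.posSemidef) (B := r • P + N₁ • En ln)
    (by rw [hfac]; exact (T.posDef h (div_pos hN1 hr0)).posSemidef.smul hr0.le) (by
      rw [hfac, det_smul, T.det_eq, det_nonsing_inv, hMd, Fintype.card_fin]
      simp only [Ring.inverse_one, one_mul]
      refine hr.trans_le (mul_le_mul_of_nonneg_left ?_ (by positivity))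
      exact div_le_div_of_nonneg_right ((le_div_iff₀ hr0).2 (by nlinarith)) hN0.le)
  linarith

lemma BlowLim.normal_eq (H : BlowLim ln ψ Dψ 𝒰 Ψ G) (h : Sol b Λ L ln ψ Dψ) (hb : -1 < b)
    (T : TanForm b ψ ln P) {z : Eu n} (hz : 0 < z ln) :
    G z (EuclideanSpace.single ln 1) = nrm ln P / (1 + b) * z ln := by
  refine le_antisymm ?_ ?_
  · have h0 : (z - z ln • EuclideanSpace.single ln (1 : ℝ)) ln = 0 := by simp
    have := H.normal_add h hb h0 (z := z ln • EuclideanSpace.single ln 1) (by simpa using hz)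
    rw [add_sub_cancel] at this
    rw [this]
    exact H.normal_le h hb T hz
  · have h1 : Tendsto (fun k => bdGrad Dψ k z (EuclideanSpace.single ln 1)) 𝒰
        (𝓝 (G z (EuclideanSpace.single ln 1))) :=
      ((ContinuousLinearMap.apply ℝ ℝ (EuclideanSpace.single ln 1)).continuous.tendsto _).comp
        (H.grad z hz.le)
    exact ge_of_tendsto h1 (Eventually.of_forall fun k =>
      (T.bd h k).normal_deriv_ge (h.blowDown k) hb hz)

end NormalBound

/-- The point obtained from `x` by moving its normal coordinate `t` to `√(t ^ 2 + 2 * σ)`. -/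
def normalLift {n : ℕ} (ln : Fin n) (σ : ℝ) (x : Eu n) : Eu n :=
  x + (√(x ln ^ 2 + 2 * σ) - x ln) • EuclideanSpace.single ln 1

/-- The difference quotient of `ψ` with respect to half the square of the normal coordinate. -/
def normalQuot {n : ℕ} (ψ : Eu n → ℝ) (ln : Fin n) (σ : ℝ) (x : Eu n) : ℝ :=
  (ψ (normalLift ln σ x) - ψ x) / σ

lemma jet2_sqrt {σ : ℝ} (hσ : 0 < σ) (t : ℝ) :
    Jet2 (fun s => √(s ^ 2 + 2 * σ)) t (t / √(t ^ 2 + 2 * σ)) (2 * σ / √(t ^ 2 + 2 * σ) ^ 3) := by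
  have hd : ∀ s : ℝ, HasDerivAt (fun s => √(s ^ 2 + 2 * σ)) (s / √(s ^ 2 + 2 * σ)) s := fun s => by
    have h0 : (0 : ℝ) < s ^ 2 + 2 * σ := by positivity
    have h1 := (((hasDerivAt_id s).pow 2).add_const (2 * σ)).sqrt h0.ne'
    refine h1.congr_deriv ?_
    have h2 : √(s ^ 2 + 2 * σ) ≠ 0 := (Real.sqrt_pos.2 h0).ne'
    simp only [id, Nat.cast_ofNat, mul_one, Pi.pow_apply]
    field_simp
    simp
  refine ⟨fun s => s / √(s ^ 2 + 2 * σ), .of_forall hd, rfl, ?_⟩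
  have h0 : (0 : ℝ) < t ^ 2 + 2 * σ := by positivity
  have h1 : 0 < √(t ^ 2 + 2 * σ) := Real.sqrt_pos.2 h0
  refine ((hasDerivAt_id t).div (hd t) h1.ne').congr_deriv ?_
  have h2 := Real.sq_sqrt h0.le
  simp only [id]
  field_simp
  linear_combination h2

section Lift

variable {n : ℕ} {b Λ L : ℝ} {ln : Fin n} {ψ : Eu n → ℝ} {Dψ : Eu n → (Eu n →L[ℝ] ℝ)}

lemma normalLift_coord (ln : Fin n) (σ : ℝ) (x : Eu n) : normalLift ln σ x ln = √(x ln ^ 2 + 2 * σ) := by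
  simp [normalLift]

lemma contDiffAt_normalLift (ln : Fin n) {σ : ℝ} (hσ : 0 < σ) (x : Eu n) :
    ContDiffAt ℝ 2 (normalLift ln σ) x := by
  have h0 : x ln ^ 2 + 2 * σ ≠ 0 := by positivity
  have h1 : ContDiffAt ℝ 2 (fun x : Eu n => √(x ln ^ 2 + 2 * σ)) x :=
    ContDiffAt.sqrt (by fun_prop) h0
  have h2 : ContDiffAt ℝ 2 (fun x : Eu n => x ln) x := by fun_prop
  exact contDiffAt_id.add ((h1.sub h2).smul contDiffAt_const)

lemma Sol.contDiffAt_normalQuot (h : Sol b Λ L ln ψ Dψ) {σ : ℝ} (hσ : 0 < σ) {x : Eu n}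
    (hx : 0 < x ln) : ContDiffAt ℝ 2 (normalQuot ψ ln σ) x := by
  have hy : 0 < normalLift ln σ x ln := by rw [normalLift_coord]; positivity
  exact ((ContDiffAt.comp x (h.smooth _ hy) (contDiffAt_normalLift ln hσ x)).sub
    (h.smooth x hx)).div_const σ

lemma mul_add_smul_mul {J X E : Mt n} {ρ : ℝ} (hJ : J * E * J = ρ • E) (c : ℝ) :
    J * (X + c • E) * J = J * X * J + (c * ρ) • E := by
  rw [Matrix.mul_add, Matrix.add_mul, Matrix.mul_smul, Matrix.smul_mul, hJ, smul_smul]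

lemma Sol.Mb_normalQuot (h : Sol b Λ L ln ψ Dψ) {σ : ℝ} (hσ : 0 < σ) {x : Eu n} (hx : 0 < x ln)
    (κ : ℝ) :
    Mb b (fun y => κ * normalQuot ψ ln σ y) ln x = (κ / σ) •
      ((Tn ln + (x ln / normalLift ln σ x ln) • En ln) * Mb b ψ ln (normalLift ln σ x) *
          (Tn ln + (x ln / normalLift ln σ x ln) • En ln) +
        ((1 + b) * (2 * σ / normalLift ln σ x ln ^ 2) *
          (Dψ (normalLift ln σ x) (EuclideanSpace.single ln 1) / normalLift ln σ x ln)) • En ln -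
        Mb b ψ ln x) := by
  set e : Eu n := EuclideanSpace.single ln 1 with he
  set y := normalLift ln σ x with hy
  set r := y ln with hr
  have hrs : r = √(x ln ^ 2 + 2 * σ) := normalLift_coord ln σ x
  have hr0 : 0 < r := by rw [hrs]; positivity
  have hr2 : r ^ 2 = x ln ^ 2 + 2 * σ := by rw [hrs]; exact Real.sq_sqrt (by positivity)
  set ρ := x ln / r with hρ
  set J := Tn ln + ρ • En ln with hJ
  have hJt : J.transpose = J := by
    rw [hJ, transpose_add, transpose_smul, Tn_transpose, En_transpose]
  have hJv : ∀ ξ : Eu n, WithLp.toLp 2 (J *ᵥ ξ.ofLp) = ξ + ((ρ - 1) * ξ ln) • e := fun ξ => by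
    have h1 : J = 1 + (ρ - 1) • En ln := by rw [hJ, Tn]; module
    ext i
    by_cases hi : i = ln
    · subst hi
      simp [h1, En, add_mulVec, Matrix.single_mulVec, he]
    · simp [h1, En, add_mulVec, Matrix.single_mulVec, he, hi]
  set ℓ := fderiv ℝ ψ y with hℓ
  have hsm := h.smooth y hr0
  have hDψ : ∀ ξ, Dψ y ξ = ℓ ξ := fun ξ => by rw [hℓ, (h.hasFDerivAt hr0).fderiv]
  have hX : (J * hs ψ y * J).transpose = J * hs ψ y * J := by
    rw [transpose_mul, transpose_mul, hJt, (hs_symm hsm : (hs ψ y).transpose = _),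
      Matrix.mul_assoc]
  have hjet : ∀ ξ : Eu n, Jet2 (fun t : ℝ => κ * normalQuot ψ ln σ (x + t • ξ)) 0
      (κ / σ * (ℓ (ξ + ((ρ - 1) * ξ ln) • e) - fderiv ℝ ψ x ξ))
      (qf ((κ / σ) • (J * hs ψ y * J + (ℓ e * (2 * σ / r ^ 3)) • En ln - hs ψ x)) ξ) := fun ξ => by
    have c0 : Jet2 (fun t : ℝ => (x + t • ξ) ln) 0 (ξ ln) 0 := by
      simpa using (jet2_line x ξ 0).comp_clm (EuclideanSpace.proj ln : Eu n →L[ℝ] ℝ)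
    have c1 : Jet2 (fun t : ℝ => √((x + t • ξ) ln ^ 2 + 2 * σ)) 0 (ρ * ξ ln)
        (2 * σ / r ^ 3 * ξ ln ^ 2) := by
      have := Jet2.comp (F := fun s => √(s ^ 2 + 2 * σ)) (h := fun t : ℝ => (x + t • ξ) ln)
        (t := 0) (jet2_sqrt hσ _) c0
      simpa [hρ, hrs] using this
    have c2 : Jet2 (fun t : ℝ => normalLift ln σ (x + t • ξ)) 0 (ξ + ((ρ - 1) * ξ ln) • e)
        ((2 * σ / r ^ 3 * ξ ln ^ 2) • e) := by
      have h1 := (c1.sub c0).comp_clm (ContinuousLinearMap.toSpanSingleton ℝ e)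
      have h2 := (jet2_line x ξ 0).add h1
      simp only [ContinuousLinearMap.toSpanSingleton_apply, zero_add, sub_zero] at h2
      rw [show (ρ - 1) * ξ ln = ρ * ξ ln - ξ ln by ring]
      exact h2
    have c2' : normalLift ln σ (x + (0 : ℝ) • ξ) = y := by rw [zero_smul, add_zero]
    have c3 := ContDiffAt.jet2_comp (v := ψ) (c := fun t : ℝ => normalLift ln σ (x + t • ξ)) (t := 0)
      (by rw [c2']; exact hsm) c2
    rw [c2', snd_eq_qf hsm] at c3
    have c4 := jet2_line_comp (h.smooth x hx) ξ
    have c5 := (c3.sub c4).const_mul (κ / σ)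
    have e1 : qf (J * hs ψ y * J) ξ = qf (hs ψ y) (ξ + ((ρ - 1) * ξ ln) • e) := by
      have := qf_conj J (hs ψ y) ξ
      rwa [hJt, hJv] at this
    rw [qf_smul, qf_sub, qf_add, qf_smul, qf_En, e1]
    simp only [map_smul, smul_eq_mul] at c5
    refine Jet2.congr ?_ (.of_forall fun t => ?_) (f := fun t : ℝ => κ / σ *
      (ψ (normalLift ln σ (x + t • ξ)) - ψ (x + t • ξ)))
    · convert c5 using 1
      ring
    · simp only [normalQuot]; ring
  have hvc : ContDiffAt ℝ 2 (fun y => κ * normalQuot ψ ln σ y) x :=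
    contDiffAt_const.mul (h.contDiffAt_normalQuot hσ hx)
  rw [Mb_of_jets hvc (by
    rw [transpose_smul, transpose_sub, transpose_add, hX, transpose_smul, En_transpose,
      (hs_symm (h.smooth x hx) : (hs ψ x).transpose = _)]) hjet b ln, hDψ, Mb_eq, Mb_eq, pd, pd,
    ← hℓ, ← hr]
  have hJE : J * En ln * J = ρ ^ 2 • En ln := by
    rw [hJ, Matrix.add_mul, row_mul_En (Tn_transpose ln) (Tn_row ln), zero_add, Matrix.smul_mul,
      En_mul_self, Matrix.mul_add, Matrix.smul_mul, En_mul_row (Tn_row ln), smul_zero, zero_add,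
      Matrix.mul_smul, Matrix.smul_mul, En_mul_self, smul_smul, sq]
  have hee : ℓ (e + ((ρ - 1) * e ln) • e) = ρ * ℓ e := by
    simp [he]; ring
  have hsplit : ∀ c : ℝ, J * (hs ψ y + c • En ln) * J = J * hs ψ y * J + (c * ρ ^ 2) • En ln :=
    mul_add_smul_mul hJE
  rw [← he, hee, hsplit]
  have hx2 : 2 * σ = r ^ 2 - x ln ^ 2 := by linarith
  have hcoef : κ / σ * (ℓ e * (2 * σ / r ^ 3)) +
      b * (κ / σ * (ρ * ℓ e - fderiv ℝ ψ x e)) / x ln =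
      κ / σ * (b * ℓ e / r * ρ ^ 2 + (1 + b) * (2 * σ / r ^ 2) * (ℓ e / r) -
        b * fderiv ℝ ψ x e / x ln) := by
    rw [hx2, hρ]
    have := hx.ne'
    field_simp
    ring
  have hfin : ∀ (A B E : Mt n) (k s c d g m : ℝ), k * s + c = k * (d + g - m) →
      k • (A + s • E - B) + c • E = k • (A + d • E + g • E - (B + m • E)) :=
    fun A B E k s c d g m hk => by
      have : k • (A + d • E + g • E - (B + m • E)) = k • (A - B) + (k * (d + g - m)) • E := by
        module
      rw [this, ← hk]
      module
  exact hfin _ _ _ _ _ _ _ _ _ hcoef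

end Lift

section LiftTrace

variable {n : ℕ} {b Λ L : ℝ} {ln : Fin n} {ψ : Eu n → ℝ} {Dψ : Eu n → (Eu n →L[ℝ] ℝ)}

lemma trace_squeeze_ge (ln : Fin n) {A B : Mt n} (hA : A.PosSemidef) (hB : B.PosSemidef)
    (hAd : A.det = 1) (hBd : B.det = 1) {x r σ : ℝ} (hx : 0 < x) (hσ : 0 < σ) (hr : 0 < r)
    (hr2 : r ^ 2 = x ^ 2 + 2 * σ) :
    n - 2 * σ / x ^ 2 ≤ (A * ((Tn ln + (x / r) • En ln) * B * (Tn ln + (x / r) • En ln))).trace := by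
  set J := Tn ln + (x / r) • En ln with hJ
  have hn : 0 < n := ln.pos
  have hn' : (0 : ℝ) < n := by exact_mod_cast hn
  have hJt : J.transpose = J := by
    rw [hJ, transpose_add, transpose_smul, Tn_transpose, En_transpose]
  have hJd : J.det = x / r := by
    rw [hJ, det_add_smul_En (Tn_row ln), Tn, sub_add_cancel, det_one, mul_one]
  have hC : (J * B * J).PosSemidef := by
    have := psd_conj hB J
    rwa [hJt] at this
  set s := 2 * σ / x ^ 2 with hs
  have hs0 : 0 < s := by positivity
  have hθ : 0 < 1 + s / n := by positivity
  have hpow : 1 + s ≤ (1 + s / n) ^ n := by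
    have := one_add_mul_le_pow (a := s / n) (by linarith [div_pos hs0 hn']) n
    rwa [mul_div_cancel₀ _ hn'.ne'] at this
  have key := trace_mul_ge hn hA (hC.smul hθ.le) (by
    rw [hAd, one_mul, det_smul, det_mul, det_mul, hJd, hBd, Fintype.card_fin]
    have h1 : (1 + s) * (x / r * 1 * (x / r)) = 1 := by
      rw [hs]
      field_simp
      linarith
    exact h1.symm.trans_le (mul_le_mul_of_nonneg_right hpow (by positivity)))
  rw [Matrix.mul_smul, trace_smul, smul_eq_mul] at key
  set τ := (A * (J * B * J)).trace
  have h2 : (1 + s / n) * (n - s) ≤ n := by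
    have : (1 + s / n) * (n - s) = n - s ^ 2 / n := by field_simp; ring
    have : 0 ≤ s ^ 2 / n := by positivity
    linarith
  exact le_of_mul_le_mul_left (h2.trans key) hθ

lemma Sol.trace_normalQuot_le (h : Sol b Λ L ln ψ Dψ) {σ : ℝ} (hσ : 0 < σ) {x : Eu n}
    (hx : 0 < x ln) :
    ((Mb b ψ ln x)⁻¹ * Mb b (fun y => -1 * normalQuot ψ ln σ y) ln x).trace ≤
      2 / x ln ^ 2 - 2 * (1 + b) * (Dψ (normalLift ln σ x) (EuclideanSpace.single ln 1) /
        normalLift ln σ x ln) / (normalLift ln σ x ln) ^ 2 * (Mb b ψ ln x)⁻¹ ln ln := by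
  have hΛ := inv_pos.2 h.pos
  have hr2 : normalLift ln σ x ln ^ 2 = x ln ^ 2 + 2 * σ := by
    rw [normalLift_coord]; exact Real.sq_sqrt (by positivity)
  have hr : 0 < normalLift ln σ x ln := by rw [normalLift_coord]; positivity
  have hM := (h.ell x hx).posDef hΛ
  have hd := h.det x hx
  rw [h.Mb_normalQuot hσ hx (-1)]
  set M := Mb b ψ ln x
  set y := normalLift ln σ x
  set ζ := Dψ y (EuclideanSpace.single ln 1) / y ln
  have key := trace_squeeze_ge ln hM.inv.posSemidef ((h.ell y hr).posDef hΛ).posSemidef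
    (by rw [det_nonsing_inv, hd]; simp) (h.det y hr) hx hσ hr hr2
  rw [Matrix.mul_smul, Matrix.mul_sub, Matrix.mul_add, Matrix.mul_smul, trace_smul, trace_sub,
    trace_add, trace_smul, trace_mul_En, nonsing_inv_mul M (by rw [hd]; exact isUnit_one),
    trace_one, Fintype.card_fin, smul_eq_mul, smul_eq_mul]
  set τ := (M⁻¹ * ((Tn ln + (x ln / y ln) • En ln) * Mb b ψ ln y *
    (Tn ln + (x ln / y ln) • En ln))).trace
  set c := 2 * (1 + b) * ζ / y ln ^ 2 * M⁻¹ ln ln with hc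
  have e1 : (1 + b) * (2 * σ / y ln ^ 2) * ζ * M⁻¹ ln ln = σ * c := by rw [hc]; ring
  rw [e1]
  have e2 : 2 * σ / x ln ^ 2 = σ * (2 / x ln ^ 2) := by ring
  rw [e2] at key
  have e3 : -1 / σ * (τ + σ * c - n) = (n - τ) / σ - c := by field_simp; ring
  rw [e3]
  have : (n - τ) / σ ≤ 2 / x ln ^ 2 := by rw [div_le_iff₀ hσ]; linarith
  linarith

/-- The difference quotients converge to the normalized normal derivative. -/
lemma Sol.abs_normalQuot_sub_le (h : Sol b Λ L ln ψ Dψ) {σ : ℝ} (hσ : 0 < σ) {x : Eu n}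
    (hx : 0 < x ln) :
    |normalQuot ψ ln σ x - 2 * Dψ x (EuclideanSpace.single ln 1) / (√(x ln ^ 2 + 2 * σ) + x ln)|
      ≤ L * σ / x ln ^ 2 * 4 := by
  set e : Eu n := EuclideanSpace.single ln 1 with he
  set r := √(x ln ^ 2 + 2 * σ) with hr
  have hr0 : 0 < r := by positivity
  have hr2 : r ^ 2 = x ln ^ 2 + 2 * σ := Real.sq_sqrt (by positivity)
  have hδ : r - x ln = 2 * σ / (r + x ln) := by
    rw [eq_div_iff (by positivity)]; linarith
  have hδ0 : 0 < r - x ln := by rw [hδ]; positivity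
  have h1 := h.taylor (x := x) (y := normalLift ln σ x) hx.le
    (by rw [normalLift_coord]; positivity)
  have h2 : normalLift ln σ x - x = (r - x ln) • e := by simp [normalLift, hr, he]
  rw [h2, norm_smul, he, norm_single_one, mul_one, map_smul, smul_eq_mul, ← he,
    Real.norm_of_nonneg hδ0.le] at h1
  have h3 : normalQuot ψ ln σ x - 2 * Dψ x e / (r + x ln) =
      (ψ (normalLift ln σ x) - ψ x - (r - x ln) * Dψ x e) / σ := by
    rw [normalQuot, hδ]; field_simp
  rw [h3, abs_div, abs_of_pos hσ, div_le_iff₀ hσ]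
  refine h1.trans ?_
  have h4 : r - x ln ≤ 2 * σ / x ln := by
    rw [hδ]; gcongr; linarith
  calc L * (r - x ln) ^ 2 ≤ L * (2 * σ / x ln) ^ 2 := by
        have := h.lip_nonneg
        gcongr
    _ = L * σ / x ln ^ 2 * 4 * σ := by ring

lemma Sol.continuousOn_grad (h : Sol b Λ L ln ψ Dψ) : ContinuousOn Dψ {x | 0 ≤ x ln} :=
  (LipschitzOnWith.of_dist_le_mul (K := L.toNNReal) fun x hx y hy => by
    rw [Real.coe_toNNReal _ h.lip_nonneg, dist_eq_norm, dist_eq_norm]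
    exact h.lip x y hx hy).continuousOn

lemma Sol.tendsto_normalQuot (h : Sol b Λ L ln ψ Dψ) {l : Filter ℕ} {σ : ℕ → ℝ}
    (hσ : ∀ k, 0 < σ k) (hσ0 : Tendsto σ l (𝓝 0)) {y : Eu n} {ys : ℕ → Eu n} (hy : 0 < y ln)
    (hys : ∀ k, 0 < ys k ln) (hlim : Tendsto ys l (𝓝 y)) :
    Tendsto (fun k => normalQuot ψ ln (σ k) (ys k)) l
      (𝓝 (Dψ y (EuclideanSpace.single ln 1) / y ln)) := by
  have hc : Tendsto (fun k => ys k ln) l (𝓝 (y ln)) :=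
    ((by fun_prop : Continuous fun x : Eu n => x ln).tendsto y).comp hlim
  have hD : Tendsto (fun k => Dψ (ys k)) l (𝓝 (Dψ y)) :=
    ((h.continuousOn_grad.continuousAt (mem_of_superset ((isOpen_upper ln).mem_nhds hy)
      fun z hz => (show 0 < z ln from hz).le)).tendsto).comp hlim
  have hDe : Tendsto (fun k => Dψ (ys k) (EuclideanSpace.single ln 1)) l
      (𝓝 (Dψ y (EuclideanSpace.single ln 1))) :=
    ((ContinuousLinearMap.apply ℝ ℝ (EuclideanSpace.single ln 1)).continuous.tendsto _).comp hD
  have hroot : Tendsto (fun k => √(ys k ln ^ 2 + 2 * σ k) + ys k ln) l (𝓝 (y ln + y ln)) := by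
    have := (((hc.pow 2).add (hσ0.const_mul 2)).sqrt).add hc
    simpa [Real.sqrt_sq hy.le] using this
  have hmain := (hDe.const_mul 2).div hroot (by positivity)
  have herr : Tendsto (fun k => L * σ k / ys k ln ^ 2 * 4) l (𝓝 0) := by
    have := (((hσ0.const_mul L).div (hc.pow 2) (by positivity)).mul_const 4)
    simpa using this
  have h2 := squeeze_zero_norm (f := fun k => normalQuot ψ ln (σ k) (ys k) -
    2 * Dψ (ys k) (EuclideanSpace.single ln 1) / (√(ys k ln ^ 2 + 2 * σ k) + ys k ln))
    (fun k => h.abs_normalQuot_sub_le (hσ k) (hys k)) herr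
  have := h2.add hmain
  simp only [Pi.div_apply, sub_add_cancel, zero_add] at this
  convert this using 2
  field_simp
  ring

end LiftTrace

lemma one_le_diag_mul_inv_diag {n : ℕ} {M : Mt n} (hM : M.PosDef) (i : Fin n) :
    1 ≤ M i i * M⁻¹ i i := by
  have hp : 0 < M i i := hM.diag_pos
  have hu : IsUnit M.det := hM.det_pos.ne'.isUnit
  have hiM : M⁻¹.transpose = M⁻¹ := by
    have := hM.inv.isHermitian
    rwa [IsHermitian, conjTranspose_eq_transpose_of_trivial] at this
  have h1 := (psd_conj hM.posSemidef (M⁻¹ - (M i i)⁻¹ • (1 : Mt n))).diag_nonneg (i := i)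
  have h2 : (M⁻¹ - (M i i)⁻¹ • (1 : Mt n)) * M * (M⁻¹ - (M i i)⁻¹ • (1 : Mt n)).transpose =
      M⁻¹ - (2 * (M i i)⁻¹) • (1 : Mt n) + ((M i i)⁻¹ * (M i i)⁻¹) • M := by
    rw [transpose_sub, transpose_smul, transpose_one, hiM, Matrix.sub_mul, nonsing_inv_mul M hu,
      Matrix.smul_mul, Matrix.one_mul, Matrix.sub_mul, Matrix.mul_sub, Matrix.mul_sub,
      Matrix.one_mul, Matrix.one_mul, Matrix.smul_mul, mul_nonsing_inv M hu, Matrix.mul_smul,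
      Matrix.smul_mul, Matrix.mul_one, smul_smul]
    module
  rw [h2] at h1
  simp only [Matrix.add_apply, Matrix.sub_apply, Matrix.smul_apply, one_apply_eq, smul_eq_mul,
    mul_one] at h1
  rw [mul_assoc, inv_mul_cancel₀ hp.ne', mul_one] at h1
  have h3 : (M i i)⁻¹ ≤ M⁻¹ i i := by linarith
  calc (1 : ℝ) = M i i * (M i i)⁻¹ := (mul_inv_cancel₀ hp.ne').symm
    _ ≤ M i i * M⁻¹ i i := mul_le_mul_of_nonneg_left h3 hp.le

/-- The quotient of the normal derivative by the normal coordinate. -/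
def normalRatio {n : ℕ} (Dψ : Eu n → (Eu n →L[ℝ] ℝ)) (ln : Fin n) (x : Eu n) : ℝ :=
  Dψ x (EuclideanSpace.single ln 1) / x ln

section Touch

variable {n : ℕ} {b Λ L : ℝ} {ln : Fin n} {ψ : Eu n → ℝ} {Dψ : Eu n → (Eu n →L[ℝ] ℝ)}

lemma Sol.continuousAt_normalRatio (h : Sol b Λ L ln ψ Dψ) {x : Eu n} (hx : 0 < x ln) :
    ContinuousAt (normalRatio Dψ ln) x := by
  have h1 : ContinuousAt Dψ x :=
    h.continuousOn_grad.continuousAt (mem_of_superset ((isOpen_upper ln).mem_nhds hx)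
      fun z hz => (show 0 < z ln from hz).le)
  exact (h1.clm_apply continuousAt_const).div
    (by fun_prop : Continuous fun x : Eu n => x ln).continuousAt hx.ne'

lemma Sol.continuousAt_Mb (h : Sol b Λ L ln ψ Dψ) {x : Eu n} (hx : 0 < x ln) :
    ContinuousAt (Mb b ψ ln) x := by
  have h1 : ContinuousAt (fun y => hs ψ y + (b * pd ψ ln y / y ln) • En ln) x :=
    (continuousAt_hs (h.smooth x hx)).add
      (((continuousAt_const.mul (hasFDerivAt_pd (h.smooth x hx) ln).continuousAt).div
        (by fun_prop : Continuous fun x : Eu n => x ln).continuousAt hx.ne').smul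
          continuousAt_const)
  rwa [show Mb b ψ ln = fun y => hs ψ y + (b * pd ψ ln y / y ln) • En ln from
    funext fun y => Mb_eq b ψ ln y]

lemma Sol.continuousAt_Mb_inv (h : Sol b Λ L ln ψ Dψ) {x : Eu n} (hx : 0 < x ln) :
    ContinuousAt (fun y => (Mb b ψ ln y)⁻¹) x := by
  have h1 : ContinuousAt (fun y => (Mb b ψ ln y).adjugate) x :=
    ContinuousAt.comp (f := Mb b ψ ln) (g := adjugate)
      (continuous_id.matrix_adjugate).continuousAt (h.continuousAt_Mb hx)
  refine h1.congr ?_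
  filter_upwards [(isOpen_upper ln).mem_nhds hx] with y hy
  rw [inv_def, h.det y hy]
  simp

lemma tendsto_normalLift {l : Filter ℕ} {σ : ℕ → ℝ} (hσ0 : Tendsto σ l (𝓝 0)) {y : Eu n}
    {ys : ℕ → Eu n} (hy : 0 < y ln) (hlim : Tendsto ys l (𝓝 y)) :
    Tendsto (fun k => normalLift ln (σ k) (ys k)) l (𝓝 y) := by
  have hc : Tendsto (fun k => ys k ln) l (𝓝 (y ln)) :=
    ((by fun_prop : Continuous fun x : Eu n => x ln).tendsto y).comp hlim
  have h1 := hlim.add (((((hc.pow 2).add (hσ0.const_mul 2)).sqrt).sub hc).smul_const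
    (EuclideanSpace.single ln (1 : ℝ)))
  simpa [normalLift, Real.sqrt_sq hy.le] using h1

/-- At an interior minimum of `-normalRatio` minus a cylindrical test function, the
first order condition in the normal direction. -/
lemma Sol.normalRatio_critical (h : Sol b Λ L ln ψ Dψ) {x : Eu n} (hx : 0 < x ln) {c : ℝ}
    {f : ℝ → ℝ} {f₁ : ℝ} (hf : HasDerivAt f f₁ (x ln))
    (hmin : IsLocalMin
      (fun y => -1 * normalRatio Dψ ln y - (c * (qf (Tn ln) y / 2) + f (y ln))) x) :
    (1 + b) * normalRatio Dψ ln x = Mb b ψ ln x ln ln + x ln * f₁ := by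
  set e : Eu n := EuclideanSpace.single ln 1 with he
  have hline : HasDerivAt (fun t : ℝ => x + t • e) e 0 := by
    simpa using ((hasDerivAt_id (0 : ℝ)).smul_const e).const_add x
  have hx0 : x + (0 : ℝ) • e = x := by simp
  have hcoord : ∀ t : ℝ, (x + t • e) ln = x ln + t := fun t => by simp [he]
  have hN : HasDerivAt (fun t : ℝ => pd ψ ln (x + t • e)) (pd2 ψ ln ln x) 0 := by
    have := (hx0.symm ▸ hasFDerivAt_pd (h.smooth x hx) ln :
      HasFDerivAt (pd ψ ln) _ (x + (0 : ℝ) • e)).comp_hasDerivAt (0 : ℝ) hline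
    refine this.congr_deriv ?_
    simp [he, PiLp.single_apply]
  have hden : HasDerivAt (fun t : ℝ => x ln + t) 1 0 := (hasDerivAt_id 0).const_add _
  have hratio : HasDerivAt (fun t : ℝ => normalRatio Dψ ln (x + t • e))
      ((pd2 ψ ln ln x - normalRatio Dψ ln x) / x ln) 0 := by
    refine ((hN.div hden (by simpa using hx.ne')).congr_of_eventuallyEq ?_).congr_deriv ?_
    · filter_upwards [lt_mem_nhds (show -x ln < 0 by linarith)] with t ht
      have : 0 < (x + t • e) ln := by rw [hcoord]; linarith
      simp only [normalRatio, hcoord, Pi.div_apply]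
      rw [h.pd_eq this]
    · rw [hx0, h.pd_eq hx, normalRatio, add_zero, ← he]
      have := hx.ne'
      field_simp
  have hf' : HasDerivAt (fun t : ℝ => f (x ln + t)) f₁ 0 := by
    have : HasDerivAt f f₁ (x ln + 0) := by rwa [add_zero]
    simpa [Function.comp_def] using this.comp (0 : ℝ) hden
  have hline_min : IsLocalMin (fun t : ℝ => -1 * normalRatio Dψ ln (x + t • e) -
      (c * (qf (Tn ln) x / 2) + f (x ln + t))) 0 := by
    have h1 : Tendsto (fun t : ℝ => x + t • e) (𝓝 0) (𝓝 x) := by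
      simpa using hline.continuousAt.tendsto
    filter_upwards [h1.eventually hmin] with t ht
    rw [qf_Tn_add_single, hcoord] at ht
    simpa using ht
  have hz := hline_min.hasDerivAt_eq_zero
    ((hratio.const_mul (-1)).sub (hf'.const_add (c * (qf (Tn ln) x / 2))))
  have hMnn : Mb b ψ ln x ln ln = pd2 ψ ln ln x + b * normalRatio Dψ ln x := by
    simp only [Mb, of_apply, and_self, if_true, h.pd_eq hx, normalRatio]
    ring
  have h1 : (pd2 ψ ln ln x - normalRatio Dψ ln x) = -(f₁ * x ln) := by
    rw [← neg_mul, ← div_eq_iff hx.ne']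
    linarith
  rw [hMnn]
  linarith

/-- The normal ratio is a subsolution: if `-normalRatio` minus a cylindrical test function has
an interior minimum in a cylinder, the test function violates the strict inequality somewhere. -/
lemma Sol.normalRatio_touch (h : Sol b Λ L ln ψ Dψ) {r s t c : ℝ} (hs : 0 < s) {f f₁ f₂ : ℝ → ℝ}
    (hf : ∀ t, 0 < t → Jet2 f t (f₁ t) (f₂ t)) (hf₁ : ∀ t, 0 < t → ContinuousAt f₁ t)
    (hf₂ : ∀ t, 0 < t → ContinuousAt f₂ t) {z : Eu n}
    (hz : qf (Tn ln) z ≤ r ∧ s ≤ z ln ∧ z ln ≤ t)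
    (hbd : ∀ x : Eu n, qf (Tn ln) x ≤ r ∧ s ≤ x ln ∧ x ln ≤ t →
      qf (Tn ln) x = r ∨ x ln = s ∨ x ln = t →
      -1 * normalRatio Dψ ln z - (c * (qf (Tn ln) z / 2) + f (z ln)) <
        -1 * normalRatio Dψ ln x - (c * (qf (Tn ln) x / 2) + f (x ln))) :
    ∃ x : Eu n, 0 < x ln ∧ c * ((Mb b ψ ln x)⁻¹ * Tn ln).trace +
      (f₂ (x ln) + (b + 2) * f₁ (x ln) / x ln) * (Mb b ψ ln x)⁻¹ ln ln ≤ 0 := by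
  set K := {x : Eu n | qf (Tn ln) x ≤ r ∧ s ≤ x ln ∧ x ln ≤ t} with hK
  have hKup : ∀ x ∈ K, 0 < x ln := fun x hx => hs.trans_le hx.2.1
  have hcoord : Continuous fun x : Eu n => x ln := by fun_prop
  have htest : ∀ x ∈ K, ContinuousAt (fun x : Eu n => c * (qf (Tn ln) x / 2) + f (x ln)) x :=
    fun x hx => (continuousAt_const.mul ((continuous_qf _).continuousAt.div_const 2)).add
      (ContinuousAt.comp (f := fun x : Eu n => x ln) (hf _ (hKup x hx)).hasDerivAt.continuousAt
        hcoord.continuousAt)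
  set 𝒰 : Ultrafilter ℕ := hyperfilter ℕ
  have hσ : ∀ k : ℕ, (0 : ℝ) < 1 / ((k : ℝ) + 1) := fun k => by positivity
  have hσ0 : Tendsto (fun k : ℕ => 1 / ((k : ℝ) + 1)) 𝒰 (𝓝 0) :=
    tendsto_one_div_add_atTop_nhds_zero_nat.mono_left Nat.hyperfilter_le_atTop
  obtain ⟨x, xs, hx, hxs, hxmin, hlim, hUmin⟩ := exists_tendsto_minimizers
    (isCompact_cylinder ln r s t) ⟨z, hz⟩ 𝒰
    (u := fun k x => -1 * normalQuot ψ ln (1 / ((k : ℝ) + 1)) x -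
      (c * (qf (Tn ln) x / 2) + f (x ln)))
    (U := fun x => -1 * normalRatio Dψ ln x - (c * (qf (Tn ln) x / 2) + f (x ln)))
    (fun k x hx => ((continuousAt_const.mul
      (h.contDiffAt_normalQuot (hσ k) (hKup x hx)).continuousAt).sub
        (htest x hx)).continuousWithinAt)
    (fun y ys hy hys hl => ((h.tendsto_normalQuot hσ hσ0 (hKup y hy) (fun k => hKup _ (hys k))
      hl).const_mul (-1)).sub ((htest y hy).tendsto.comp hl))
  have hx0 := hKup x hx
  have hlt : ∀ hxb : qf (Tn ln) x = r ∨ x ln = s ∨ x ln = t, False := fun hxb =>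
    absurd (hbd x hx hxb) (not_lt.2 (hUmin hz))
  have i1 : qf (Tn ln) x < r := lt_of_le_of_ne hx.1 fun h1 => hlt (Or.inl h1)
  have i2 : s < x ln := lt_of_le_of_ne hx.2.1 fun h1 => hlt (Or.inr (Or.inl h1.symm))
  have i3 : x ln < t := lt_of_le_of_ne hx.2.2 fun h1 => hlt (Or.inr (Or.inr h1))
  have hKx : K ∈ 𝓝 x := cylinder_mem_nhds i1 i2 i3
  refine ⟨x, hx0, ?_⟩
  have hMp := (h.ell x hx0).posDef (inv_pos.2 h.pos)
  have hcrit := h.normalRatio_critical hx0 (hf _ hx0).hasDerivAt (hUmin.isLocalMin hKx)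
  have hineq : ∀ᶠ k in (𝒰 : Filter ℕ), c * ((Mb b ψ ln (xs k))⁻¹ * Tn ln).trace +
      (f₂ (xs k ln) + b * f₁ (xs k ln) / xs k ln) * (Mb b ψ ln (xs k))⁻¹ ln ln ≤
      2 / xs k ln ^ 2 - 2 * (1 + b) * normalRatio Dψ ln (normalLift ln (1 / ((k : ℝ) + 1)) (xs k)) /
        (normalLift ln (1 / ((k : ℝ) + 1)) (xs k) ln) ^ 2 * (Mb b ψ ln (xs k))⁻¹ ln ln := by
    filter_upwards [hlim.eventually (eventually_mem_nhds_iff.2 hKx)] with k hk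
    have hy := hKup _ (hxs k)
    have h1 := touch_cyl (contDiffAt_const.mul (h.contDiffAt_normalQuot (hσ k) hy))
      (Tn_transpose ln) (Tn_row ln) c (hf _ hy) ((hxmin k).isLocalMin hk) b
      ((h.ell _ hy).posDef (inv_pos.2 h.pos)).inv.posSemidef
    exact h1.trans (h.trace_normalQuot_le (hσ k) hy)
  have hA : Tendsto (fun k => (Mb b ψ ln (xs k))⁻¹) 𝒰 (𝓝 (Mb b ψ ln x)⁻¹) :=
    (h.continuousAt_Mb_inv hx0).tendsto.comp hlim
  have hAnn : Tendsto (fun k => (Mb b ψ ln (xs k))⁻¹ ln ln) 𝒰 (𝓝 ((Mb b ψ ln x)⁻¹ ln ln)) :=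
    ((by fun_prop : Continuous fun A : Mt n => A ln ln).tendsto _).comp hA
  have hAT : Tendsto (fun k => ((Mb b ψ ln (xs k))⁻¹ * Tn ln).trace) 𝒰
      (𝓝 ((Mb b ψ ln x)⁻¹ * Tn ln).trace) :=
    ((continuous_id.matrix_mul continuous_const).matrix_trace.tendsto _).comp hA
  have hxn : Tendsto (fun k => xs k ln) 𝒰 (𝓝 (x ln)) := (hcoord.tendsto x).comp hlim
  have hlift := tendsto_normalLift hσ0 hx0 hlim
  have hln : Tendsto (fun k : ℕ => normalLift ln (1 / ((k : ℝ) + 1)) (xs k) ln) 𝒰 (𝓝 (x ln)) :=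
    (hcoord.tendsto x).comp hlift
  have hlimit := le_of_tendsto_of_tendsto
    ((hAT.const_mul c).add ((((hf₂ _ hx0).tendsto.comp hxn).add
      ((((hf₁ _ hx0).tendsto.comp hxn).const_mul b).div hxn hx0.ne')).mul hAnn))
    ((tendsto_const_nhds.div (hxn.pow 2) (by positivity)).sub
      (((((h.continuousAt_normalRatio hx0).tendsto.comp hlift).const_mul
        (2 * (1 + b))).div (hln.pow 2) (by positivity)).mul hAnn)) hineq
  have hprod := one_le_diag_mul_inv_diag hMp ln
  set a := (Mb b ψ ln x)⁻¹
  rw [mul_assoc 2 (1 + b), hcrit] at hlimit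
  have e1 : 2 / x ln ^ 2 - 2 * (Mb b ψ ln x ln ln + x ln * f₁ (x ln)) / x ln ^ 2 * a ln ln =
      2 / x ln ^ 2 * (1 - Mb b ψ ln x ln ln * a ln ln) - 2 * f₁ (x ln) / x ln * a ln ln := by
    field_simp
    ring
  have e2 : 2 / x ln ^ 2 * (1 - Mb b ψ ln x ln ln * a ln ln) ≤ 0 :=
    mul_nonpos_of_nonneg_of_nonpos (by positivity) (by linarith)
  rw [e1] at hlimit
  have e3 : (f₂ (x ln) + (b + 2) * f₁ (x ln) / x ln) * a ln ln =
      (f₂ (x ln) + b * f₁ (x ln) / x ln) * a ln ln + 2 * f₁ (x ln) / x ln * a ln ln := by ring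
  rw [e3]
  linarith

end Touch

lemma jet2_barrier (A κ b : ℝ) {t : ℝ} (ht : 0 < t) :
    Jet2 (fun t : ℝ => A * t ^ 2 - κ * t ^ (-1 - b)) t
      (A * (2 * t) - κ * ((-1 - b) * t ^ (-2 - b)))
      (A * 2 - κ * ((-1 - b) * ((-2 - b) * t ^ (-3 - b)))) := by
  have h1 : ∀ (p q : ℝ), p - 1 = q → ∀ s : ℝ, 0 < s →
      HasDerivAt (fun s : ℝ => s ^ p) (p * s ^ q) s :=
    fun p q hpq s hs => hpq ▸ Real.hasDerivAt_rpow_const (Or.inl hs.ne')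
  refine ⟨fun t => A * (2 * t) - κ * ((-1 - b) * t ^ (-2 - b)), ?_, rfl, ?_⟩
  · filter_upwards [lt_mem_nhds ht] with s hs
    refine (((hasDerivAt_id s).pow 2).const_mul A |>.sub
      ((h1 (-1 - b) (-2 - b) (by ring) s hs).const_mul κ)).congr_deriv ?_
    simp
  · refine ((((hasDerivAt_id t).const_mul 2).const_mul A).sub
      (((h1 (-2 - b) (-3 - b) (by ring) t ht).const_mul (-1 - b)).const_mul κ)).congr_deriv ?_
    simp

section Ratio

variable {n : ℕ} {b Λ L : ℝ} {ln : Fin n} {ψ : Eu n → ℝ} {Dψ : Eu n → (Eu n →L[ℝ] ℝ)}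

lemma Sol.normalRatio_le (h : Sol b Λ L ln ψ Dψ) {x : Eu n} (hx : 0 < x ln) :
    normalRatio Dψ ln x ≤ L := by
  rw [normalRatio, div_le_iff₀ hx]
  exact (le_abs_self _).trans (h.abs_normal_le hx.le)

/-- Comparison with an explicit barrier in a cylinder of radius `R` and height `δ * R`. -/
lemma Sol.normalRatio_barrier (h : Sol b Λ L ln ψ Dψ) (hb : -1 < b) {Z ε R δ K : ℝ} (hε : 0 < ε)
    (hR : 0 < R) (hK : 0 < K) (hKΛ : n * Λ < K * (3 + b) * Λ⁻¹) (hKδ : K * δ ^ 2 ≤ 1 / 2)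
    (hZ : ∀ x : Eu n, 0 < x ln → normalRatio Dψ ln x ≤ Z)
    (htop : ∀ x : Eu n, qf (Tn ln) x ≤ R ^ 2 → 0 < x ln → x ln = δ * R →
      normalRatio Dψ ln x ≤ Z - ε)
    {z : Eu n} (hzT : qf (Tn ln) z ≤ R ^ 2) (hz0 : 0 < z ln) (hzδ : z ln ≤ δ * R) :
    normalRatio Dψ ln z ≤ Z - ε * (1 / 2 - qf (Tn ln) z / R ^ 2 + K * z ln ^ 2 / R ^ 2) := by
  have hb1 : 0 < 1 + b := by linarith
  have hΛ := h.pos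
  by_contra! hcon
  set g := normalRatio Dψ ln z -
    (Z - ε * (1 / 2 - qf (Tn ln) z / R ^ 2 + K * z ln ^ 2 / R ^ 2)) with hg
  have hg0 : 0 < g := sub_pos.2 hcon
  set p := z ln ^ (-1 - b) with hp
  have hp0 : 0 < p := Real.rpow_pos_of_pos hz0 _
  set κ := g / (2 * p) with hκ
  have hκ0 : 0 < κ := by positivity
  have hκp : κ * p = g / 2 := by rw [hκ]; field_simp
  obtain ⟨τ, hτ, hτ0, hτz⟩ : ∃ τ : ℝ, ε ≤ κ * τ ^ (-1 - b) ∧ 0 < τ ∧ τ < z ln := by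
    have h1 : Tendsto (fun t : ℝ => κ * t ^ (-1 - b)) (𝓝[>] 0) atTop :=
      (tendsto_rpow_neg_nhdsGT_zero (by linarith)).const_mul_atTop hκ0
    obtain ⟨τ, h2, h3⟩ := ((h1.eventually_ge_atTop ε).and (Ioo_mem_nhdsGT hz0)).exists
    exact ⟨τ, h2, h3⟩
  have hpc : ∀ q t : ℝ, 0 < t → ContinuousAt (fun t : ℝ => t ^ q) t := fun q t ht =>
    Real.continuousAt_rpow_const t q (Or.inl ht.ne')
  have hKx : ∀ x : Eu n, 0 < x ln → x ln ≤ δ * R → K * x ln ^ 2 / R ^ 2 ≤ 1 / 2 := fun x h0 h1 => by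
    rw [div_le_iff₀ (by positivity)]
    have : x ln ^ 2 ≤ (δ * R) ^ 2 := by gcongr
    nlinarith [mul_le_mul_of_nonneg_left this hK.le, sq_nonneg R]
  obtain ⟨x, hx, hle⟩ := h.normalRatio_touch (r := R ^ 2) (s := τ) (t := δ * R)
    (c := -(2 * ε / R ^ 2)) hτ0
    (fun t ht => jet2_barrier (ε * K / R ^ 2) κ b ht)
    (fun t ht => (by fun_prop : ContinuousAt (fun t : ℝ => ε * K / R ^ 2 * (2 * t)) t).sub
      (continuousAt_const.mul (continuousAt_const.mul (hpc _ t ht))))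
    (fun t ht => continuousAt_const.sub
      (continuousAt_const.mul (continuousAt_const.mul (continuousAt_const.mul (hpc _ t ht)))))
    (z := z) ⟨hzT, hτz.le, hzδ⟩ (fun x hx hxb => by
      have hx0 : 0 < x ln := hτ0.trans_le hx.2.1
      have k1 := hKx x hx0 hx.2.2
      have k2 := hZ x hx0
      have k3 : 0 < κ * x ln ^ (-1 - b) := mul_pos hκ0 (Real.rpow_pos_of_pos hx0 _)
      have hT0 := qf_Tn_nonneg ln x
      have k4 : 0 ≤ qf (Tn ln) x / R ^ 2 := by positivity
      have e1 : ∀ y : Eu n, -(2 * ε / R ^ 2) * (qf (Tn ln) y / 2) +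
          (ε * K / R ^ 2 * y ln ^ 2 - κ * y ln ^ (-1 - b)) =
          ε * (1 / 2 - qf (Tn ln) y / R ^ 2 + K * y ln ^ 2 / R ^ 2) - ε / 2 -
            κ * y ln ^ (-1 - b) := fun y => by ring
      rw [e1, e1, ← hp, hκp]
      suffices hs : normalRatio Dψ ln x ≤
          Z - ε * (1 / 2 - qf (Tn ln) x / R ^ 2 + K * x ln ^ 2 / R ^ 2) + κ * x ln ^ (-1 - b) by
        linarith
      rcases hxb with hxb | hxb | hxb
      · have : qf (Tn ln) x / R ^ 2 = 1 := by rw [hxb]; exact div_self (by positivity)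
        rw [this]
        nlinarith
      · rw [hxb] at k3 ⊢
        rw [hxb] at k1
        nlinarith
      · have := htop x hx.1 hx0 hxb
        nlinarith)
  have hinv := (h.ell x hx).inv (inv_pos.2 hΛ) hΛ
  rw [inv_inv] at hinv
  set a := (Mb b ψ ln x)⁻¹
  have hE : (a.trace - a ln ln) ≤ n * Λ := by
    have h1 := hinv.trace_self_le
    have h2 := hinv.diag_ge ln
    have h3 := inv_pos.2 hΛ
    linarith
  have hpow1 : x ln ^ (-2 - b) = x ln ^ (-3 - b) * x ln := by
    rw [← Real.rpow_add_one hx.ne']; congr 1; ring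
  have e2 : -(2 * ε / R ^ 2) * (a * Tn ln).trace +
      (ε * K / R ^ 2 * 2 - κ * ((-1 - b) * ((-2 - b) * x ln ^ (-3 - b))) +
        (b + 2) * (ε * K / R ^ 2 * (2 * x ln) - κ * ((-1 - b) * x ln ^ (-2 - b))) / x ln) * a ln ln =
      2 * ε / R ^ 2 * (K * (3 + b) * a ln ln - (a.trace - a ln ln)) := by
    rw [hpow1, trace_mul_Tn]
    field_simp
    ring
  rw [e2] at hle
  have h3 : K * (3 + b) * Λ⁻¹ ≤ K * (3 + b) * a ln ln :=
    mul_le_mul_of_nonneg_left (hinv.diag_ge ln) (mul_nonneg hK.le (by linarith))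
  have h4 : 0 < 2 * ε / R ^ 2 * (K * (3 + b) * a ln ln - (a.trace - a ln ln)) :=
    mul_pos (by positivity) (by linarith)
  linarith

end Ratio

section Liouville

variable {n : ℕ} {b Λ L : ℝ} {ln : Fin n} {ψ : Eu n → ℝ} {Dψ : Eu n → (Eu n →L[ℝ] ℝ)} {P : Mt n}
  {𝒰 : Ultrafilter ℕ} {Ψ : Eu n → ℝ} {G : Eu n → (Eu n →L[ℝ] ℝ)}

lemma normalRatio_bdGrad (k : ℕ) (x : Eu n) :
    normalRatio (bdGrad Dψ k) ln x = normalRatio Dψ ln ((2 : ℝ) ^ k • x) := by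
  simp only [normalRatio, bdGrad, _root_.smul_apply, PiLp.smul_apply, smul_eq_mul]
  rw [inv_mul_eq_div, div_div]

lemma BlowLim.tendsto_grad (H : BlowLim ln ψ Dψ 𝒰 Ψ G) (h : Sol b Λ L ln ψ Dψ) {y : Eu n}
    {ys : ℕ → Eu n} (hy : 0 ≤ y ln) (hys : ∀ k, 0 ≤ ys k ln) (hlim : Tendsto ys 𝒰 (𝓝 y)) :
    Tendsto (fun k => bdGrad Dψ k (ys k)) 𝒰 (𝓝 (G y)) := by
  have h1 : Tendsto (fun k => L * ‖ys k - y‖) 𝒰 (𝓝 0) := by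
    simpa using ((hlim.sub_const y).norm.const_mul L)
  have h2 := squeeze_zero_norm (f := fun k => bdGrad Dψ k (ys k) - bdGrad Dψ k y)
    (fun k => (h.blowDown k).lip _ _ (hys k) hy) h1
  simpa using h2.add (H.grad y hy)

lemma BlowLim.normalRatio_eventually_le (H : BlowLim ln ψ Dψ 𝒰 Ψ G) (h : Sol b Λ L ln ψ Dψ)
    (hb : -1 < b) (T : TanForm b ψ ln P) {δ ε : ℝ} (hδ : 0 < δ) (hε : 0 < ε) :
    ∀ᶠ k in (𝒰 : Filter ℕ), ∀ x : Eu n, qf (Tn ln) x ≤ 1 → x ln = δ →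
      normalRatio (bdGrad Dψ k) ln x ≤ nrm ln P / (1 + b) + ε := by
  by_contra hcon
  rw [← Ultrafilter.eventually_not] at hcon
  have hK := isCompact_cylinder ln 1 δ δ
  have hex : ∀ k : ℕ, ∃ x : Eu n, (qf (Tn ln) x ≤ 1 ∧ δ ≤ x ln ∧ x ln ≤ δ) ∧
      ((¬∀ x : Eu n, qf (Tn ln) x ≤ 1 → x ln = δ →
        normalRatio (bdGrad Dψ k) ln x ≤ nrm ln P / (1 + b) + ε) →
        nrm ln P / (1 + b) + ε < normalRatio (bdGrad Dψ k) ln x) := fun k => by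
    by_cases hk : ∀ x : Eu n, qf (Tn ln) x ≤ 1 → x ln = δ →
        normalRatio (bdGrad Dψ k) ln x ≤ nrm ln P / (1 + b) + ε
    · refine ⟨δ • EuclideanSpace.single ln 1, ⟨?_, ?_, ?_⟩, fun h => absurd hk h⟩
      · rw [qf_Tn, norm_smul]; simp
      · simp
      · simp
    · push Not at hk
      obtain ⟨x, h1, h2, h3⟩ := hk
      exact ⟨x, ⟨h1, h2.ge, h2.le⟩, fun _ => h3⟩
  choose xs hxs hlarge using hex
  obtain ⟨x, hx, hlim⟩ := exists_tendsto_ultrafilter hK 𝒰 hxs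
  have hx0 : 0 < x ln := hδ.trans_le hx.2.1
  have h1 : Tendsto (fun k => bdGrad Dψ k (xs k) (EuclideanSpace.single ln 1)) 𝒰
      (𝓝 (G x (EuclideanSpace.single ln 1))) :=
    ((ContinuousLinearMap.apply ℝ ℝ (EuclideanSpace.single ln 1)).continuous.tendsto _).comp
      (H.tendsto_grad h hx0.le (fun k => hδ.le.trans (hxs k).2.1) hlim)
  have h2 : Tendsto (fun k => xs k ln) 𝒰 (𝓝 (x ln)) :=
    ((by fun_prop : Continuous fun x : Eu n => x ln).tendsto x).comp hlim
  have h3 := h1.div h2 hx0.ne'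
  rw [H.normal_eq h hb T hx0, mul_div_cancel_right₀ _ hx0.ne'] at h3
  have := ge_of_tendsto h3 (hcon.mono fun k hk => (hlarge k hk).le)
  linarith

/-- The normal derivative of an entire solution is linear in the normal coordinate. -/
lemma BlowLim.normalRatio_eq (H : BlowLim ln ψ Dψ 𝒰 Ψ G) (h : Sol b Λ L ln ψ Dψ)
    (hb : -1 < b) (T : TanForm b ψ ln P) {x : Eu n} (hx : 0 < x ln) :
    normalRatio Dψ ln x = nrm ln P / (1 + b) := by
  set c := nrm ln P / (1 + b) with hc
  have hge : ∀ y : Eu n, 0 < y ln → c ≤ normalRatio Dψ ln y := fun y hy => by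
    rw [normalRatio, le_div_iff₀ hy]
    exact T.normal_deriv_ge h hb hy
  set S := (normalRatio Dψ ln) '' {y | 0 < y ln} with hS
  have hne : S.Nonempty := ⟨_, x, hx, rfl⟩
  have hbdd : BddAbove S := ⟨L, by rintro _ ⟨y, hy, rfl⟩; exact h.normalRatio_le hy⟩
  set Z := sSup S with hZ
  have hZle : ∀ y : Eu n, 0 < y ln → normalRatio Dψ ln y ≤ Z := fun y hy =>
    le_csSup hbdd ⟨y, hy, rfl⟩
  refine le_antisymm ?_ (hge x hx)
  by_contra! hlt
  have hcZ : c < Z := hlt.trans_le (hZle x hx)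
  set ε := (Z - c) / 2 with hε
  have hε0 : 0 < ε := by rw [hε]; linarith
  have hΛ := h.pos
  have hn : (0 : ℝ) < n := by exact_mod_cast ln.pos
  have hb3 : 0 < 3 + b := by linarith
  obtain ⟨K, hK, hKΛ⟩ : ∃ K : ℝ, 0 < K ∧ n * Λ < K * (3 + b) * Λ⁻¹ := by
    refine ⟨2 * (n * Λ * Λ / (3 + b)), by positivity, ?_⟩
    have : 2 * (n * Λ * Λ / (3 + b)) * (3 + b) * Λ⁻¹ = 2 * (n * Λ) := by field_simp
    rw [this]
    linarith [mul_pos hn hΛ]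
  obtain ⟨δ, hδ, hKδ⟩ : ∃ δ : ℝ, 0 < δ ∧ K * δ ^ 2 ≤ 1 / 2 := by
    refine ⟨√(1 / (2 * K)), by positivity, ?_⟩
    rw [Real.sq_sqrt (by positivity)]
    exact le_of_eq (by field_simp)
  have hall : ∀ y : Eu n, 0 < y ln → normalRatio Dψ ln y ≤ Z - ε / 4 := fun y hy => by
    have hev := H.normalRatio_eventually_le h hb T hδ hε0
    have hpow : Tendsto (fun k : ℕ => (2 : ℝ) ^ k) 𝒰 atTop :=
      (tendsto_pow_atTop_atTop_of_one_lt one_lt_two).mono_left H.le_atTop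
    obtain ⟨k, hk, h1, h2⟩ := (hev.and ((hpow.eventually_ge_atTop (2 * ‖y‖)).and
      (hpow.eventually_ge_atTop (y ln / δ)))).exists
    set R := (2 : ℝ) ^ k with hR
    have hR0 : 0 < R := by positivity
    have hqy : qf (Tn ln) y ≤ R ^ 2 / 4 := by
      rw [qf_Tn]
      nlinarith [norm_nonneg y, sq_nonneg (y ln)]
    have key := h.normalRatio_barrier hb hε0 hR0 hK hKΛ hKδ hZle (fun w hw hw0 hwδ => by
      have h3 := hk (R⁻¹ • w) (by
        rw [qf_vec_smul, inv_pow, inv_mul_le_iff₀ (by positivity)]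
        linarith) (by
        rw [PiLp.smul_apply, smul_eq_mul, hwδ]
        field_simp)
      rw [normalRatio_bdGrad, ← hR, smul_inv_smul₀ hR0.ne'] at h3
      linarith) (hqy.trans (by nlinarith)) hy (by rwa [div_le_iff₀ hδ, mul_comm] at h2)
    have h3 : qf (Tn ln) y / R ^ 2 ≤ 1 / 4 := by
      rw [div_le_iff₀ (by positivity)]; linarith
    have h4 : 0 ≤ K * y ln ^ 2 / R ^ 2 := by positivity
    nlinarith
  have : Z ≤ Z - ε / 4 := csSup_le hne (by rintro _ ⟨y, hy, rfl⟩; exact hall y hy)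
  linarith

/-- Liouville theorem: the Hessian of an entire solution is constant. -/
lemma BlowLim.hs_eq (H : BlowLim ln ψ Dψ 𝒰 Ψ G) (h : Sol b Λ L ln ψ Dψ)
    (hb : -1 < b) (T : TanForm b ψ ln P) {x : Eu n} (hx : 0 < x ln) :
    hs ψ x = P + (nrm ln P / (1 + b)) • En ln := by
  have hb1 : 1 + b ≠ 0 := by linarith
  set N := nrm ln P with hN
  have hN0 : 0 < N := T.nrm_pos h
  set c := N / (1 + b) with hc
  have hcN : c + b * c = N := by rw [hc]; field_simp
  have hpd : ∀ y : Eu n, 0 < y ln → pd ψ ln y = c * y ln := fun y hy => by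
    have := H.normalRatio_eq h hb T hy
    rwa [normalRatio, div_eq_iff hy.ne', ← h.pd_eq hy] at this
  have hcol : ∀ i, hs ψ x i ln = if i = ln then c else 0 := fun i => by
    have h1 : HasFDerivAt (pd ψ ln) (c • (EuclideanSpace.proj ln : Eu n →L[ℝ] ℝ)) x := by
      refine ((EuclideanSpace.proj ln : Eu n →L[ℝ] ℝ).hasFDerivAt.const_mul
        c).congr_of_eventuallyEq ?_
      filter_upwards [(isOpen_upper ln).mem_nhds hx] with y hy
      exact hpd y hy
    simp only [hs, of_apply, pd2]
    rw [pd, h1.fderiv]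
    simp [PiLp.single_apply, eq_comm]
  have hsy : (hs ψ x).transpose = hs ψ x := hs_symm (h.smooth x hx)
  have hE1 : hs ψ x * En ln = c • En ln := by
    ext i j
    by_cases hj : j = ln
    · subst hj
      simp [En, hcol, Matrix.single_apply, eq_comm]
    · simp [En, hj, Ne.symm hj]
  have hE2 : En ln * hs ψ x = c • En ln := by
    have := congrArg transpose hE1
    rwa [transpose_mul, transpose_smul, En_transpose, hsy] at this
  have hM : Mb b ψ ln x = hs ψ x + (b * c) • En ln := by
    rw [Mb_eq, hpd x hx, ← mul_assoc, mul_div_cancel_right₀ _ hx.ne']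
  have hMnn : Mb b ψ ln x ln ln = N := by
    rw [hM, Matrix.add_apply, Matrix.smul_apply, hcol, if_pos rfl]
    simp [En, hcN]
  have hTMT : Tn ln * Mb b ψ ln x * Tn ln = hs ψ x - c • En ln := by
    rw [hM, Tn]
    simp only [Matrix.sub_mul, Matrix.mul_sub, Matrix.mul_add, Matrix.add_mul, Matrix.one_mul,
      Matrix.mul_one, Matrix.mul_smul, Matrix.smul_mul, hE1, hE2, En_mul_self]
    module
  have hpsd := T.psd_sub h hx
  have htr := T.trace_defect h hx
  rw [hMnn, ← hN, div_self hN0.ne', sub_self] at htr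
  have hlo : 0 < min Λ⁻¹ N := lt_min (inv_pos.2 h.pos) hN0
  have hup : 0 < max Λ N := lt_max_of_lt_left h.pos
  have h1 := ((T.ell h (N := N)).inv hlo hup).trace_ge hpsd
  have h2 : (P - Tn ln * Mb b ψ ln x * Tn ln).trace = 0 := by
    refine le_antisymm ?_ hpsd.trace_nonneg
    by_contra! h3
    linarith [mul_pos (inv_pos.2 hup) h3]
  have h3 := hpsd.trace_eq_zero_iff.1 h2
  rw [hTMT, sub_eq_zero] at h3
  rw [h3]
  abel

end Liouville

lemma fderiv_fderiv_eq_of_hs_eq {n : ℕ} {v : Eu n → ℝ} {x y : Eu n} (hx : ContDiffAt ℝ 2 v x)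
    (hy : ContDiffAt ℝ 2 v y) (he : hs v x = hs v y) :
    fderiv ℝ (fderiv ℝ v) x = fderiv ℝ (fderiv ℝ v) y := by
  ext1 ξ
  ext1 η
  rw [snd_eq_sum hx, snd_eq_sum hy]
  have : ∀ i j, pd2 v i j x = pd2 v i j y := fun i j => congrFun (congrFun he i) j
  simp only [this]

lemma Sol.exists_hessian {n : ℕ} {b Λ L : ℝ} {ln : Fin n} {ψ : Eu n → ℝ}
    {Dψ : Eu n → (Eu n →L[ℝ] ℝ)} (h : Sol b Λ L ln ψ Dψ) (hb : -1 < b) :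
    ∃ A : Eu n →L[ℝ] Eu n →L[ℝ] ℝ, ∀ x : Eu n, 0 < x ln → A = fderiv ℝ (fderiv ℝ ψ) x := by
  obtain ⟨𝒰, Ψ, G, H⟩ := h.exists_blowLim
  obtain ⟨P, T⟩ := H.exists_tanForm h hb
  have h0 : 0 < (EuclideanSpace.single ln 1 : Eu n) ln := by simp
  exact ⟨fderiv ℝ (fderiv ℝ ψ) (EuclideanSpace.single ln 1), fun x hx =>
    fderiv_fderiv_eq_of_hs_eq (h.smooth _ h0) (h.smooth x hx)
      ((H.hs_eq h hb T h0).trans (H.hs_eq h hb T hx).symm)⟩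

end RegularityProof

theorem stmt9 (n : ℕ) (hn : 2 ≤ n) (ln : Fin n) (hln : (ln : ℕ) = n - 1)
    (b : ℝ) (hb : -1 < b)
    (ψ : Eu n → ℝ) (Dψ : Eu n → (Eu n →L[ℝ] ℝ)) (L : NNReal)
    -- ψ is C¹ on the closed half-space with gradient Dψ, which is Lipschitz there
    (hC1 : ∀ x : Eu n, 0 ≤ x ln →
      HasFDerivWithinAt ψ (Dψ x) {y : Eu n | 0 ≤ y ln} x)
    (hLip : LipschitzOnWith L Dψ {y : Eu n | 0 ≤ y ln})
    -- ψ is C² in the open half-space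
    (hC2 : ContDiffOn ℝ 2 ψ {y : Eu n | 0 < y ln})
    -- det M_b[ψ] = 1 in the open half-space
    (heq : ∀ x : Eu n, 0 < x ln → (Mb b ψ ln x).det = 1)
    -- Neumann boundary condition ψ_{x_n}(x',0) = 0
    (hbdry : ∀ x : Eu n, x ln = 0 → Dψ x (EuclideanSpace.single ln 1) = 0)
    -- uniform ellipticity
    (Chat : ℝ) (hChat : 0 < Chat)
    (hell : ∀ x : Eu n, 0 < x ln →
      matLE (Chat⁻¹ • (1 : Matrix (Fin n) (Fin n) ℝ)) (Mb b ψ ln x) ∧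
      matLE (Mb b ψ ln x) (Chat • (1 : Matrix (Fin n) (Fin n) ℝ))) :
    -- conclusion: ψ ∈ C^{2,α} up to the boundary
    ∃ α : ℝ, α ∈ Set.Ioo (0 : ℝ) 1 ∧
      ∃ H : Eu n → (Eu n →L[ℝ] Eu n →L[ℝ] ℝ),
        -- H is a continuous extension of D²ψ to the closed half-space …
        ContinuousOn H {y : Eu n | 0 ≤ y ln} ∧
        (∀ x : Eu n, 0 < x ln → H x = fderiv ℝ (fderiv ℝ ψ) x) ∧
        -- … which is α-Hölder on the slab ℝ^{n-1} × [0,1]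
        ∃ C : ℝ, 0 < C ∧
          ∀ x y : Eu n, 0 ≤ x ln → x ln ≤ 1 → 0 ≤ y ln → y ln ≤ 1 →
            ‖H x - H y‖ ≤ C * ‖x - y‖ ^ α := by
  have h : Sol b Chat L ln ψ Dψ :=
    { pos := hChat
      lip_nonneg := NNReal.coe_nonneg L
      der := hC1
      lip := fun x y hx hy => by simpa [dist_eq_norm] using hLip.dist_le_mul x hx y hy
      smooth := fun x hx => hC2.contDiffAt ((isOpen_upper ln).mem_nhds hx)
      det := heq
      bdry := hbdry
      ell := fun x hx => hell x hx }
  obtain ⟨A, hA⟩ := h.exists_hessian hb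
  refine ⟨1 / 2, by norm_num, fun _ => A, continuousOn_const, hA, 1, one_pos,
    fun x y _ _ _ _ => ?_⟩
  rw [show A - A = 0 from sub_self A]
  exact ContinuousLinearMap.opNorm_zero.trans_le
    (mul_nonneg zero_le_one (Real.rpow_nonneg (norm_nonneg _) _))
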